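/- In the net setting for distance-regular graphs with d → ∞ and Assumption (DR), the net λ ↦ 1/k(λ) ∈ (0, 1/2] has exactly one accumulation point; more precisely, either k = 2 eventually along the net, or k → ∞ along the net. -/

import Mathlib

open Matrix Filter

/-- A (bundled) distance-regular graph: a finite connected simple graph of diameter `d`
with intersection numbers `a i`, `b i`, `c i` for `0 ≤ i ≤ d`; `b 0` is the valency `k`. -/
structure DRG where
  X : Type
  fin : Fintype X
  G : SimpleGraph X
  d : ℕ
  a : ℕ → ℕ
  b : ℕ → ℕ
  c : ℕ → ℕ
  conn : G.Connected
  dist_le : ∀ x y : X, G.dist x y ≤ d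
  dist_eq : ∃ x y : X, G.dist x y = d
  bd : b d = 0
  c0 : c 0 = 0
  count_c : ∀ i ≤ d, ∀ x y : X, G.dist x y = i →
      {z : X | G.Adj y z ∧ G.dist x z = i - 1}.ncard = c i
  count_a : ∀ i ≤ d, ∀ x y : X, G.dist x y = i →
      {z : X | G.Adj y z ∧ G.dist x z = i}.ncard = a i
  count_b : ∀ i ≤ d, ∀ x y : X, G.dist x y = i →
      {z : X | G.Adj y z ∧ G.dist x z = i + 1}.ncard = b i

attribute [instance] DRG.fin

noncomputable instance (Γ : DRG) : DecidableEq Γ.X := Classical.decEq _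

noncomputable instance (Γ : DRG) : DecidableRel Γ.G.Adj := fun _ _ => Classical.dec _

namespace DRG

variable (Γ : DRG)

/-- The `i`-th distance matrix (over `ℂ`). -/
noncomputable def Amat (i : ℕ) : Matrix Γ.X Γ.X ℂ :=
  Matrix.of fun x y => if Γ.G.dist x y = i then 1 else 0

/-- The adjacency algebra `A(Γ) = span_ℂ {A_0, …, A_d}`. -/
noncomputable def adjAlg : Submodule ℂ (Matrix Γ.X Γ.X ℂ) :=
  Submodule.span ℂ {M | ∃ i ≤ Γ.d, M = Γ.Amat i}

/-- The matrix `K_t = (t^{∂(x,y)})_{x,y}` (over `ℝ`). -/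
noncomputable def Kmat (t : ℝ) : Matrix Γ.X Γ.X ℝ :=
  Matrix.of fun x y => t ^ Γ.G.dist x y

/-- `t ∈ π(Γ)`, i.e. `K_t` is positive semidefinite. -/
def piMem (t : ℝ) : Prop := (Γ.Kmat t).PosSemidef

/-- The Gibbs functional `φ_t(B) = ∑_x t^{∂(x,o)} B_{x,o}` with base vertex `o`. -/
noncomputable def gibbs (t : ℝ) (o : Γ.X) (B : Matrix Γ.X Γ.X ℂ) : ℂ :=
  ∑ x : Γ.X, (t : ℂ) ^ Γ.G.dist x o * B x o

end DRG

section Net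

variable {Λ : Type*} [Preorder Λ] [IsDirected Λ (· ≤ ·)] [Nonempty Λ]

/-- The variance `Σ_t²(A) = k(1−t)(1+t+t·a₁)` as a function of the net index. -/
noncomputable def sig2 (Γ : Λ → DRG) (t : Λ → ℝ) (l : Λ) : ℝ :=
  ((Γ l).b 0 : ℝ) * (1 - t l) * (1 + t l + t l * ((Γ l).a 1 : ℝ))

/-- `ω̄_i = c_i b_{i−1} / Σ_t²(A)`. -/
noncomputable def omegaBar (Γ : Λ → DRG) (t : Λ → ℝ) (i : ℕ) (l : Λ) : ℝ :=
  (((Γ l).c i : ℝ) * ((Γ l).b (i - 1) : ℝ)) / sig2 Γ t l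

/-- `ᾱ_i = (a_{i−1} − t·k) / Σ_t(A)`. -/
noncomputable def alphaBar (Γ : Λ → DRG) (t : Λ → ℝ) (i : ℕ) (l : Λ) : ℝ :=
  (((Γ l).a (i - 1) : ℝ) - t l * ((Γ l).b 0 : ℝ)) / Real.sqrt (sig2 Γ t l)

/-- `k_i = (b₀⋯b_{i−1})/(c₁⋯c_i)` as a real number. -/
noncomputable def kiProd (Γ : Λ → DRG) (i : ℕ) (l : Λ) : ℝ :=
  (∏ h ∈ Finset.range i, ((Γ l).b h : ℝ)) / (∏ h ∈ Finset.range i, ((Γ l).c (h + 1) : ℝ))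

/-- `γ̄_i = t^i √(k_i)`. -/
noncomputable def gammaBar (Γ : Λ → DRG) (t : Λ → ℝ) (i : ℕ) (l : Λ) : ℝ :=
  t l ^ i * Real.sqrt (kiProd Γ i l)

/-- Assumption (DR): for every `i ≥ 1` the limits `ω_i = lim ω̄_i` and `α_i = lim ᾱ_i`
exist (with prescribed values `ω i`, `αl i`) and `ω_i > 0`. -/
def AssumptionDR (Γ : Λ → DRG) (t : Λ → ℝ) (ω αl : ℕ → ℝ) : Prop :=
  ∀ i : ℕ, 1 ≤ i → 0 < ω i ∧ Tendsto (omegaBar Γ t i) atTop (nhds (ω i)) ∧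
    Tendsto (alphaBar Γ t i) atTop (nhds (αl i))

end Net

/-- The polynomials attached to an array of intersection numbers. -/
noncomputable def arrP (a b c : ℕ → ℕ) : ℕ → Polynomial ℚ
  | 0 => 1
  | 1 => Polynomial.X
  | (i + 2) => Polynomial.C ((c (i + 2) : ℚ)⁻¹) *
      ((Polynomial.X - Polynomial.C (a (i + 1) : ℚ)) * arrP a b c (i + 1) -
        Polynomial.C (b i : ℚ) * arrP a b c i)

/-- The numbers `k_i` attached to an array of intersection numbers. -/
noncomputable def arrK (b c : ℕ → ℕ) (i : ℕ) : ℚ :=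
  ∏ h ∈ Finset.range i, ((b h : ℚ) / (c (h + 1) : ℚ))

/-- The sum `∑ p_i ^ 2 / k_i`, the reciprocal of the Christoffel function. -/
noncomputable def arrF (a b c : ℕ → ℕ) (d : ℕ) : Polynomial ℚ :=
  ∑ i ∈ Finset.range (d + 1), Polynomial.C (arrK b c i)⁻¹ * arrP a b c i ^ 2

/-- The properties of the intersection array of a distance-regular graph of valency `k` that
are used below. -/
structure IntArray (k : ℕ) where
  d : ℕ
  a : ℕ → ℕ
  b : ℕ → ℕ
  c : ℕ → ℕ
  two_le : 2 ≤ d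
  b0 : b 0 = k
  c1 : c 1 = 1
  a0 : a 0 = 0
  c0 : c 0 = 0
  sum_eq : ∀ i ≤ d, a i + b i + c i = k
  bpos : ∀ i < d, 1 ≤ b i
  cpos : ∀ i, 1 ≤ i → i ≤ d → 1 ≤ c i
  cmono : ∀ i j, i ≤ j → j ≤ d → c i ≤ c j
  banti : ∀ i j, i ≤ j → j ≤ d → b j ≤ b i
  cb : ∀ i j, i + j ≤ d → c i ≤ b j
  rat : ∀ x : ℝ, (x - a d) * Polynomial.aeval x (arrP a b c d) =
      b (d - 1) * Polynomial.aeval x (arrP a b c (d - 1)) →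
      ∃ z : ℚ, Polynomial.aeval x (arrF a b c d) = (z : ℝ)

lemma Matrix.exists_trace_eq_natCast_of_isIdempotentElem {n : Type*} [Fintype n] [DecidableEq n]
    {M : Matrix n n ℝ} (h : M * M = M) : ∃ r : ℕ, M.trace = r := by
  have he : IsIdempotentElem (Matrix.toLin' M) := by
    unfold IsIdempotentElem
    rw [Module.End.mul_eq_comp, ← Matrix.toLin'_mul, h]
  refine ⟨Module.finrank ℝ (LinearMap.range (Matrix.toLin' M)), ?_⟩
  rw [← LinearMap.IsProj.trace (LinearMap.IsIdempotentElem.isProj_range _ he), Matrix.trace_toLin'_eq]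

namespace DRG

variable (Γ : DRG)

lemma exists_between {x y : Γ.X} {i : ℕ} (hi : i ≤ Γ.G.dist x y) :
    ∃ z, Γ.G.dist x z = i ∧ Γ.G.dist z y = Γ.G.dist x y - i := by
  obtain ⟨p, hp⟩ := Γ.conn.exists_walk_length_eq_dist x y
  refine ⟨p.getVert i, ?_⟩
  have h1 : Γ.G.dist x (p.getVert i) ≤ i := by
    refine (SimpleGraph.dist_le (p.take i)).trans ?_
    simp
  have h2 : Γ.G.dist (p.getVert i) y ≤ Γ.G.dist x y - i := by
    refine (SimpleGraph.dist_le (p.drop i)).trans ?_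
    simp [hp]
  have h3 := Γ.conn.dist_triangle (u := x) (v := p.getVert i) (w := y)
  omega

lemma exists_dist_eq {i : ℕ} (hi : i ≤ Γ.d) : ∃ x y : Γ.X, Γ.G.dist x y = i := by
  obtain ⟨x, y, h⟩ := Γ.dist_eq
  obtain ⟨z, hz, -⟩ := Γ.exists_between (x := x) (y := y) (i := i) (by omega)
  exact ⟨x, z, hz⟩

lemma sum_adj (x y : Γ.X) (g : ℕ → ℝ) :
    ∑ z, (if Γ.G.Adj y z then g (Γ.G.dist x z) else 0) =
      Γ.c (Γ.G.dist x y) * g (Γ.G.dist x y - 1) + Γ.a (Γ.G.dist x y) * g (Γ.G.dist x y) +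
        Γ.b (Γ.G.dist x y) * g (Γ.G.dist x y + 1) := by
  classical
  set i := Γ.G.dist x y with hi
  have hid : i ≤ Γ.d := Γ.dist_le x y
  rw [← Γ.count_c i hid x y rfl, ← Γ.count_a i hid x y rfl, ← Γ.count_b i hid x y rfl]
  have key : ∀ (P : Γ.X → Prop) (r : ℝ), ({z | P z}.ncard : ℝ) * r = ∑ z, if P z then r else 0 := by
    intro P r
    rw [Set.ncard_eq_toFinset_card', ← Finset.sum_filter]
    simp
  rw [key, key, key, ← Finset.sum_add_distrib, ← Finset.sum_add_distrib]
  refine Finset.sum_congr rfl fun z _ => ?_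
  by_cases hz : Γ.G.Adj y z
  · simp only [hz, true_and, if_true]
    have h0 : i = 0 → Γ.G.dist x z ≠ 0 := by
      intro h h'
      rw [hi, Γ.conn.dist_eq_zero_iff] at h
      rw [Γ.conn.dist_eq_zero_iff] at h'
      exact hz.ne (h.symm.trans h')
    rcases hz.diff_dist_adj (u := x) with h | h | h
    · have : Γ.G.dist x z ≠ i - 1 := by omega
      rw [if_neg this, if_pos (by omega), if_neg (by omega), h]; ring
    · rw [if_neg (by omega), if_neg (by omega), if_pos (by omega), h]; ring
    · rw [if_pos (by omega), if_neg (by omega), if_neg (by omega), h]; ring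
  · simp [hz]

lemma sum_abc {i : ℕ} (hi : i ≤ Γ.d) : Γ.a i + Γ.b i + Γ.c i = Γ.b 0 := by
  obtain ⟨x, y, hxy⟩ := Γ.exists_dist_eq hi
  have h1 := Γ.sum_adj x y (fun _ => 1)
  have h2 := Γ.sum_adj y y (fun _ => 1)
  have ha0 : Γ.a 0 = 0 := by
    rw [← Γ.count_a 0 (Nat.zero_le _) y y (by simp), Set.ncard_eq_zero]
    ext z
    simp only [Set.mem_ofPred_eq, Set.mem_empty_iff_false, iff_false, not_and,
      Γ.conn.dist_eq_zero_iff]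
    rintro h rfl
    exact h.ne rfl
  rw [SimpleGraph.dist_self, h1, hxy, Γ.c0, ha0] at h2
  have h3 : ((Γ.c i + Γ.a i + Γ.b i : ℕ) : ℝ) = (Γ.b 0 : ℕ) := by
    push_cast at h2 ⊢; linarith
  have h4 : Γ.c i + Γ.a i + Γ.b i = Γ.b 0 := by exact_mod_cast h3
  omega

lemma a_zero : Γ.a 0 = 0 := by
  have := Γ.sum_abc (Nat.zero_le _)
  rw [Γ.c0] at this
  omega

lemma b_pos {i : ℕ} (hi : i < Γ.d) : 1 ≤ Γ.b i := by
  obtain ⟨x, y, hxy⟩ := Γ.exists_dist_eq (i := i + 1) hi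
  obtain ⟨z, hz, hz'⟩ := Γ.exists_between (x := x) (y := y) (i := i) (by omega)
  rw [← Γ.count_b i hi.le x z hz, Nat.one_le_iff_ne_zero]
  exact Set.ncard_ne_zero_of_mem (a := y)
    ⟨SimpleGraph.dist_eq_one_iff_adj.1 (by omega), hxy⟩ (Set.toFinite _)

lemma c_pos {i : ℕ} (h1 : 1 ≤ i) (hi : i ≤ Γ.d) : 1 ≤ Γ.c i := by
  obtain ⟨x, y, hxy⟩ := Γ.exists_dist_eq hi
  obtain ⟨z, hz, hz'⟩ := Γ.exists_between (x := x) (y := y) (i := i - 1) (by omega)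
  rw [← Γ.count_c i hi x y hxy, Nat.one_le_iff_ne_zero]
  exact Set.ncard_ne_zero_of_mem (a := z)
    ⟨(SimpleGraph.dist_eq_one_iff_adj.1 (by omega)).symm, hz⟩ (Set.toFinite _)

lemma c_one (h1 : 1 ≤ Γ.d) : Γ.c 1 = 1 := by
  obtain ⟨x, y, hxy⟩ := Γ.exists_dist_eq h1
  rw [← Γ.count_c 1 h1 x y hxy, Set.ncard_eq_one]
  refine ⟨x, ?_⟩
  ext z
  simp only [Set.mem_ofPred_eq, Set.mem_singleton_iff, Nat.sub_self, Γ.conn.dist_eq_zero_iff]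
  constructor
  · rintro ⟨-, h⟩; exact h.symm
  · rintro rfl; exact ⟨(SimpleGraph.dist_eq_one_iff_adj.1 hxy).symm, rfl⟩

lemma c_le_b {i j : ℕ} (hij : i + j ≤ Γ.d) : Γ.c i ≤ Γ.b j := by
  obtain ⟨x, z, hxz⟩ := Γ.exists_dist_eq hij
  obtain ⟨y, hy, hy'⟩ := Γ.exists_between (x := x) (y := z) (i := j) (by omega)
  rcases Nat.eq_zero_or_pos i with rfl | hi
  · simp [Γ.c0]
  rw [← Γ.count_c i (by omega) z y (by rw [SimpleGraph.dist_comm]; omega),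
    ← Γ.count_b j (by omega) x y hy]
  refine Set.ncard_le_ncard ?_ (Set.toFinite _)
  rintro w ⟨hw, hw'⟩
  refine ⟨hw, ?_⟩
  have h1 := Γ.conn.dist_triangle (u := x) (v := y) (w := w)
  have h2 := Γ.conn.dist_triangle (u := x) (v := w) (w := z)
  rw [SimpleGraph.dist_eq_one_iff_adj.2 hw] at h1
  rw [Γ.G.dist_comm (u := w)] at h2
  omega

lemma c_le_succ {i : ℕ} (hi : i + 1 ≤ Γ.d) : Γ.c i ≤ Γ.c (i + 1) := by
  obtain ⟨x, y, hxy⟩ := Γ.exists_dist_eq hi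
  obtain ⟨x', hx, hx'⟩ := Γ.exists_between (x := x) (y := y) (i := 1) (by omega)
  rcases Nat.eq_zero_or_pos i with rfl | hi0
  · simp [Γ.c0]
  rw [← Γ.count_c i (by omega) x' y (by omega), ← Γ.count_c (i + 1) hi x y hxy]
  refine Set.ncard_le_ncard ?_ (Set.toFinite _)
  rintro w ⟨hw, hw'⟩
  refine ⟨hw, ?_⟩
  have h1 := Γ.conn.dist_triangle (u := x) (v := x') (w := w)
  have h2 := Γ.conn.dist_triangle (u := x) (v := w) (w := y)
  rw [SimpleGraph.dist_eq_one_iff_adj.2 hw.symm] at h2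
  omega

lemma b_succ_le {i : ℕ} (hi : i + 1 ≤ Γ.d) : Γ.b (i + 1) ≤ Γ.b i := by
  obtain ⟨x, y, hxy⟩ := Γ.exists_dist_eq hi
  obtain ⟨x', hx, hx'⟩ := Γ.exists_between (x := x) (y := y) (i := 1) (by omega)
  rw [← Γ.count_b i (by omega) x' y (by omega), ← Γ.count_b (i + 1) hi x y hxy]
  refine Set.ncard_le_ncard ?_ (Set.toFinite _)
  rintro w ⟨hw, hw'⟩
  refine ⟨hw, ?_⟩
  have h1 := Γ.conn.dist_triangle (u := x) (v := x') (w := w)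
  have h2 := Γ.conn.dist_triangle (u := x') (v := y) (w := w)
  rw [SimpleGraph.dist_eq_one_iff_adj.2 hw] at h2
  omega

lemma c_mono {i j : ℕ} (hij : i ≤ j) (hj : j ≤ Γ.d) : Γ.c i ≤ Γ.c j := by
  induction j, hij using Nat.le_induction with
  | base => exact le_rfl
  | succ j _ ih => exact (ih (by omega)).trans (Γ.c_le_succ hj)

lemma b_anti {i j : ℕ} (hij : i ≤ j) (hj : j ≤ Γ.d) : Γ.b j ≤ Γ.b i := by
  induction j, hij using Nat.le_induction with
  | base => exact le_rfl
  | succ j _ ih => exact (Γ.b_succ_le hj).trans (ih (by omega))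

end DRG

namespace DRG

variable (Γ : DRG)

lemma arrK_pos {b c : ℕ → ℕ} {d : ℕ} (hb : ∀ i < d, 1 ≤ b i)
    (hc : ∀ i, 1 ≤ i → i ≤ d → 1 ≤ c i) {i : ℕ} (hi : i ≤ d) : 0 < arrK b c i := by
  refine Finset.prod_pos fun h hh => ?_
  rw [Finset.mem_range] at hh
  have h1 := hb h (by omega)
  have h2 := hc (h + 1) (by omega) (by omega)
  positivity

lemma arrK_succ {b c : ℕ → ℕ} {d : ℕ} (hc : ∀ i, 1 ≤ i → i ≤ d → 1 ≤ c i) {i : ℕ}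
    (hi : i + 1 ≤ d) : c (i + 1) * arrK b c (i + 1) = arrK b c i * b i := by
  have h2 := hc (i + 1) (by omega) (by omega)
  have : (c (i + 1) : ℚ) ≠ 0 := by positivity
  rw [arrK, Finset.prod_range_succ, ← arrK]
  field_simp

lemma arrP_aeval_succ {a b c : ℕ → ℕ} {d : ℕ} (hc : ∀ i, 1 ≤ i → i ≤ d → 1 ≤ c i) (hc1 : c 1 = 1)
    (ha0 : a 0 = 0) {i : ℕ} (hi : i + 1 ≤ d) (x : ℝ) :
    c (i + 1) * Polynomial.aeval x (arrP a b c (i + 1)) =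
      (x - a i) * Polynomial.aeval x (arrP a b c i) -
        (if i = 0 then 0 else b (i - 1) * Polynomial.aeval x (arrP a b c (i - 1))) := by
  rcases i with _ | i
  · simp [arrP, hc1, ha0]
  · have h2 := hc (i + 1 + 1) (by omega) (by omega)
    have : (c (i + 1 + 1) : ℝ) ≠ 0 := by positivity
    simp [arrP]
    field_simp

lemma rat_arrF (x : ℝ) (hd : 2 ≤ Γ.d) (hx : (x - Γ.a Γ.d) *
      Polynomial.aeval x (arrP Γ.a Γ.b Γ.c Γ.d) =
      Γ.b (Γ.d - 1) * Polynomial.aeval x (arrP Γ.a Γ.b Γ.c (Γ.d - 1))) :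
    ∃ z : ℚ, Polynomial.aeval x (arrF Γ.a Γ.b Γ.c Γ.d) = (z : ℝ) := by
  classical
  set p : ℕ → ℝ := fun i => Polynomial.aeval x (arrP Γ.a Γ.b Γ.c i) with hp
  set κ : ℕ → ℝ := fun i => (arrK Γ.b Γ.c i : ℝ) with hκ
  have hκpos : ∀ i ≤ Γ.d, 0 < κ i := fun i hi => by
    have := arrK_pos (fun i h => Γ.b_pos h) (fun i h h' => Γ.c_pos h h') hi
    simp only [hκ]; exact_mod_cast this
  have hκs : ∀ i, i + 1 ≤ Γ.d → Γ.c (i + 1) * κ (i + 1) = κ i * Γ.b i := fun i hi => by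
    have := arrK_succ (b := Γ.b) (fun i h h' => Γ.c_pos h h') hi
    simp only [hκ]; exact_mod_cast this
  have hps : ∀ i, i + 1 ≤ Γ.d → Γ.c (i + 1) * p (i + 1) = (x - Γ.a i) * p i -
      (if i = 0 then 0 else Γ.b (i - 1) * p (i - 1)) := fun i hi =>
    arrP_aeval_succ (fun i h h' => Γ.c_pos h h') (Γ.c_one (by omega)) Γ.a_zero hi x
  have hp0 : p 0 = 1 := by simp [hp, arrP]
  have hκ0 : κ 0 = 1 := by simp [hκ, arrK]
  set u : ℕ → ℝ := fun i => p i / κ i with hu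
  have hpu : ∀ i ≤ Γ.d, p i = κ i * u i := fun i hi => by
    simp only [hu]; field_simp [(hκpos i hi).ne']
  have hur : ∀ i ≤ Γ.d, Γ.c i * u (i - 1) + Γ.a i * u i + Γ.b i * u (i + 1) = x * u i := by
    intro i hi
    have hk := (hκpos i hi).ne'
    have hbb : κ i * (Γ.b i * u (i + 1)) = (x - Γ.a i) * p i -
      (if i = 0 then 0 else Γ.b (i - 1) * p (i - 1)) := by
      rcases hi.lt_or_eq with h | h
      · rw [← hps i h, hpu (i + 1) h]
        linear_combination (-u (i + 1)) * hκs i h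
      · rw [h, Γ.bd, if_neg (by omega), hx]; simp [hp]
    have hcc : κ i * (Γ.c i * u (i - 1)) =
        (if i = 0 then 0 else Γ.b (i - 1) * p (i - 1)) := by
      rcases i with _ | i
      · simp [Γ.c0]
      · simp only [Nat.add_sub_cancel, Nat.add_one_ne_zero, if_false]
        rw [hpu i (by omega)]
        linear_combination (u i) * hκs i hi
    apply mul_left_cancel₀ hk
    linear_combination hbb + hcc - (Γ.a i - x) * hpu i hi
  let D : ℕ → Matrix Γ.X Γ.X ℝ := fun j => Matrix.of fun y z => if Γ.G.dist y z = j then 1 else 0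
  let A : Matrix Γ.X Γ.X ℝ := Matrix.of fun y z => if Γ.G.Adj z y then 1 else 0
  let M : Matrix Γ.X Γ.X ℝ := Matrix.of fun y z => u (Γ.G.dist y z)
  have hmulA : ∀ (g : ℕ → ℝ), (Matrix.of fun y z => g (Γ.G.dist y z)) * A =
      Matrix.of fun y z => Γ.c (Γ.G.dist y z) * g (Γ.G.dist y z - 1) +
        Γ.a (Γ.G.dist y z) * g (Γ.G.dist y z) + Γ.b (Γ.G.dist y z) * g (Γ.G.dist y z + 1) := by
    intro g
    ext y z
    rw [Matrix.mul_apply]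
    simp only [Matrix.of_apply, A]
    rw [← Γ.sum_adj y z g]
    refine Finset.sum_congr rfl fun w _ => ?_
    split_ifs <;> simp
  have hMA : M * A = x • M := by
    rw [hmulA]
    ext y z
    simp only [Matrix.of_apply, Matrix.smul_apply, smul_eq_mul, M]
    exact hur _ (Γ.dist_le y z)
  have hMt : Mᵀ = M := by
    ext y z
    simp only [Matrix.transpose_apply, M, Matrix.of_apply, Γ.G.dist_comm]
  have hAt : Aᵀ = A := by
    ext y z
    simp only [Matrix.transpose_apply, A, Matrix.of_apply, Γ.G.adj_comm]
  have hAM : A * M = x • M := by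
    have := congrArg Matrix.transpose hMA
    rwa [Matrix.transpose_mul, hMt, hAt, Matrix.transpose_smul, hMt] at this
  have hDA : ∀ i, i + 1 ≤ Γ.d → Γ.c (i + 1) • D (i + 1) = D i * A - (Γ.a i : ℝ) • D i -
      (if i = 0 then 0 else (Γ.b (i - 1) : ℝ) • D (i - 1)) := by
    intro i hi
    have := hmulA (fun j => if j = i then 1 else 0)
    change D i * A = _ at this
    rw [this]
    ext y z
    have hyz := Γ.dist_le y z
    generalize hm : Γ.G.dist y z = m at hyz
    rcases i with _ | i
    · simp only [Matrix.smul_apply, Matrix.sub_apply, Matrix.of_apply, D, hm, smul_eq_mul, if_true,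
        Matrix.zero_apply]
      rcases m with _ | _ | m
      · simp [Γ.c0]
      · simp
      · simp
    · simp only [Matrix.smul_apply, Matrix.sub_apply, Matrix.of_apply, D, hm, smul_eq_mul,
        Nat.add_one_ne_zero, if_false, Nat.add_sub_cancel]
      rcases eq_or_ne m (i + 1 + 1) with h | h
      · have h5 : ¬ (i + 1 + 1 = i) := by omega
        subst h; simp [h5]
      rcases eq_or_ne m (i + 1) with h' | h'
      · subst h'; simp
      rcases eq_or_ne m i with h'' | h''
      · subst h''
        have : ¬ (m - 1 = m + 1) := by omega
        have h5 : ¬ (m = m + 1 + 1) := by omega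
        simp [this, h5]
      · have : ¬ (m - 1 = i + 1) ∨ m = 0 := by omega
        rcases this with h3 | h3
        · simp [h, h', h'', h3]
        · have h4 : ¬ (0 = i) := by omega
          subst h3; simp [h4, Γ.c0, Ne.symm h'']
  have hDM : ∀ i ≤ Γ.d, D i * M = p i • M := by
    intro i
    induction i using Nat.strong_induction_on with
    | _ i ih =>
      intro hi
      rcases i with _ | i
      · have : D 0 = 1 := by
          ext y z
          simp only [D, Matrix.of_apply, Γ.conn.dist_eq_zero_iff, Matrix.one_apply]
        rw [this, hp0, one_mul, one_smul]
      · have hc : (Γ.c (i + 1) : ℝ) ≠ 0 := by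
          have := Γ.c_pos (i := i + 1) (by omega) hi
          positivity
        have h1 := congrArg (· * M) (hDA i hi)
        have hi0 := ih i (by omega) (by omega)
        simp only [Matrix.sub_mul, Matrix.smul_mul, Matrix.mul_assoc, hAM, Matrix.mul_smul, hi0]
          at h1
        have h2 : (if i = 0 then (0 : Matrix Γ.X Γ.X ℝ) else (Γ.b (i - 1) : ℝ) • D (i - 1)) * M =
            (if i = 0 then 0 else Γ.b (i - 1) * p (i - 1)) • M := by
          rcases i with _ | i
          · simp
          · simp only [Nat.add_one_ne_zero, if_false, Nat.add_sub_cancel, Matrix.smul_mul]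
            rw [ih i (by omega) (by omega), smul_smul]
        rw [h2] at h1
        have h3 : (Γ.c (i + 1) : ℝ) • (D (i + 1) * M) = (Γ.c (i + 1) : ℝ) • (p (i + 1) • M) := by
          rw [smul_smul, hps i hi, Nat.cast_smul_eq_nsmul, h1]
          module
        exact smul_right_injective _ hc h3
  have hMsum : M = ∑ i ∈ Finset.range (Γ.d + 1), u i • D i := by
    ext y z
    rw [Matrix.sum_apply]
    simp only [Matrix.smul_apply, D, Matrix.of_apply, smul_eq_mul, mul_ite, mul_one, mul_zero, M]
    rw [Finset.sum_ite_eq, if_pos]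
    rw [Finset.mem_range]
    have := Γ.dist_le y z
    omega
  have hF : Polynomial.aeval x (arrF Γ.a Γ.b Γ.c Γ.d) =
      ∑ i ∈ Finset.range (Γ.d + 1), u i * p i := by
    rw [arrF, map_sum]
    refine Finset.sum_congr rfl fun i _ => ?_
    simp only [map_mul, Polynomial.aeval_C, map_pow, hu, hp, hκ]
    simp only [map_inv₀, eq_ratCast]
    ring
  have hMM : M * M = (Polynomial.aeval x (arrF Γ.a Γ.b Γ.c Γ.d) : ℝ) • M := by
    have h1 : M * M = (∑ i ∈ Finset.range (Γ.d + 1), u i • D i) * M := by rw [← hMsum]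
    rw [h1, Matrix.sum_mul, hF, Finset.sum_smul]
    refine Finset.sum_congr rfl fun i hi => ?_
    rw [Finset.mem_range] at hi
    rw [Matrix.smul_mul, hDM i (by omega), smul_smul]
  set F : ℝ := Polynomial.aeval x (arrF Γ.a Γ.b Γ.c Γ.d) with hFdef
  have hFpos : 0 < F := by
    rw [hF]
    refine Finset.sum_pos' (fun i hi => ?_) ⟨0, by simp, ?_⟩
    · rw [Finset.mem_range] at hi
      rw [hpu i (by omega)]
      have hk := hκpos i (by omega)
      have : u i * (κ i * u i) = κ i * u i ^ 2 := by ring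
      rw [this]; positivity
    · simp [hu, hp0, hκ0]
  obtain ⟨r, hr⟩ := Matrix.exists_trace_eq_natCast_of_isIdempotentElem (M := F⁻¹ • M) (by
    rw [Matrix.smul_mul, Matrix.mul_smul, hMM, smul_smul, smul_smul]
    congr 1
    field_simp)
  have htr : M.trace = Fintype.card Γ.X := by
    simp [Matrix.trace, M, hu, hp0, hκ0]
  rw [Matrix.trace_smul, htr, smul_eq_mul] at hr
  refine ⟨(Fintype.card Γ.X : ℚ) / r, ?_⟩
  have hcard : (Fintype.card Γ.X : ℝ) ≠ 0 := by
    obtain ⟨y, -⟩ := Γ.dist_eq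
    have : Nonempty Γ.X := ⟨y⟩
    exact_mod_cast Fintype.card_ne_zero
  push_cast
  rw [← hr]
  field_simp

/-- The intersection array of a distance-regular graph of diameter at least two. -/
def intArray (hd : 2 ≤ Γ.d) : IntArray (Γ.b 0) where
  d := Γ.d
  a := Γ.a
  b := Γ.b
  c := Γ.c
  two_le := hd
  b0 := rfl
  c1 := Γ.c_one (by omega)
  a0 := Γ.a_zero
  c0 := Γ.c0
  sum_eq _ hi := Γ.sum_abc hi
  bpos _ hi := Γ.b_pos hi
  cpos _ h hi := Γ.c_pos h hi
  cmono _ _ h hj := Γ.c_mono h hj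
  banti _ _ h hj := Γ.b_anti h hj
  cb _ _ h := Γ.c_le_b h
  rat x hx := Γ.rat_arrF x hd hx

end DRG

namespace IntArray

variable {k : ℕ} (Γ : IntArray k)

/-- The off-diagonal entries of the symmetrized intersection matrix. -/
noncomputable def r (i : ℕ) : ℝ := Real.sqrt (Γ.b i * Γ.c (i + 1))

/-- The orthonormal polynomials of the array. -/
noncomputable def q (i : ℕ) (x : ℝ) : ℝ :=
  Polynomial.aeval x (arrP Γ.a Γ.b Γ.c i) / Real.sqrt (arrK Γ.b Γ.c i)

/-- The reciprocal of the Christoffel function. -/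
noncomputable def F (x : ℝ) : ℝ := ∑ i ∈ Finset.range (Γ.d + 1), Γ.q i x ^ 2

lemma arrK_pos {i : ℕ} (hi : i ≤ Γ.d) : (0 : ℝ) < arrK Γ.b Γ.c i := by
  exact_mod_cast DRG.arrK_pos Γ.bpos Γ.cpos hi

lemma sqrtK_pos {i : ℕ} (hi : i ≤ Γ.d) : 0 < Real.sqrt (arrK Γ.b Γ.c i) :=
  Real.sqrt_pos.2 (Γ.arrK_pos hi)

lemma r_pos {i : ℕ} (hi : i < Γ.d) : 0 < Γ.r i := by
  have h1 := Γ.bpos i hi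
  have h2 := Γ.cpos (i + 1) (by omega) hi
  exact Real.sqrt_pos.2 (by positivity)

lemma r_nonneg (i : ℕ) : 0 ≤ Γ.r i := Real.sqrt_nonneg _

lemma r_sq (i : ℕ) : Γ.r i ^ 2 = Γ.b i * Γ.c (i + 1) := Real.sq_sqrt (by positivity)

lemma b_le {i : ℕ} (hi : i ≤ Γ.d) : Γ.b i ≤ k := by have := Γ.sum_eq i hi; omega

lemma c_le {i : ℕ} (hi : i ≤ Γ.d) : Γ.c i ≤ k := by have := Γ.sum_eq i hi; omega

lemma a_le {i : ℕ} (hi : i ≤ Γ.d) : Γ.a i ≤ k := by have := Γ.sum_eq i hi; omega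

lemma r_le {i : ℕ} (hi : i < Γ.d) : Γ.r i ≤ k := by
  have h1 : (Γ.b i : ℝ) ≤ k := by exact_mod_cast Γ.b_le hi.le
  have h2 : (Γ.c (i + 1) : ℝ) ≤ k := by exact_mod_cast Γ.c_le hi
  refine Real.sqrt_le_iff.2 ⟨by positivity, ?_⟩
  nlinarith [(Nat.cast_nonneg (Γ.c (i + 1)) : (0 : ℝ) ≤ _), (Nat.cast_nonneg k : (0 : ℝ) ≤ _)]

lemma one_le_r {i : ℕ} (hi : i < Γ.d) : 1 ≤ Γ.r i := by
  have h1 : (1 : ℝ) ≤ Γ.b i := by exact_mod_cast Γ.bpos i hi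
  have h2 : (1 : ℝ) ≤ Γ.c (i + 1) := by exact_mod_cast Γ.cpos _ (by omega) hi
  refine Real.le_sqrt_of_sq_le ?_
  nlinarith

lemma arrK_succ {i : ℕ} (hi : i < Γ.d) :
    (Γ.c (i + 1) : ℝ) * arrK Γ.b Γ.c (i + 1) = arrK Γ.b Γ.c i * Γ.b i := by
  exact_mod_cast DRG.arrK_succ (b := Γ.b) Γ.cpos hi

lemma sqrtK_mul_r {i : ℕ} (hi : i < Γ.d) :
    Real.sqrt (arrK Γ.b Γ.c i) * Γ.r i = Real.sqrt (arrK Γ.b Γ.c (i + 1)) * Γ.c (i + 1) := by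
  rw [r, ← Real.sqrt_mul (Γ.arrK_pos hi.le).le, ← mul_assoc, ← Γ.arrK_succ hi]
  have : (Γ.c (i + 1) : ℝ) * arrK Γ.b Γ.c (i + 1) * Γ.c (i + 1) =
    arrK Γ.b Γ.c (i + 1) * (Γ.c (i + 1) : ℝ) ^ 2 := by ring
  rw [this, Real.sqrt_mul (Γ.arrK_pos hi).le, Real.sqrt_sq (by positivity)]

lemma sqrtK_succ_mul_r {i : ℕ} (hi : i < Γ.d) :
    Real.sqrt (arrK Γ.b Γ.c (i + 1)) * Γ.r i = Real.sqrt (arrK Γ.b Γ.c i) * Γ.b i := by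
  have h := Γ.sqrtK_mul_r hi
  have h1 := Γ.r_sq i
  have h3 := Γ.r_pos hi
  apply mul_right_cancel₀ h3.ne'
  have h2 := Γ.cpos (i + 1) (by omega) hi
  linear_combination Real.sqrt (arrK Γ.b Γ.c (i + 1)) * h1 - Γ.b i * h

lemma q_zero (x : ℝ) : Γ.q 0 x = 1 := by simp [q, arrP, arrK]

lemma aeval_eq {i : ℕ} (hi : i ≤ Γ.d) (x : ℝ) :
    Polynomial.aeval x (arrP Γ.a Γ.b Γ.c i) = Real.sqrt (arrK Γ.b Γ.c i) * Γ.q i x := by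
  rw [q]; field_simp [(Γ.sqrtK_pos hi).ne']

lemma q_rec {i : ℕ} (hi : i < Γ.d) (x : ℝ) :
    Γ.r i * Γ.q (i + 1) x = (x - Γ.a i) * Γ.q i x -
      (if i = 0 then 0 else Γ.r (i - 1) * Γ.q (i - 1) x) := by
  have h := DRG.arrP_aeval_succ (b := Γ.b) Γ.cpos Γ.c1 Γ.a0 hi x
  rw [Γ.aeval_eq hi, Γ.aeval_eq hi.le] at h
  have hs := (Γ.sqrtK_pos hi.le).ne'
  have h1 := Γ.sqrtK_mul_r hi
  apply mul_left_cancel₀ hs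
  rcases i with _ | i
  · simp only [if_true] at h ⊢
    linear_combination h + Γ.q (0 + 1) x * h1
  · simp only [Nat.add_one_ne_zero, if_false, Nat.add_sub_cancel] at h ⊢
    rw [Γ.aeval_eq (by omega : i ≤ Γ.d)] at h
    have h2 := Γ.sqrtK_succ_mul_r (by omega : i < Γ.d)
    linear_combination h + Γ.q (i + 1 + 1) x * h1 + Γ.q i x * h2

lemma q_rec_zero (x : ℝ) : Γ.r 0 * Γ.q 1 x = x := by
  have := Γ.q_rec (i := 0) (by have := Γ.two_le; omega) x
  simpa [Γ.q_zero, Γ.a0] using this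

lemma q_rec_succ {i : ℕ} (hi : i + 1 < Γ.d) (x : ℝ) :
    Γ.r (i + 1) * Γ.q (i + 2) x = (x - Γ.a (i + 1)) * Γ.q (i + 1) x - Γ.r i * Γ.q i x := by
  simpa using Γ.q_rec hi x

lemma F_eq_aeval (x : ℝ) : Γ.F x = Polynomial.aeval x (arrF Γ.a Γ.b Γ.c Γ.d) := by
  rw [arrF, F, map_sum]
  refine Finset.sum_congr rfl fun i hi => ?_
  rw [Finset.mem_range] at hi
  simp only [map_mul, Polynomial.aeval_C, map_pow, q, div_pow]
  rw [Real.sq_sqrt (Γ.arrK_pos (by omega)).le]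
  simp only [map_inv₀, eq_ratCast]
  ring

lemma one_le_F (x : ℝ) : 1 ≤ Γ.F x := by
  have : Γ.q 0 x ^ 2 ≤ Γ.F x :=
    Finset.single_le_sum (f := fun i => Γ.q i x ^ 2) (fun i _ => sq_nonneg _) (by simp)
  simpa [Γ.q_zero] using this

lemma rat_F {x : ℝ} (hx : (x - Γ.a Γ.d) * Γ.q Γ.d x = Γ.r (Γ.d - 1) * Γ.q (Γ.d - 1) x) :
    ∃ z : ℚ, Γ.F x = z := by
  rw [F_eq_aeval]
  have hd := Γ.two_le
  refine Γ.rat x ?_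
  obtain ⟨e, he⟩ : ∃ e, Γ.d = e + 1 := ⟨Γ.d - 1, by omega⟩
  rw [Γ.aeval_eq le_rfl, Γ.aeval_eq (by omega)]
  have h2 := Γ.sqrtK_succ_mul_r (by omega : e < Γ.d)
  rw [he] at hx ⊢
  simp only [Nat.add_sub_cancel] at hx ⊢
  linear_combination Real.sqrt (arrK Γ.b Γ.c (e + 1)) * hx + Γ.q e x * h2

/-- The symmetrized intersection matrix. -/
noncomputable def J : Matrix (Fin (Γ.d + 1)) (Fin (Γ.d + 1)) ℝ :=
  Matrix.of fun i j => if (j : ℕ) = i then (Γ.a i : ℝ) else if (j : ℕ) = i + 1 then Γ.r i else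
    if (i : ℕ) = j + 1 then Γ.r j else 0

lemma J_isHermitian : Γ.J.IsHermitian := by
  ext i j
  simp only [J, Matrix.conjTranspose_apply, Matrix.of_apply, star_trivial]
  rcases lt_trichotomy (i : ℕ) j with h | h | h
  · grind
  · have : i = j := Fin.ext h
    subst this; rfl
  · grind

lemma sum_fin_ite {n : ℕ} (v : ℕ → ℝ) (hv : ∀ m, n ≤ m → v m = 0) (m : ℕ) :
    ∑ j : Fin n, (if (j : ℕ) = m then v j else 0) = v m := by
  rw [Fin.sum_univ_eq_sum_range (fun j => if j = m then v j else 0) n, Finset.sum_ite_eq']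
  split_ifs with h
  · rfl
  · rw [hv m (by simpa using h)]

lemma J_mulVec (v : ℕ → ℝ) (hv : ∀ m, Γ.d + 1 ≤ m → v m = 0) (i : Fin (Γ.d + 1)) :
    (Γ.J *ᵥ fun j => v j) i = Γ.a i * v i + Γ.r i * v (i + 1) +
      (if (i : ℕ) = 0 then 0 else Γ.r (i - 1) * v (i - 1)) := by
  have h0 : (Γ.J *ᵥ fun j => v j) i = ∑ j : Fin (Γ.d + 1), (Γ.a i * (if (j : ℕ) = i then v j else 0)
      + Γ.r i * (if (j : ℕ) = i + 1 then v j else 0) +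
      (if (i : ℕ) = 0 then 0 else Γ.r (i - 1) * (if (j : ℕ) = i - 1 then v j else 0))) := by
    simp only [Matrix.mulVec, dotProduct]
    refine Finset.sum_congr rfl fun j _ => ?_
    simp only [J, Matrix.of_apply]
    by_cases h1 : (j : ℕ) = i
    · rw [h1]; by_cases h2 : (i : ℕ) = 0
      · simp [h2]
      · have : ¬ ((i : ℕ) = i - 1) := by omega
        simp [this]
    by_cases h2 : (j : ℕ) = i + 1
    · have : ¬ ((i : ℕ) + 1 = i - 1) := by omega
      simp [h2, this]
    by_cases h3 : (i : ℕ) = j + 1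
    · have : ¬ ((j : ℕ) = j + 1 + 1) := by omega
      simp [h3, this]
    · have : (i : ℕ) = 0 ∨ ¬ ((j : ℕ) = i - 1) := by omega
      rcases this with h | h
      · rw [if_neg h1, if_neg h2, if_neg h3, if_neg h1, if_neg h2, if_pos h]; ring
      · simp [h1, h2, h3, h]
  rw [h0, Finset.sum_add_distrib, Finset.sum_add_distrib, ← Finset.mul_sum, ← Finset.mul_sum,
    sum_fin_ite v hv, sum_fin_ite v hv]
  by_cases h : (i : ℕ) = 0
  · simp [h]
  · simp only [h, if_false]
    rw [← Finset.mul_sum, sum_fin_ite v hv]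

/-- The eigenvalues of the array. -/
noncomputable def θ : Fin (Γ.d + 1) → ℝ := Γ.J_isHermitian.eigenvalues

/-- The eigenvectors of the symmetrized intersection matrix. -/
noncomputable def ev (j : Fin (Γ.d + 1)) (i : ℕ) : ℝ :=
  if h : i < Γ.d + 1 then Γ.J_isHermitian.eigenvectorBasis j ⟨i, h⟩ else 0

lemma ev_fin (j i : Fin (Γ.d + 1)) : Γ.ev j i = Γ.J_isHermitian.eigenvectorBasis j i := by
  simp only [ev, dif_pos i.2]

lemma ev_big (j : Fin (Γ.d + 1)) (m : ℕ) (hm : Γ.d + 1 ≤ m) : Γ.ev j m = 0 := by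
  rw [ev, dif_neg (by omega)]

lemma J_mulVec_ev (j : Fin (Γ.d + 1)) :
    (Γ.J *ᵥ fun i => Γ.ev j i) = Γ.θ j • (fun i : Fin (Γ.d + 1) => Γ.ev j i) := by
  have := Γ.J_isHermitian.mulVec_eigenvectorBasis j
  simp only [ev_fin]
  exact this

lemma ev_row (j : Fin (Γ.d + 1)) {i : ℕ} (hi : i ≤ Γ.d) :
    Γ.r i * Γ.ev j (i + 1) = (Γ.θ j - Γ.a i) * Γ.ev j i -
      (if i = 0 then 0 else Γ.r (i - 1) * Γ.ev j (i - 1)) := by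
  have h1 := Γ.J_mulVec (Γ.ev j) (Γ.ev_big j) ⟨i, by omega⟩
  rw [J_mulVec_ev] at h1
  simp only [Pi.smul_apply, smul_eq_mul] at h1
  linear_combination -h1

lemma ev_eq (j : Fin (Γ.d + 1)) {i : ℕ} (hi : i ≤ Γ.d) :
    Γ.ev j i = Γ.ev j 0 * Γ.q i (Γ.θ j) := by
  induction i using Nat.strong_induction_on with
  | _ i ih =>
    rcases i with _ | i
    · simp [Γ.q_zero]
    · have h1 := Γ.ev_row j (i := i) (by omega)
      have h2 := Γ.q_rec (i := i) (by omega) (Γ.θ j)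
      apply mul_left_cancel₀ (Γ.r_pos (i := i) (by omega)).ne'
      rw [h1, ih i (by omega) (by omega), mul_left_comm (Γ.r i), h2]
      rcases i with _ | i
      · simp; ring
      · simp only [Nat.add_one_ne_zero, if_false, Nat.add_sub_cancel]
        rw [ih i (by omega) (by omega)]; ring

lemma sum_ev_mul_ev (j j' : Fin (Γ.d + 1)) :
    ∑ i : Fin (Γ.d + 1), Γ.ev j i * Γ.ev j' i = if j = j' then 1 else 0 := by
  have h := orthonormal_iff_ite.1 Γ.J_isHermitian.eigenvectorBasis.orthonormal j j'
  rw [← h, PiLp.inner_apply]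
  refine Finset.sum_congr rfl fun i _ => ?_
  simp [ev_fin, mul_comm]

lemma sum_ev_mul_ev' (i i' : Fin (Γ.d + 1)) :
    ∑ j : Fin (Γ.d + 1), Γ.ev j i * Γ.ev j i' = if i = i' then 1 else 0 := by
  have h := Γ.J_isHermitian.eigenvectorBasis.sum_inner_mul_inner (𝕜 := ℝ)
    (EuclideanSpace.single i (1 : ℝ)) (EuclideanSpace.single i' (1 : ℝ))
  simp only [EuclideanSpace.inner_single_left, EuclideanSpace.inner_single_right] at h
  simp only [ev_fin]
  simpa [Pi.single_apply, eq_comm] using h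

lemma ev_zero_ne (j : Fin (Γ.d + 1)) : Γ.ev j 0 ≠ 0 := by
  intro h
  have h1 := Γ.sum_ev_mul_ev j j
  rw [if_pos rfl, Finset.sum_eq_zero] at h1
  · exact zero_ne_one h1
  · intro i _
    rw [Γ.ev_eq j (by omega), h]; simp

/-- The weights of the Gauss quadrature attached to the array. -/
noncomputable def w (j : Fin (Γ.d + 1)) : ℝ := Γ.ev j 0 ^ 2

lemma w_pos (j : Fin (Γ.d + 1)) : 0 < Γ.w j := by
  have := Γ.ev_zero_ne j
  unfold w; positivity

lemma θ_injective : Function.Injective Γ.θ := by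
  intro j j' h
  by_contra hne
  have h1 := Γ.sum_ev_mul_ev j j'
  have h2 := Γ.sum_ev_mul_ev j j
  rw [if_neg hne] at h1
  rw [if_pos rfl] at h2
  have : ∑ i : Fin (Γ.d + 1), Γ.ev j i * Γ.ev j' i =
      (Γ.ev j' 0 / Γ.ev j 0) * ∑ i : Fin (Γ.d + 1), Γ.ev j i * Γ.ev j i := by
    rw [Finset.mul_sum]
    refine Finset.sum_congr rfl fun i _ => ?_
    rw [Γ.ev_eq j' (by omega), Γ.ev_eq j (by omega), h]
    field_simp [Γ.ev_zero_ne j]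
  rw [h1, h2, mul_one] at this
  exact div_ne_zero (Γ.ev_zero_ne j') (Γ.ev_zero_ne j) this.symm

lemma w_mul_F (j : Fin (Γ.d + 1)) : Γ.w j * Γ.F (Γ.θ j) = 1 := by
  have h2 := Γ.sum_ev_mul_ev j j
  rw [if_pos rfl] at h2
  rw [← h2, F, w, Finset.mul_sum,
    ← Fin.sum_univ_eq_sum_range (fun i => Γ.ev j 0 ^ 2 * Γ.q i (Γ.θ j) ^ 2)]
  refine Finset.sum_congr rfl fun i _ => ?_
  rw [Γ.ev_eq j (i := i) (by omega)]; ring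

lemma sum_w_q_q {i i' : ℕ} (hi : i ≤ Γ.d) (hi' : i' ≤ Γ.d) :
    ∑ j, Γ.w j * (Γ.q i (Γ.θ j) * Γ.q i' (Γ.θ j)) = if i = i' then 1 else 0 := by
  have h := Γ.sum_ev_mul_ev' ⟨i, by omega⟩ ⟨i', by omega⟩
  simp only [Fin.mk.injEq] at h
  rw [← h]
  refine Finset.sum_congr rfl fun j _ => ?_
  rw [Γ.ev_eq j hi, Γ.ev_eq j hi', w]; ring

lemma q_end (j : Fin (Γ.d + 1)) :
    (Γ.θ j - Γ.a Γ.d) * Γ.q Γ.d (Γ.θ j) = Γ.r (Γ.d - 1) * Γ.q (Γ.d - 1) (Γ.θ j) := by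
  have hd := Γ.two_le
  have h := Γ.ev_row j le_rfl
  rw [if_neg (by omega), Γ.ev_big j _ le_rfl, Γ.ev_eq j le_rfl,
    Γ.ev_eq j (i := Γ.d - 1) (by omega)] at h
  apply mul_left_cancel₀ (Γ.ev_zero_ne j)
  linear_combination -h

lemma rat_F_θ (j : Fin (Γ.d + 1)) : ∃ z : ℚ, Γ.F (Γ.θ j) = z := Γ.rat_F (Γ.q_end j)

lemma abs_θ_le (j : Fin (Γ.d + 1)) : |Γ.θ j| ≤ 3 * k := by
  obtain ⟨i, -, hi⟩ := Finset.exists_max_image Finset.univ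
    (fun i : Fin (Γ.d + 1) => |Γ.ev j i|) ⟨0, Finset.mem_univ _⟩
  have hle : ∀ m : ℕ, |Γ.ev j m| ≤ |Γ.ev j i| := by
    intro m
    by_cases hm : m < Γ.d + 1
    · exact hi ⟨m, hm⟩ (Finset.mem_univ _)
    · rw [Γ.ev_big j m (by omega), abs_zero]; positivity
  have hpos : 0 < |Γ.ev j i| := (abs_pos.2 (Γ.ev_zero_ne j)).trans_le (hle 0)
  have h := Γ.ev_row j (i := i) (by omega)
  have ha : (Γ.a i : ℝ) ≤ k := by exact_mod_cast Γ.a_le (by omega : (i : ℕ) ≤ Γ.d)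
  have h1 : |Γ.r i * Γ.ev j (i + 1)| ≤ k * |Γ.ev j i| := by
    by_cases hid : (i : ℕ) < Γ.d
    · rw [abs_mul, abs_of_nonneg (Γ.r_nonneg _)]
      exact mul_le_mul (Γ.r_le hid) (hle _) (abs_nonneg _) (by positivity)
    · rw [Γ.ev_big j _ (by omega), mul_zero, abs_zero]; positivity
  have h2 : |(if (i : ℕ) = 0 then 0 else Γ.r (i - 1) * Γ.ev j (i - 1))| ≤ k * |Γ.ev j i| := by
    split_ifs with h0
    · rw [abs_zero]; positivity
    · rw [abs_mul, abs_of_nonneg (Γ.r_nonneg _)]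
      exact mul_le_mul (Γ.r_le (by omega)) (hle _) (abs_nonneg _) (by positivity)
  have h3 : |Γ.a i * Γ.ev j i| ≤ k * |Γ.ev j i| := by
    rw [abs_mul, abs_of_nonneg (by positivity)]
    gcongr
  have h4 : |Γ.θ j * Γ.ev j i| ≤ 3 * k * |Γ.ev j i| := by
    have : Γ.θ j * Γ.ev j i = Γ.r i * Γ.ev j (i + 1) + Γ.a i * Γ.ev j i +
      (if (i : ℕ) = 0 then 0 else Γ.r (i - 1) * Γ.ev j (i - 1)) := by linear_combination -h
    rw [this]
    refine (abs_add_three _ _ _).trans ?_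
    linarith
  rw [abs_mul] at h4
  exact le_of_mul_le_mul_right h4 hpos

lemma J_pow_mulVec_ev (j : Fin (Γ.d + 1)) (m : ℕ) :
    (Γ.J ^ m *ᵥ fun i => Γ.ev j i) = Γ.θ j ^ m • (fun i : Fin (Γ.d + 1) => Γ.ev j i) := by
  induction m with
  | zero => simp
  | succ m ih =>
    rw [pow_succ, ← Matrix.mulVec_mulVec, J_mulVec_ev, Matrix.mulVec_smul, ih, smul_smul, pow_succ,
      mul_comm]

lemma trace_J_pow (m : ℕ) : (Γ.J ^ m).trace = ∑ j, Γ.θ j ^ m := by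
  have h1 : ∀ i, (Γ.J ^ m) i i = ∑ j, Γ.θ j ^ m * (Γ.ev j i * Γ.ev j i) := by
    intro i
    have h2 : (Γ.J ^ m) i i = ∑ l, (Γ.J ^ m) i l * ∑ j, Γ.ev j l * Γ.ev j i := by
      simp [sum_ev_mul_ev']
    rw [h2]
    simp_rw [Finset.mul_sum]
    rw [Finset.sum_comm]
    refine Finset.sum_congr rfl fun j _ => ?_
    have h3 := congrFun (Γ.J_pow_mulVec_ev j m) i
    simp only [Matrix.mulVec, dotProduct, Pi.smul_apply, smul_eq_mul] at h3
    rw [← mul_assoc, ← h3, Finset.sum_mul]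
    refine Finset.sum_congr rfl fun l _ => by ring
  simp only [Matrix.trace, Matrix.diag_apply, h1]
  rw [Finset.sum_comm]
  refine Finset.sum_congr rfl fun j _ => ?_
  rw [← Finset.mul_sum, sum_ev_mul_ev]; simp

lemma J_conj (i l : Fin (Γ.d + 1)) :
    ∃ z : ℚ, Real.sqrt (arrK Γ.b Γ.c l) * Γ.J i l = Real.sqrt (arrK Γ.b Γ.c i) * z := by
  simp only [J, Matrix.of_apply]
  split_ifs with h1 h2 h3
  · exact ⟨Γ.a i, by rw [h1]; simp⟩
  · exact ⟨Γ.b i, by rw [h2, Γ.sqrtK_succ_mul_r (by omega)]; simp⟩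
  · exact ⟨Γ.c i, by rw [h3, Γ.sqrtK_mul_r (by omega)]; simp⟩
  · exact ⟨0, by simp⟩

lemma J_pow_conj (m : ℕ) (i l : Fin (Γ.d + 1)) :
    ∃ z : ℚ, Real.sqrt (arrK Γ.b Γ.c l) * (Γ.J ^ m) i l = Real.sqrt (arrK Γ.b Γ.c i) * z := by
  induction m generalizing l with
  | zero =>
    by_cases h : i = l
    · subst h; exact ⟨1, by simp⟩
    · exact ⟨0, by simp [h]⟩
  | succ m ih =>
    choose z hz using ih
    choose z' hz' using fun n => Γ.J_conj n l
    refine ⟨∑ n, z n * z' n, ?_⟩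
    rw [pow_succ, Matrix.mul_apply]
    push_cast
    rw [Finset.mul_sum, Finset.mul_sum]
    refine Finset.sum_congr rfl fun n _ => ?_
    linear_combination (Γ.J ^ m) i n * hz' n + z' n * hz n

lemma rat_sum_θ_pow (m : ℕ) : ∃ z : ℚ, ∑ j, Γ.θ j ^ m = z := by
  choose z hz using fun i => Γ.J_pow_conj m i i
  refine ⟨∑ i, z i, ?_⟩
  rw [← trace_J_pow, Matrix.trace]
  push_cast
  refine Finset.sum_congr rfl fun i _ => ?_
  exact mul_left_cancel₀ (Γ.sqrtK_pos (i := i) (by omega)).ne' (hz i)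

end IntArray

lemma isIntegral_leadingCoeff_mul_of_eval_eq_zero {f : Polynomial ℝ} {η : ℝ}
    (hf : ∀ n, IsIntegral ℤ (f.coeff n)) (h0 : f.eval η = 0) :
    IsIntegral ℤ (f.leadingCoeff * η) := by
  have hl : f ∈ Polynomial.lifts (algebraMap (integralClosure ℤ ℝ) ℝ) := by
    rw [Polynomial.lifts_iff_coeff_lifts]
    exact fun n => ⟨⟨f.coeff n, hf n⟩, rfl⟩
  obtain ⟨p, hp⟩ := (Polynomial.mem_lifts _).1 hl
  have h1 : Polynomial.aeval η p = 0 := by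
    rw [← h0, ← hp, Polynomial.eval_map, Polynomial.aeval_def]
  have h2 := isIntegral_trans (R := ℤ) _ (isIntegral_leadingCoeff_smul p η h1)
  have h3 : f.leadingCoeff = algebraMap (integralClosure ℤ ℝ) ℝ p.leadingCoeff := by
    rw [← hp, Polynomial.leadingCoeff_map_of_injective]
    exact Subtype.val_injective
  rwa [h3, ← Algebra.smul_def]

/-- Division of a polynomial with integral coefficients by a linear factor `X - η`. -/
lemma isIntegral_coeff_of_X_sub_C_mul (η : ℝ) (m : ℕ) :
    ∀ g : Polynomial ℝ, g.natDegree < m →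
      (∀ n, IsIntegral ℤ (((Polynomial.X - Polynomial.C η) * g).coeff n)) →
      ∀ n, IsIntegral ℤ (g.coeff n) := by
  induction m with
  | zero => intro g hg; omega
  | succ m ih =>
    intro g hg hf
    have hg0 : (Polynomial.C (g.coeff m) * Polynomial.X ^ m : Polynomial ℝ).natDegree ≤ m :=
      Polynomial.natDegree_C_mul_X_pow_le _ _
    have hcoef : (((Polynomial.X - Polynomial.C η) * g).coeff (m + 1)) = g.coeff m := by
      rw [sub_mul, Polynomial.coeff_sub, Polynomial.coeff_X_mul, Polynomial.coeff_C_mul,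
        Polynomial.coeff_eq_zero_of_natDegree_lt hg, mul_zero, sub_zero]
    have hlead : IsIntegral ℤ (g.coeff m) := by
      have := hf (m + 1)
      rwa [hcoef] at this
    have hleadη : IsIntegral ℤ (g.coeff m * η) := by
      by_cases h0 : g.coeff m = 0
      · rw [h0, zero_mul]; exact isIntegral_zero
      have h1 : ((Polynomial.X - Polynomial.C η) * g).leadingCoeff = g.coeff m := by
        rw [Polynomial.leadingCoeff_mul, Polynomial.leadingCoeff_X_sub_C, one_mul,
          Polynomial.leadingCoeff]
        congr 1
        have := Polynomial.le_natDegree_of_ne_zero h0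
        omega
      rw [← h1]
      exact isIntegral_leadingCoeff_mul_of_eval_eq_zero hf (by simp)
    set g' := g - Polynomial.C (g.coeff m) * Polynomial.X ^ m with hg'
    have hsplit : g = g' + Polynomial.C (g.coeff m) * Polynomial.X ^ m := by rw [hg']; ring
    have hX : ∀ a : ℝ, IsIntegral ℤ a → ∀ j n, IsIntegral ℤ
        ((Polynomial.C a * Polynomial.X ^ j : Polynomial ℝ).coeff n) := by
      intro a ha j n
      rw [Polynomial.coeff_C_mul_X_pow]
      split_ifs
      · exact ha
      · exact isIntegral_zero
    have hintg : ∀ n, IsIntegral ℤ (g'.coeff n) := by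
      rcases Nat.eq_zero_or_pos m with rfl | hm
      · have : g' = 0 := by
          rw [hg', pow_zero, mul_one, sub_eq_zero]
          exact Polynomial.eq_C_of_natDegree_eq_zero (by omega)
        intro n; rw [this, Polynomial.coeff_zero]; exact isIntegral_zero
      · refine ih g' ?_ fun n => ?_
        · have h1 : g'.natDegree ≤ m := by
            refine (Polynomial.natDegree_sub_le _ _).trans ?_
            exact max_le (by omega) hg0
          rcases h1.lt_or_eq with h | h
          · exact h
          · exfalso
            have h2 : g'.coeff m = 0 := by
              rw [hg']; simp
            rw [← h] at h2
            have h3 : g' = 0 := Polynomial.leadingCoeff_eq_zero.1 h2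
            rw [h3] at h; simp at h; omega
        · have : (Polynomial.X - Polynomial.C η) * g' = (Polynomial.X - Polynomial.C η) * g -
            Polynomial.C (g.coeff m) * Polynomial.X ^ (m + 1) +
            Polynomial.C (g.coeff m * η) * Polynomial.X ^ m := by
              rw [hg', Polynomial.C_mul]; ring
          rw [this, Polynomial.coeff_add, Polynomial.coeff_sub]
          exact ((hf n).sub (hX _ hlead _ _)).add (hX _ hleadη _ _)
    intro n
    rw [hsplit, Polynomial.coeff_add]
    exact (hintg n).add (hX _ hlead _ _)

/-- If `e * ∏ (X - η_j)` has integral coefficients, then all `e * ∏_{j ∈ T} η_j` are integral. -/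
lemma isIntegral_mul_prod_subset {ι : Type*} [DecidableEq ι] (η : ι → ℝ) (e : ℝ)
    (U : Finset ι) (hU : ∀ n, IsIntegral ℤ
      ((Polynomial.C e * ∏ j ∈ U, (Polynomial.X - Polynomial.C (η j))).coeff n))
    {T : Finset ι} (hT : T ⊆ U) : IsIntegral ℤ (e * ∏ j ∈ T, η j) := by
  have key : ∀ V : Finset ι, V ⊆ U → ∀ n, IsIntegral ℤ
      ((Polynomial.C e * ∏ j ∈ U \ V, (Polynomial.X - Polynomial.C (η j))).coeff n) := by
    intro V
    induction V using Finset.induction_on with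
    | empty => intro _; simpa using hU
    | insert a V ha ih =>
      intro hV
      have h1 := ih ((Finset.subset_insert _ _).trans hV)
      have haU : a ∈ U \ V := Finset.mem_sdiff.2 ⟨hV (Finset.mem_insert_self _ _), ha⟩
      refine isIntegral_coeff_of_X_sub_C_mul (η a) _ _ (Nat.lt_succ_self _) fun n => ?_
      have h2 := h1 n
      rw [← Finset.mul_prod_erase _ _ haU] at h2
      rw [Finset.sdiff_insert, mul_left_comm]
      exact h2
  have h1 := key (U \ T) Finset.sdiff_subset 0
  rw [Finset.sdiff_sdiff_eq_self hT, Polynomial.coeff_zero_eq_eval_zero] at h1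
  simp only [Polynomial.eval_mul, Polynomial.eval_C, Polynomial.eval_prod, Polynomial.eval_sub,
    Polynomial.eval_X, zero_sub, Finset.prod_neg] at h1
  have h2 := h1.mul ((isIntegral_one : IsIntegral ℤ (1 : ℝ)).neg.pow T.card)
  have h3 : (-1 : ℝ) ^ T.card * (-1) ^ T.card = 1 := by rw [← mul_pow]; simp
  have h4 : e * ∏ j ∈ T, η j = e * ((-1) ^ T.card * ∏ j ∈ T, η j) * (-1) ^ T.card := by
    linear_combination (-(e * ∏ j ∈ T, η j)) * h3
  rw [h4]
  exact h2

lemma isIntegral_pow_mul_det_vandermonde {n : ℕ} (v : Fin n → ℝ) (e : ℝ)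
    (h : ∀ T : Finset (Fin n), IsIntegral ℤ (e * ∏ j ∈ T, v j)) :
    IsIntegral ℤ (e ^ (n - 1) * (Matrix.vandermonde v).det) := by
  rw [Matrix.det_apply', Finset.mul_sum]
  refine IsIntegral.sum _ fun σ _ => ?_
  rw [mul_left_comm]
  refine IsIntegral.mul ?_ ?_
  · exact isIntegral_algebraMap (R := ℤ) (A := ℝ) (x := ((Equiv.Perm.sign σ : ℤˣ) : ℤ))
  have h1 : e ^ (n - 1) * ∏ i, Matrix.vandermonde v (σ i) i =
      ∏ t ∈ Finset.range (n - 1), (e * ∏ i ∈ Finset.univ.filter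
        (fun i : Fin n => t < ((σ.symm i : Fin n) : ℕ)), v i) := by
    rw [Finset.prod_mul_distrib, Finset.prod_const, Finset.card_range]
    congr 1
    rw [← Equiv.prod_comp σ.symm]
    simp only [Matrix.vandermonde_apply, Equiv.apply_symm_apply, Finset.prod_filter]
    rw [Finset.prod_comm]
    refine Finset.prod_congr rfl fun i _ => ?_
    rw [← Finset.prod_filter, Finset.prod_const]
    congr 1
    have : (Finset.range (n - 1)).filter (fun t => t < ((σ.symm i : Fin n) : ℕ)) =
        Finset.range (σ.symm i : Fin n) := by
      ext t
      simp only [Finset.mem_filter, Finset.mem_range]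
      have := (σ.symm i).2
      omega
    rw [this, Finset.card_range]
  rw [h1]
  exact IsIntegral.prod _ fun t _ => h _

namespace IntArray

variable {k : ℕ} (Γ : IntArray k)

lemma isIntegral_sqrt_natCast (n : ℕ) : IsIntegral ℤ (Real.sqrt n) := by
  refine IsIntegral.of_pow (n := 2) (by norm_num) ?_
  rw [Real.sq_sqrt (by positivity)]
  exact isIntegral_algebraMap (R := ℤ) (A := ℝ) (x := (n : ℤ))

lemma isIntegral_r (i : ℕ) : IsIntegral ℤ (Γ.r i) := by
  have := isIntegral_sqrt_natCast (Γ.b i * Γ.c (i + 1))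
  rw [Nat.cast_mul] at this
  exact this

lemma isIntegral_natCast (n : ℕ) : IsIntegral ℤ (n : ℝ) :=
  isIntegral_algebraMap (R := ℤ) (A := ℝ) (x := (n : ℤ))

lemma isIntegral_J (i j : Fin (Γ.d + 1)) : IsIntegral ℤ (Γ.J i j) := by
  simp only [J, Matrix.of_apply]
  split_ifs
  · exact isIntegral_natCast _
  · exact Γ.isIntegral_r _
  · exact Γ.isIntegral_r _
  · exact isIntegral_zero

/-- The row `i` of the symmetrized matrix has constant entries `√N, α, √N`. -/
def GoodRow (α N i : ℕ) : Prop :=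
  Γ.a i = α ∧ (1 ≤ i → Γ.r (i - 1) = Real.sqrt N) ∧ (i < Γ.d → Γ.r i = Real.sqrt N)

/-- The rescaled eigenvalues. -/
noncomputable def η (α N : ℕ) (j : Fin (Γ.d + 1)) : ℝ := (Γ.θ j - α) / Real.sqrt N

lemma prod_X_sub_η_eq_det (α N : ℕ) (hN : 1 ≤ N) :
    (∏ j, (Polynomial.X - Polynomial.C (Γ.η α N j))) =
    (Matrix.of fun i j : Fin (Γ.d + 1) => (if i = j then (Polynomial.X : Polynomial ℝ) else 0) -
      Polynomial.C ((Γ.J i j - if i = j then (α : ℝ) else 0) / Real.sqrt N)).det := by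
  have hs : 0 < Real.sqrt N := Real.sqrt_pos.2 (by exact_mod_cast hN)
  refine Polynomial.funext fun x => ?_
  rw [← Polynomial.coe_evalRingHom, RingHom.map_det, Polynomial.coe_evalRingHom]
  have h1 := congrArg (Polynomial.eval (α + Real.sqrt N * x)) Γ.J_isHermitian.charpoly_eq
  rw [Matrix.eval_charpoly] at h1
  simp only [Polynomial.eval_prod, Polynomial.eval_sub, Polynomial.eval_X, Polynomial.eval_C] at h1 ⊢
  have h2 : ∀ j, (α + Real.sqrt N * x - Γ.θ j) = Real.sqrt N * (x - Γ.η α N j) := by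
    intro j; rw [η]; field_simp; ring
  have h3 : (Matrix.scalar (Fin (Γ.d + 1))) (α + Real.sqrt N * x) - Γ.J = Real.sqrt N •
      (Matrix.of fun i j : Fin (Γ.d + 1) => (if i = j then x else 0) -
        ((Γ.J i j - if i = j then (α : ℝ) else 0) / Real.sqrt N)) := by
    ext i j
    simp only [Matrix.scalar_apply, Matrix.sub_apply, Matrix.diagonal_apply, Matrix.smul_apply,
      Matrix.of_apply, smul_eq_mul]
    split_ifs <;> field_simp <;> ring
  rw [h3, Matrix.det_smul] at h1
  have h4 : ∏ j, (α + Real.sqrt N * x - Γ.θ j) =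
      Real.sqrt N ^ (Fintype.card (Fin (Γ.d + 1))) * ∏ j, (x - Γ.η α N j) := by
    simp only [h2, Finset.prod_mul_distrib, Finset.prod_const, Finset.card_univ]
  have h5 := h1.trans h4
  have h6 := mul_left_cancel₀ (pow_ne_zero _ hs.ne') h5
  rw [← h6]
  congr 1
  ext i j
  simp only [RingHom.mapMatrix_apply, Matrix.map_apply, Matrix.of_apply,
    Polynomial.coe_evalRingHom, Polynomial.eval_sub, Polynomial.eval_C]
  split_ifs <;> simp

attribute [local instance] Polynomial.algebra in
lemma isIntegral_coeff_prod_X_sub_η (α N : ℕ) (hN : 1 ≤ N) (B : Finset (Fin (Γ.d + 1)))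
    (hB : ∀ i, i ∉ B → Γ.GoodRow α N i) (n : ℕ) :
    IsIntegral ℤ ((Polynomial.C (Real.sqrt N ^ B.card) *
      ∏ j, (Polynomial.X - Polynomial.C (Γ.η α N j))).coeff n) := by
  have hs : 0 < Real.sqrt N := Real.sqrt_pos.2 (by exact_mod_cast hN)
  rw [prod_X_sub_η_eq_det Γ α N hN]
  set v : Fin (Γ.d + 1) → Polynomial ℝ :=
    fun i => Polynomial.C (if i ∈ B then Real.sqrt N else 1) with hv
  have hv1 : Polynomial.C (Real.sqrt N ^ B.card) = ∏ i, v i := by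
    rw [hv, ← map_prod, Finset.prod_ite_mem, Finset.univ_inter, Finset.prod_const]
  rw [hv1, ← Matrix.det_mul_column]
  revert n
  rw [← Polynomial.isIntegral_iff_isIntegral_coeff]
  refine IsIntegral.det fun i j => ?_
  rw [Polynomial.isIntegral_iff_isIntegral_coeff]
  intro n
  simp only [Matrix.of_apply, hv]
  by_cases hi : i ∈ B
  · have h1 : Polynomial.C (if i ∈ B then Real.sqrt N else 1) *
        ((if i = j then (Polynomial.X : Polynomial ℝ) else 0) -
        Polynomial.C ((Γ.J i j - if i = j then (α : ℝ) else 0) / Real.sqrt N)) =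
        Polynomial.C (if i = j then Real.sqrt N else 0) * Polynomial.X -
        Polynomial.C (Γ.J i j - if i = j then (α : ℝ) else 0) := by
      rw [if_pos hi, mul_sub, ← Polynomial.C_mul, mul_div_cancel₀ _ hs.ne']
      split_ifs <;> simp
    rw [h1, Polynomial.coeff_sub, Polynomial.coeff_C_mul, Polynomial.coeff_X, Polynomial.coeff_C]
    have h2 : IsIntegral ℤ (if i = j then Real.sqrt N else 0) := by
      split_ifs
      · exact isIntegral_sqrt_natCast N
      · exact isIntegral_zero
    have h3 : IsIntegral ℤ (Γ.J i j - if i = j then (α : ℝ) else 0) := by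
      refine (Γ.isIntegral_J i j).sub ?_
      split_ifs
      · exact isIntegral_natCast _
      · exact isIntegral_zero
    refine IsIntegral.sub (h2.mul ?_) ?_
    · split_ifs
      · exact isIntegral_one
      · exact isIntegral_zero
    · by_cases hn : n = 0
      · rw [if_pos hn]; exact h3
      · rw [if_neg hn]; exact isIntegral_zero
  · obtain ⟨ha, hr, hr'⟩ := hB i hi
    rw [if_neg hi, Polynomial.C_1, one_mul, Polynomial.coeff_sub, Polynomial.coeff_C]
    refine IsIntegral.sub ?_ ?_
    · split_ifs
      · rw [Polynomial.coeff_X]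
        split_ifs
        · exact isIntegral_one
        · exact isIntegral_zero
      · simpa using isIntegral_zero
    · have h2 : IsIntegral ℤ ((Γ.J i j - if i = j then (α : ℝ) else 0) / Real.sqrt N) := by
        simp only [J, Matrix.of_apply]
        by_cases h1 : i = j
        · subst h1
          simp [ha, isIntegral_zero]
        · have h1' : ¬ (j : ℕ) = i := fun h => h1 (Fin.ext h.symm)
          rw [if_neg h1, if_neg h1', sub_zero]
          split_ifs with h3 h4
          · rw [hr' (by omega), div_self hs.ne']; exact isIntegral_one
          · have h5 : (j : ℕ) = i - 1 := by omega
            rw [h5, hr (by omega), div_self hs.ne']; exact isIntegral_one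
          · rw [zero_div]; exact isIntegral_zero
      by_cases hn : n = 0
      · rw [if_pos hn]; exact h2
      · rw [if_neg hn]; exact isIntegral_zero

/-- Power sums of the eigenvalues over a union of level sets of `F` are rational. -/
lemma rat_sum_θ_pow_of_level (S : Finset (Fin (Γ.d + 1)))
    (hS : ∀ i ∈ S, ∀ j, Γ.F (Γ.θ i) = Γ.F (Γ.θ j) → j ∈ S) (m : ℕ) :
    ∃ z : ℚ, ∑ j ∈ S, Γ.θ j ^ m = z := by
  classical
  choose f hf using Γ.rat_F_θ
  set g : Polynomial ℚ := Lagrange.interpolate (Finset.univ.image f) id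
    (fun y => if ∃ i ∈ S, f i = y then 1 else 0) with hg
  have hgf : ∀ j, g.eval (f j) = if j ∈ S then 1 else 0 := by
    intro j
    have h1 := Lagrange.eval_interpolate_at_node (s := Finset.univ.image f) (v := id)
      (fun y => if ∃ i ∈ S, f i = y then (1 : ℚ) else 0) (Function.injective_id.injOn)
      (i := f j) (Finset.mem_image_of_mem _ (Finset.mem_univ _))
    rw [id] at h1
    rw [hg, h1]
    refine if_congr ⟨?_, fun h => ⟨j, h, rfl⟩⟩ rfl rfl
    rintro ⟨i, hi, hij⟩
    exact hS i hi j (by rw [hf, hf, hij])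
  set P : Polynomial ℚ := Polynomial.X ^ m * g.comp (arrF Γ.a Γ.b Γ.c Γ.d) with hP
  have h1 : ∀ j, Polynomial.aeval (Γ.θ j) P = if j ∈ S then Γ.θ j ^ m else 0 := by
    intro j
    rw [hP, map_mul, map_pow, Polynomial.aeval_X, Polynomial.aeval_comp, ← F_eq_aeval, hf]
    have : Polynomial.aeval ((f j : ℚ) : ℝ) g = ((g.eval (f j) : ℚ) : ℝ) :=
      (Polynomial.aeval_algebraMap_apply ℝ (f j) g)
    rw [this, hgf]
    split_ifs <;> simp
  choose z hz using Γ.rat_sum_θ_pow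
  refine ⟨∑ n ∈ Finset.range (P.natDegree + 1), P.coeff n * z n, ?_⟩
  have h2 : ∑ j ∈ S, Γ.θ j ^ m = ∑ j, Polynomial.aeval (Γ.θ j) P := by
    simp only [h1, Finset.sum_ite_mem, Finset.univ_inter]
  rw [h2]
  simp only [Polynomial.aeval_eq_sum_range]
  rw [Finset.sum_comm]
  push_cast
  refine Finset.sum_congr rfl fun n _ => ?_
  rw [← hz, ← Finset.smul_sum, Rat.smul_def]

/-- A discriminant bound for the rescaled eigenvalues in a union of level sets of `F`. -/
theorem one_le_disc (S : Finset (Fin (Γ.d + 1)))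
    (hS : ∀ i ∈ S, ∀ j, Γ.F (Γ.θ i) = Γ.F (Γ.θ j) → j ∈ S) (α N : ℕ) (hN : 1 ≤ N)
    (B : Finset (Fin (Γ.d + 1))) (hB : ∀ i, i ∉ B → Γ.GoodRow α N i) :
    1 ≤ Real.sqrt N ^ (2 * B.card * S.card) *
      ∏ i ∈ S, ∏ j ∈ S.erase i, |Γ.η α N i - Γ.η α N j| := by
  classical
  have hN1 : (1 : ℝ) ≤ N := by exact_mod_cast hN
  have hs1 : 1 ≤ Real.sqrt N := Real.one_le_sqrt.2 hN1
  have hs : 0 < Real.sqrt N := by linarith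
  set n := S.card with hn
  set φ : Fin n ≃ S := S.equivFin.symm with hφ
  set e : ℝ := Real.sqrt N ^ B.card with he
  set v : Fin n → ℝ := fun i => Γ.η α N (φ i) with hv
  set u : Fin n → ℝ := fun i => Γ.θ (φ i) with hu
  have hintg : IsIntegral ℤ (e ^ (n - 1) * (Matrix.vandermonde v).det) := by
    refine isIntegral_pow_mul_det_vandermonde v e fun T => ?_
    have h1 := isIntegral_mul_prod_subset (Γ.η α N) e Finset.univ
      (Γ.isIntegral_coeff_prod_X_sub_η α N hN B hB)
      (T := T.map ⟨fun i => (φ i : Fin (Γ.d + 1)), fun a b h => φ.injective (Subtype.ext h)⟩)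
      (Finset.subset_univ _)
    rw [Finset.prod_map] at h1
    exact h1
  have hrat : ∃ z : ℚ, (Matrix.vandermonde u).det ^ 2 = z := by
    choose z hz using Γ.rat_sum_θ_pow_of_level S hS
    refine ⟨(Matrix.of fun i j : Fin n => z (i + j)).det, ?_⟩
    have h1 : (Matrix.vandermonde u).det ^ 2 =
        ((Matrix.vandermonde u)ᵀ * Matrix.vandermonde u).det := by
      rw [Matrix.det_mul, Matrix.det_transpose, sq]
    rw [h1, show (((Matrix.of fun i j : Fin n => z (i + j)).det : ℚ) : ℝ) =
      (algebraMap ℚ ℝ) (Matrix.of fun i j : Fin n => z (i + j)).det from rfl, RingHom.map_det]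
    congr 1
    ext i j
    simp only [Matrix.mul_apply, Matrix.transpose_apply, Matrix.vandermonde_apply,
      RingHom.mapMatrix_apply, Matrix.map_apply, Matrix.of_apply]
    have h2 := hz (i + j)
    rw [← Finset.sum_coe_sort S, ← Equiv.sum_comp φ] at h2
    refine Eq.trans (Finset.sum_congr rfl fun m _ => ?_) h2
    rw [← pow_add]
  have huv : (Matrix.vandermonde u).det = Real.sqrt N ^ (∑ i : Fin n, (i : ℕ)) *
      (Matrix.vandermonde v).det := by
    rw [← Finset.prod_pow_eq_pow_sum, ← Matrix.det_mul_row,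
      ← Matrix.det_vandermonde_sub u (α : ℝ)]
    congr 1
    ext i j
    simp only [Matrix.vandermonde_apply, Matrix.of_apply, hv, hu, η]
    rw [← mul_pow, mul_div_cancel₀ _ hs.ne']
  have hv0 : (Matrix.vandermonde v).det ≠ 0 := by
    rw [Matrix.det_vandermonde_ne_zero_iff]
    intro i j hij
    have h1 : Γ.θ (φ i) = Γ.θ (φ j) := by
      simp only [hv, η] at hij
      have := (div_left_inj' hs.ne').1 hij
      linarith
    exact φ.injective (Subtype.ext (Γ.θ_injective h1))
  have hsq : ∃ m : ℤ, (e ^ (n - 1) * (Matrix.vandermonde v).det) ^ 2 = m := by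
    obtain ⟨z, hz⟩ := hrat
    set a := ∑ i : Fin n, (i : ℕ) with ha
    have h1 : (e ^ (n - 1) * (Matrix.vandermonde v).det) ^ 2 =
        (((N : ℚ) ^ (B.card * (n - 1)) / (N : ℚ) ^ a * z : ℚ) : ℝ) := by
      push_cast
      rw [← hz, huv, he]
      have h2 : (N : ℝ) = Real.sqrt N ^ 2 := (Real.sq_sqrt (by linarith)).symm
      rw [h2, Real.sqrt_sq hs.le]
      field_simp
      ring
    have h3 := hintg.pow 2
    rw [h1] at h3
    have h4 : IsIntegral ℤ ((N : ℚ) ^ (B.card * (n - 1)) / (N : ℚ) ^ a * z) :=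
      (isIntegral_algebraMap_iff (B := ℝ) (algebraMap ℚ ℝ).injective).1 h3
    obtain ⟨m, hm⟩ := IsIntegrallyClosed.isIntegral_iff.1 h4
    refine ⟨m, ?_⟩
    rw [h1, ← hm]
    simp
  have hone : 1 ≤ (e ^ (n - 1) * (Matrix.vandermonde v).det) ^ 2 := by
    obtain ⟨m, hm⟩ := hsq
    have h1 : 0 < (e ^ (n - 1) * (Matrix.vandermonde v).det) ^ 2 := by
      have : e ≠ 0 := pow_ne_zero _ hs.ne'
      positivity
    rw [hm] at h1 ⊢
    exact_mod_cast h1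
  have hdet : ∏ i ∈ S, ∏ j ∈ S.erase i, |Γ.η α N i - Γ.η α N j| =
      (Matrix.vandermonde v).det ^ 2 := by
    have h1 : ∏ i ∈ S, ∏ j ∈ S.erase i, |Γ.η α N i - Γ.η α N j| =
        ∏ i : Fin n, ∏ j ∈ {i}ᶜ, |v j - v i| := by
      rw [← Finset.prod_coe_sort S, ← Equiv.prod_comp φ]
      refine Finset.prod_congr rfl fun i _ => ?_
      refine (Finset.prod_bij (fun j _ => ((φ j : S) : Fin (Γ.d + 1))) ?_ ?_ ?_ ?_).symm
      · intro j hj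
        rw [Finset.mem_compl, Finset.mem_singleton] at hj
        exact Finset.mem_erase.2 ⟨fun h => hj (φ.injective (Subtype.ext h)), (φ j).2⟩
      · exact fun _ _ _ _ h => φ.injective (Subtype.ext h)
      · intro j hj
        rw [Finset.mem_erase] at hj
        refine ⟨φ.symm ⟨j, hj.2⟩, ?_, by simp⟩
        rw [Finset.mem_compl, Finset.mem_singleton]
        intro h
        apply hj.1
        rw [← h]; simp
      · intro j _
        rw [abs_sub_comm]
    rw [h1, ← Finset.prod_prod_Ioi_mul_eq_prod_prod_off_diag (fun j i => |v j - v i|),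
      ← sq_abs, Matrix.det_vandermonde, Finset.abs_prod, sq, ← Finset.prod_mul_distrib]
    refine Finset.prod_congr rfl fun i _ => ?_
    rw [Finset.abs_prod, ← Finset.prod_mul_distrib]
    refine Finset.prod_congr rfl fun j _ => ?_
    rw [abs_sub_comm (v i)]
  rw [hdet]
  refine hone.trans ?_
  rw [mul_pow]
  refine mul_le_mul_of_nonneg_right ?_ (sq_nonneg _)
  rw [he, ← pow_mul, ← pow_mul]
  refine pow_le_pow_right₀ hs1 ?_
  have : B.card * (n - 1) ≤ B.card * n := Nat.mul_le_mul_left _ (by omega)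
  nlinarith

end IntArray

/-- Every real polynomial is a linear combination of the rescaled Chebyshev polynomials. -/
lemma Polynomial.chebyshev_C_induction {P : Polynomial ℝ → Prop} (hadd : ∀ f g, P f → P g → P (f + g))
    (hsmul : ∀ (c : ℝ) f, P f → P (Polynomial.C c * f))
    (hC : ∀ m : ℕ, P (Polynomial.Chebyshev.C ℝ m)) (g : Polynomial ℝ) : P g := by
  have h0 : P 0 := by simpa using hsmul 0 _ (hC 0)
  set W : Submodule ℝ (Polynomial ℝ) :=
    Submodule.span ℝ (Set.range fun m : ℕ => Polynomial.Chebyshev.C ℝ m) with hW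
  have hWP : ∀ f ∈ W, P f := by
    intro f hf
    induction hf using Submodule.span_induction with
    | mem x hx => obtain ⟨m, rfl⟩ := hx; exact hC m
    | zero => exact h0
    | add x y _ _ hx hy => exact hadd x y hx hy
    | smul c x _ hx => rw [Polynomial.smul_eq_C_mul]; exact hsmul c x hx
  have hmem : ∀ m : ℕ, Polynomial.Chebyshev.C ℝ m ∈ W := fun m => Submodule.subset_span ⟨m, rfl⟩
  have hX : ∀ f ∈ W, Polynomial.X * f ∈ W := by
    intro f hf
    induction hf using Submodule.span_induction with
    | mem x hx =>
      obtain ⟨m, rfl⟩ := hx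
      have h1 : Polynomial.X * Polynomial.Chebyshev.C ℝ m =
          Polynomial.Chebyshev.C ℝ ((m + 1 : ℕ) : ℤ) + Polynomial.Chebyshev.C ℝ ((m : ℤ) - 1) := by
        push_cast
        rw [Polynomial.Chebyshev.C_add_one]; ring
      simp only [h1]
      refine W.add_mem (hmem _) ?_
      rw [← Polynomial.Chebyshev.C_natAbs]
      exact hmem _
    | zero => simp
    | add x y _ _ hx hy => rw [mul_add]; exact W.add_mem hx hy
    | smul c x _ hx => rw [mul_smul_comm]; exact W.smul_mem _ hx
  have hpow : ∀ n : ℕ, (Polynomial.X : Polynomial ℝ) ^ n ∈ W := by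
    intro n
    induction n with
    | zero =>
      have h1 := W.smul_mem (1 / 2 : ℝ) (hmem 0)
      have h2 : (1 / 2 : ℝ) • Polynomial.Chebyshev.C ℝ ((0 : ℕ) : ℤ) = Polynomial.X ^ 0 := by
        rw [Nat.cast_zero, Polynomial.Chebyshev.C_zero, Polynomial.smul_eq_C_mul, pow_zero,
          show (2 : Polynomial ℝ) = Polynomial.C 2 from rfl, ← Polynomial.C_mul]
        norm_num
      rwa [h2] at h1
    | succ n ih => rw [pow_succ']; exact hX _ ih
  refine hWP g ?_
  rw [Polynomial.as_sum_range_C_mul_X_pow g]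
  refine W.sum_mem fun i _ => ?_
  rw [← Polynomial.smul_eq_C_mul]
  exact W.smul_mem _ (hpow i)

/-- The mean of a polynomial with respect to the arcsine law on `[-2, 2]`. -/
noncomputable def arcsineMean (g : Polynomial ℝ) : ℝ :=
  (1 / Real.pi) * ∫ t in (0 : ℝ)..Real.pi, g.eval (2 * Real.cos t)

lemma intervalIntegrable_eval_cos (g : Polynomial ℝ) (a b : ℝ) :
    IntervalIntegrable (fun t => g.eval (2 * Real.cos t)) MeasureTheory.volume a b :=
  (g.continuous.comp (by fun_prop)).intervalIntegrable _ _

lemma arcsineMean_add (f g : Polynomial ℝ) :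
    arcsineMean (f + g) = arcsineMean f + arcsineMean g := by
  simp only [arcsineMean, Polynomial.eval_add]
  rw [intervalIntegral.integral_add (intervalIntegrable_eval_cos f _ _)
    (intervalIntegrable_eval_cos g _ _), mul_add]

lemma arcsineMean_C_mul (c : ℝ) (g : Polynomial ℝ) :
    arcsineMean (Polynomial.C c * g) = c * arcsineMean g := by
  simp only [arcsineMean, Polynomial.eval_mul, Polynomial.eval_C]
  rw [intervalIntegral.integral_const_mul]; ring

lemma arcsineMean_C_zero : arcsineMean (Polynomial.Chebyshev.C ℝ (0 : ℕ)) = 2 := by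
  simp [arcsineMean, Polynomial.Chebyshev.C_zero]

lemma arcsineMean_C_pos {m : ℕ} (hm : 1 ≤ m) :
    arcsineMean (Polynomial.Chebyshev.C ℝ m) = 0 := by
  have hm0 : (m : ℝ) ≠ 0 := by positivity
  simp only [arcsineMean, Polynomial.Chebyshev.C_two_mul_real_cos, Int.cast_natCast]
  rw [intervalIntegral.integral_const_mul,
    intervalIntegral.integral_comp_mul_left (fun t => Real.cos t) hm0, integral_cos]
  simp [Real.sin_nat_mul_pi]

namespace IntArray

variable {k : ℕ} (Γ : IntArray k)

/-- The rows of the array are constant on the interval `[w, w + l]`. -/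
structure Window (w l : ℕ) (r α : ℝ) : Prop where
  le : w + l ≤ Γ.d
  r_eq : ∀ i, w ≤ i → i < w + l → Γ.r i = r
  a_eq : ∀ i, w < i → i < w + l → (Γ.a i : ℝ) = α
  one_le : 1 ≤ r
  abs_le : |α| ≤ k

variable {Γ} {w l : ℕ} {r α : ℝ}

lemma Window.recur (h : Γ.Window w l r α) {i : ℕ} (h1 : w < i) (h2 : i < w + l) (x : ℝ) :
    Γ.q (i + 1) x = (x - α) / r * Γ.q i x - Γ.q (i - 1) x := by
  obtain ⟨j, rfl⟩ : ∃ j, i = j + 1 := ⟨i - 1, by omega⟩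
  have h3 := Γ.q_rec_succ (i := j) (by have := h.le; omega) x
  have hr := h.one_le
  rw [h.r_eq _ (by omega) (by omega), h.r_eq j (by omega) (by omega), h.a_eq _ (by omega) (by omega)] at h3
  simp only [Nat.add_sub_cancel]
  field_simp
  linarith

lemma Window.chebyshev (h : Γ.Window w l r α) (x : ℝ) (m : ℕ) :
    ∀ i, w + m ≤ i → i + m ≤ w + l → (Polynomial.Chebyshev.C ℝ m).eval ((x - α) / r) * Γ.q i x =
      Γ.q (i + m) x + Γ.q (i - m) x := by
  induction m using Nat.twoStepInduction with
  | zero => intro i _ _; simp [Polynomial.Chebyshev.C_zero]; ring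
  | one =>
    intro i h1 h2
    simp only [Nat.cast_one, Polynomial.Chebyshev.C_one, Polynomial.eval_X]
    rw [h.recur (by omega) (by omega)]; ring
  | more m ih1 ih2 =>
    intro i h1 h2
    have e1 := ih1 i (by omega) (by omega)
    have e2 := ih2 i (by omega) (by omega)
    have e3 := h.recur (i := i + (m + 1)) (by omega) (by omega) x
    have e4 := h.recur (i := i - (m + 1)) (by omega) (by omega) x
    have e5 : i - (m + 1) + 1 = i - m := by omega
    have e6 : i - (m + 1) - 1 = i - (m + 2) := by omega
    have e7 : i + (m + 1) - 1 = i + m := by omega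
    rw [e5, e6] at e4
    rw [e7] at e3
    push_cast at e2 ⊢
    rw [Polynomial.Chebyshev.C_add_two, Polynomial.eval_sub, Polynomial.eval_mul, Polynomial.eval_X]
    rw [show i + (m + 2) = i + (m + 1) + 1 by ring, e3]
    linear_combination ((x - α) / r) * e2 - e1 - e4

lemma Window.abs_eta_le (h : Γ.Window w l r α) (j : Fin (Γ.d + 1)) :
    |(Γ.θ j - α) / r| ≤ 4 * k := by
  have hr := h.one_le
  have h1 : |Γ.θ j - α| ≤ 4 * k := by
    refine (abs_sub _ _).trans ?_
    linarith [Γ.abs_θ_le j, h.abs_le]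
  rw [abs_div, abs_of_pos (by linarith : 0 < r)]
  exact (div_le_self (abs_nonneg _) hr).trans h1

end IntArray

lemma Polynomial.exists_bound_abs_eval (g : Polynomial ℝ) (R : ℝ) :
    ∃ C, 0 ≤ C ∧ ∀ x, |x| ≤ R → |g.eval x| ≤ C := by
  obtain ⟨C, hC⟩ := (isCompact_Icc (a := -R) (b := R)).exists_bound_of_continuousOn
    g.continuous.continuousOn
  exact ⟨max C 0, le_max_right _ _, fun x hx => (hC x (abs_le.1 hx)).trans (le_max_left _ _)⟩

namespace IntArray

/-- Window moments agree with the arcsine law up to a bounded error. -/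
theorem exists_window_moment (k : ℕ) (g : Polynomial ℝ) : ∃ C : ℝ, ∀ (Γ : IntArray k)
    (w l : ℕ) (r α : ℝ), Γ.Window w l r α →
    |∑ t ∈ Finset.range l, ∑ j, Γ.w j * Γ.q (w + t) (Γ.θ j) ^ 2 * g.eval ((Γ.θ j - α) / r) -
      l * arcsineMean g| ≤ C := by
  induction g using Polynomial.chebyshev_C_induction with
  | hadd f g hf hg =>
    obtain ⟨C1, h1⟩ := hf
    obtain ⟨C2, h2⟩ := hg
    refine ⟨C1 + C2, fun Γ w l r α h => ?_⟩
    refine le_trans (le_of_eq ?_) ((abs_add_le _ _).trans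
      (add_le_add (h1 Γ w l r α h) (h2 Γ w l r α h)))
    congr 1
    simp only [Polynomial.eval_add, mul_add, Finset.sum_add_distrib, arcsineMean_add]
    ring
  | hsmul c f hf =>
    obtain ⟨C1, h1⟩ := hf
    refine ⟨|c| * C1, fun Γ w l r α h => ?_⟩
    refine le_trans (le_of_eq ?_) (mul_le_mul_of_nonneg_left (h1 Γ w l r α h) (abs_nonneg c))
    rw [← abs_mul]
    congr 1
    simp only [Polynomial.eval_mul, Polynomial.eval_C, arcsineMean_C_mul, mul_sub, Finset.mul_sum]
    congr 1
    · refine Finset.sum_congr rfl fun t _ => Finset.sum_congr rfl fun j _ => ?_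
      ring
    · ring
  | hC m =>
    rcases Nat.eq_zero_or_pos m with rfl | hm
    · refine ⟨0, fun Γ w l r α h => ?_⟩
      rw [arcsineMean_C_zero]
      have h1 : ∀ t ∈ Finset.range l, ∑ j, Γ.w j * Γ.q (w + t) (Γ.θ j) ^ 2 *
          (Polynomial.Chebyshev.C ℝ ((0 : ℕ) : ℤ)).eval ((Γ.θ j - α) / r) = 2 := by
        intro t ht
        rw [Finset.mem_range] at ht
        have h2 := Γ.sum_w_q_q (i := w + t) (i' := w + t) (by have := h.le; omega)
          (by have := h.le; omega)
        simp only [if_true] at h2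
        simp only [Nat.cast_zero, Polynomial.Chebyshev.C_zero, Polynomial.eval_ofNat]
        rw [← Finset.sum_mul]
        simp only [sq, h2]; norm_num
      rw [Finset.sum_congr rfl h1]
      simp
    · obtain ⟨C, hC0, hC⟩ := Polynomial.exists_bound_abs_eval (Polynomial.Chebyshev.C ℝ m) (4 * k)
      refine ⟨2 * m * C, fun Γ w l r α h => ?_⟩
      rw [arcsineMean_C_pos hm, mul_zero, sub_zero]
      refine (Finset.abs_sum_le_sum_abs _ _).trans ?_
      have hle := h.le
      have h1 : ∀ t ∈ Finset.range l, |∑ j, Γ.w j * Γ.q (w + t) (Γ.θ j) ^ 2 *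
          (Polynomial.Chebyshev.C ℝ m).eval ((Γ.θ j - α) / r)| ≤
          (if t < m then C else 0) + (if l ≤ t + m then C else 0) := by
        intro t ht
        rw [Finset.mem_range] at ht
        by_cases hin : m ≤ t ∧ t + m < l
        · rw [if_neg (by omega), if_neg (by omega), add_zero]
          refine le_of_eq ?_
          rw [abs_eq_zero]
          have h2 : ∀ j, Γ.w j * Γ.q (w + t) (Γ.θ j) ^ 2 *
              (Polynomial.Chebyshev.C ℝ m).eval ((Γ.θ j - α) / r) =
              Γ.w j * (Γ.q (w + t) (Γ.θ j) * Γ.q (w + t + m) (Γ.θ j)) +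
              Γ.w j * (Γ.q (w + t) (Γ.θ j) * Γ.q (w + t - m) (Γ.θ j)) := by
            intro j
            linear_combination Γ.w j * Γ.q (w + t) (Γ.θ j) *
              h.chebyshev (Γ.θ j) m (w + t) (by omega) (by omega)
          simp only [h2, Finset.sum_add_distrib]
          rw [Γ.sum_w_q_q (by omega) (by omega), Γ.sum_w_q_q (by omega) (by omega),
            if_neg (by omega), if_neg (by omega), add_zero]
        · have h2 : |∑ j, Γ.w j * Γ.q (w + t) (Γ.θ j) ^ 2 *
              (Polynomial.Chebyshev.C ℝ m).eval ((Γ.θ j - α) / r)| ≤ C := by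
            refine (Finset.abs_sum_le_sum_abs _ _).trans ?_
            have h3 : ∀ j ∈ (Finset.univ : Finset (Fin (Γ.d + 1))),
                |Γ.w j * Γ.q (w + t) (Γ.θ j) ^ 2 *
                (Polynomial.Chebyshev.C ℝ m).eval ((Γ.θ j - α) / r)| ≤
                Γ.w j * (Γ.q (w + t) (Γ.θ j) * Γ.q (w + t) (Γ.θ j)) * C := by
              intro j _
              have h4 : 0 ≤ Γ.w j * (Γ.q (w + t) (Γ.θ j) * Γ.q (w + t) (Γ.θ j)) :=
                mul_nonneg (Γ.w_pos j).le (mul_self_nonneg _)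
              rw [abs_mul, sq, abs_of_nonneg h4]
              exact mul_le_mul_of_nonneg_left (hC _ (h.abs_eta_le j)) h4
            refine (Finset.sum_le_sum h3).trans ?_
            rw [← Finset.sum_mul, Γ.sum_w_q_q (by omega) (by omega), if_pos rfl, one_mul]
          rcases not_and_or.1 hin with h3 | h3
          · rw [if_pos (by omega : t < m)]
            split_ifs <;> linarith
          · rw [if_pos (by omega : l ≤ t + m)]
            split_ifs <;> linarith
      refine (Finset.sum_le_sum h1).trans ?_
      rw [Finset.sum_add_distrib, ← Finset.sum_filter, ← Finset.sum_filter, Finset.sum_const,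
        Finset.sum_const, nsmul_eq_mul, nsmul_eq_mul]
      have c1 : ((Finset.range l).filter (· < m)).card ≤ m := by
        refine (Finset.card_le_card (t := Finset.range m) fun x hx => ?_).trans
          (by rw [Finset.card_range])
        exact Finset.mem_range.2 (Finset.mem_filter.1 hx).2
      have c2 : ((Finset.range l).filter (fun t => l ≤ t + m)).card ≤ m := by
        refine (Finset.card_le_card (t := Finset.Ico (l - m) l) fun x hx => ?_).trans
          (by rw [Nat.card_Ico]; omega)
        rw [Finset.mem_filter, Finset.mem_range] at hx
        rw [Finset.mem_Ico]; omega
      have c1' : (((Finset.range l).filter (· < m)).card : ℝ) ≤ m := by exact_mod_cast c1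
      have c2' : (((Finset.range l).filter (fun t => l ≤ t + m)).card : ℝ) ≤ m := by
        exact_mod_cast c2
      nlinarith

end IntArray

namespace IntArray

variable {k : ℕ} (Γ : IntArray k)

/-- The local size of the sequence `q` near `i`. -/
noncomputable def A (i : ℕ) (x : ℝ) : ℝ := Γ.q i x ^ 2 + Γ.q (i + 1) x ^ 2

lemma A_nonneg (i : ℕ) (x : ℝ) : 0 ≤ Γ.A i x := by unfold A; positivity

variable {Γ} {w l : ℕ} {r α : ℝ}

/-- The invariant quadratic form in a window. -/
lemma Window.invariant (h : Γ.Window w l r α) (x : ℝ) {t : ℕ} (ht : t < l) :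
    Γ.q (w + t) x ^ 2 - (x - α) / r * Γ.q (w + t) x * Γ.q (w + t + 1) x + Γ.q (w + t + 1) x ^ 2 =
    Γ.q w x ^ 2 - (x - α) / r * Γ.q w x * Γ.q (w + 1) x + Γ.q (w + 1) x ^ 2 := by
  induction t with
  | zero => simp
  | succ t ih =>
    rw [← ih (by omega), ← add_assoc, h.recur (i := w + t + 1) (by omega) (by omega),
      Nat.add_sub_cancel]
    ring

lemma Window.A_le (h : Γ.Window w l r α) {x κ : ℝ} (hκ : 0 < κ) (hx : |x - α| ≤ (2 - κ) * r)
    {t : ℕ} (ht : t < l) :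
    Γ.A (w + t) x ≤ 4 / κ * Γ.A w x ∧ Γ.A w x ≤ 4 / κ * Γ.A (w + t) x := by
  have hr : 0 < r := by linarith [h.one_le]
  have h1 : |(x - α) / r| ≤ 2 - κ := by
    rw [abs_div, abs_of_pos hr, div_le_iff₀ hr]; exact hx
  set η := (x - α) / r with hη
  have h2 := h.invariant x ht
  rw [← hη] at h2
  have h3 : ∀ a b : ℝ, κ / 2 * (a ^ 2 + b ^ 2) ≤ a ^ 2 - η * a * b + b ^ 2 ∧
      a ^ 2 - η * a * b + b ^ 2 ≤ 2 * (a ^ 2 + b ^ 2) := by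
    intro a b
    obtain ⟨h4, h5⟩ := _root_.abs_le.1 h1
    have h6 : |η * a * b| ≤ (2 - κ) * ((a ^ 2 + b ^ 2) / 2) := by
      rw [mul_assoc, abs_mul]
      refine mul_le_mul h1 ?_ (abs_nonneg _) ((abs_nonneg _).trans h1)
      rw [_root_.abs_le]
      constructor <;> nlinarith [sq_nonneg (a - b), sq_nonneg (a + b)]
    obtain ⟨h7, h8⟩ := _root_.abs_le.1 h6
    constructor <;> nlinarith [sq_nonneg a, sq_nonneg b]
  have h4 := h3 (Γ.q (w + t) x) (Γ.q (w + t + 1) x)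
  have h5 := h3 (Γ.q w x) (Γ.q (w + 1) x)
  rw [h2] at h4
  unfold A
  constructor
  · rw [div_mul_eq_mul_div, le_div_iff₀ hκ]; linarith [h4.1, h5.2]
  · rw [div_mul_eq_mul_div, le_div_iff₀ hκ]; linarith [h4.2, h5.1]

/-- The part of `w_j F(θ_j) = 1` carried by a window. -/
noncomputable def mass (Γ : IntArray k) (w l : ℕ) (j : Fin (Γ.d + 1)) : ℝ :=
  ∑ t ∈ Finset.range l, Γ.w j * Γ.q (w + t) (Γ.θ j) ^ 2

lemma mass_nonneg (w l : ℕ) (j : Fin (Γ.d + 1)) : 0 ≤ Γ.mass w l j :=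
  Finset.sum_nonneg fun _ _ => mul_nonneg (Γ.w_pos j).le (sq_nonneg _)

lemma sum_q_sq_le_F (h : w + l ≤ Γ.d + 1) (x : ℝ) :
    ∑ t ∈ Finset.range l, Γ.q (w + t) x ^ 2 ≤ Γ.F x := by
  rw [F, ← Finset.sum_image (f := fun i => Γ.q i x ^ 2) (g := fun t => w + t) (by simp)]
  refine Finset.sum_le_sum_of_subset_of_nonneg ?_ fun _ _ _ => sq_nonneg _
  intro i hi
  obtain ⟨t, ht, rfl⟩ := Finset.mem_image.1 hi
  rw [Finset.mem_range] at ht ⊢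
  omega

lemma mass_le_one (h : w + l ≤ Γ.d + 1) (j : Fin (Γ.d + 1)) : Γ.mass w l j ≤ 1 := by
  rw [← Γ.w_mul_F j, mass, ← Finset.mul_sum]
  exact mul_le_mul_of_nonneg_left (sum_q_sq_le_F h _) (Γ.w_pos j).le

lemma sum_mass (h : w + l ≤ Γ.d + 1) : ∑ j, Γ.mass w l j = l := by
  simp only [mass]
  rw [Finset.sum_comm]
  have h1 : ∀ t ∈ Finset.range l, ∑ j, Γ.w j * Γ.q (w + t) (Γ.θ j) ^ 2 = 1 := by
    intro t ht
    rw [Finset.mem_range] at ht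
    have := Γ.sum_w_q_q (i := w + t) (i' := w + t) (by omega) (by omega)
    simp only [sq]
    simpa using this
  rw [Finset.sum_congr rfl h1]
  simp

/-- A bound for `F` from above at eigenvalues with large mass in a window. -/
lemma Window.F_le (h : Γ.Window w l r α) {κ δ : ℝ} (hκ : 0 < κ) (hδ : 0 < δ) {j : Fin (Γ.d + 1)}
    (hx : |Γ.θ j - α| ≤ (2 - κ) * r) (hj : δ ≤ Γ.mass w l j) :
    Γ.F (Γ.θ j) ≤ l * (4 / κ) / δ * Γ.A w (Γ.θ j) := by
  have h1 : Γ.mass w l j ≤ Γ.w j * (l * (4 / κ) * Γ.A w (Γ.θ j)) := by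
    rw [mass, ← Finset.mul_sum]
    refine mul_le_mul_of_nonneg_left ?_ (Γ.w_pos j).le
    have h2 : ∀ t ∈ Finset.range l, Γ.q (w + t) (Γ.θ j) ^ 2 ≤ 4 / κ * Γ.A w (Γ.θ j) := by
      intro t ht
      refine le_trans ?_ (h.A_le hκ hx (Finset.mem_range.1 ht)).1
      unfold A
      linarith [sq_nonneg (Γ.q (w + t + 1) (Γ.θ j))]
    refine (Finset.sum_le_sum h2).trans (le_of_eq ?_)
    simp; ring
  have h2 := Γ.w_mul_F j
  have h3 := Γ.w_pos j
  rw [div_mul_eq_mul_div, le_div_iff₀ hδ]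
  have h4 : Γ.F (Γ.θ j) * δ ≤ Γ.F (Γ.θ j) * (Γ.w j * (l * (4 / κ) * Γ.A w (Γ.θ j))) :=
    mul_le_mul_of_nonneg_left (hj.trans h1) (by linarith [Γ.one_le_F (Γ.θ j)])
  calc _ ≤ _ := h4
    _ = (Γ.w j * Γ.F (Γ.θ j)) * (l * (4 / κ) * Γ.A w (Γ.θ j)) := by ring
    _ = _ := by rw [h2, one_mul]

lemma Window.le_F (h : Γ.Window w l r α) {κ x : ℝ} (hκ : 0 < κ)
    (hx : |x - α| ≤ (2 - κ) * r) :
    l * (κ / 8) * Γ.A w x ≤ Γ.F x := by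
  have hle := h.le
  have h1 := sum_q_sq_le_F (Γ := Γ) (w := w) (l := l) (by omega) x
  have h2 := sum_q_sq_le_F (Γ := Γ) (w := w + 1) (l := l) (by omega) x
  have h3 : ∑ t ∈ Finset.range l, (κ / 4 * Γ.A w x) ≤
      ∑ t ∈ Finset.range l, Γ.q (w + t) x ^ 2 + ∑ t ∈ Finset.range l, Γ.q (w + 1 + t) x ^ 2 := by
    rw [← Finset.sum_add_distrib]
    refine Finset.sum_le_sum fun t ht => ?_
    have := (h.A_le hκ hx (Finset.mem_range.1 ht)).2
    rw [show w + 1 + t = w + t + 1 by ring]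
    rw [div_mul_eq_mul_div, le_div_iff₀ hκ] at this
    unfold A at this ⊢
    linarith
  simp only [Finset.sum_const, Finset.card_range, nsmul_eq_mul] at h3
  linarith

end IntArray

/-- Polynomial approximations of bump functions near a point. -/
lemma exists_polynomial_bump {c R Δ α r : ℝ} (hR : 2 ≤ R) (hΔ : 0 < Δ) (hr : 0 < r) (hΔr : Δ ≤ 4 * r)
    (hc : |c - α| ≤ 2 * r) : ∃ g : Polynomial ℝ,
    (∀ y, |y| ≤ R → g.eval y ≤ 1 + Δ / (128 * Real.pi * r)) ∧
    (∀ y, |y| ≤ R → Δ / 2 ≤ |α + r * y - c| → g.eval y ≤ Δ / (128 * Real.pi * r)) ∧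
    3 * (Δ / (128 * Real.pi * r)) ≤ arcsineMean g := by
  have hpi := Real.pi_pos
  set ε := Δ / (128 * Real.pi * r) with hε
  have hε0 : 0 < ε := by positivity
  set H : ℝ → ℝ := fun y => max 0 (1 - |α + r * y - c| / (Δ / 2)) with hH
  have hHc : Continuous H := by fun_prop
  obtain ⟨g, hg⟩ := exists_polynomial_near_of_continuousOn (-R) R H hHc.continuousOn ε hε0
  refine ⟨g, fun y hy => ?_, fun y hy hyc => ?_, ?_⟩
  · have h1 := (abs_lt.1 (hg y (abs_le.1 hy))).2
    have h2 : H y ≤ 1 := by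
      refine max_le zero_le_one ?_
      have : 0 ≤ |α + r * y - c| / (Δ / 2) := by positivity
      linarith
    linarith
  · have h1 := (abs_lt.1 (hg y (abs_le.1 hy))).2
    have h2 : H y ≤ 0 := by
      refine max_le le_rfl ?_
      have : 1 ≤ |α + r * y - c| / (Δ / 2) := by rwa [le_div_iff₀ (by positivity), one_mul]
      linarith
    linarith
  · have hintg : ∀ a b, IntervalIntegrable (fun t => H (2 * Real.cos t)) MeasureTheory.volume a b :=
      fun a b => (hHc.comp (by fun_prop)).intervalIntegrable _ _
    have h1 : ∫ t in (0 : ℝ)..Real.pi, (H (2 * Real.cos t) - ε) ≤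
        ∫ t in (0 : ℝ)..Real.pi, g.eval (2 * Real.cos t) := by
      refine intervalIntegral.integral_mono_on hpi.le ((hintg _ _).sub (by simp))
        (intervalIntegrable_eval_cos g _ _) fun t _ => ?_
      have h2 : |2 * Real.cos t| ≤ R := by
        rw [abs_mul, abs_two]; nlinarith [Real.abs_cos_le_one t]
      linarith [(abs_lt.1 (hg _ (abs_le.1 h2))).1]
    rw [intervalIntegral.integral_sub (hintg _ _) (by simp), intervalIntegral.integral_const,
      smul_eq_mul, sub_zero] at h1
    set t0 := Real.arccos ((c - α) / (2 * r)) with ht0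
    have hcos : Real.cos t0 = (c - α) / (2 * r) := by
      have h3 : |(c - α) / (2 * r)| ≤ 1 := by
        rw [abs_div, abs_of_pos (by positivity : (0:ℝ) < 2 * r), div_le_one (by positivity)]
        exact hc
      exact Real.cos_arccos (abs_le.1 h3).1 (abs_le.1 h3).2
    have ht00 : 0 ≤ t0 := Real.arccos_nonneg _
    have ht01 : t0 ≤ Real.pi := Real.arccos_le_pi _
    set s := Δ / (8 * r) with hs
    have hs0 : 0 < s := by positivity
    have hs1 : s ≤ 1 / 2 := by rw [hs, div_le_iff₀ (by positivity)]; linarith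
    have hHs : ∀ t, |t - t0| ≤ s → 1 / 2 ≤ H (2 * Real.cos t) := by
      intro t ht
      refine le_trans ?_ (le_max_right _ _)
      have h3 : α + r * (2 * Real.cos t) - c = 2 * r * (Real.cos t - Real.cos t0) := by
        rw [hcos]; field_simp; ring
      have h4 : |Real.cos t - Real.cos t0| ≤ |t - t0| := Real.abs_cos_sub_cos_le t t0
      have h5 : |α + r * (2 * Real.cos t) - c| ≤ Δ / 4 := by
        rw [h3, abs_mul, abs_of_pos (by positivity : (0:ℝ) < 2 * r)]
        have : 2 * r * |Real.cos t - Real.cos t0| ≤ 2 * r * s :=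
          mul_le_mul_of_nonneg_left (h4.trans ht) (by positivity)
        refine this.trans (le_of_eq ?_)
        rw [hs]; field_simp; ring
      have h6 : |α + r * (2 * Real.cos t) - c| / (Δ / 2) ≤ 1 / 2 := by
        rw [div_le_iff₀ (by positivity)]; linarith
      linarith
    obtain ⟨u, hu0, hu1, hut⟩ : ∃ u, 0 ≤ u ∧ u + s ≤ Real.pi ∧
        ∀ t ∈ Set.Icc u (u + s), |t - t0| ≤ s := by
      rcases le_or_gt t0 (Real.pi / 2) with h | h
      · refine ⟨t0, ht00, by linarith [Real.pi_gt_three], fun t ht => ?_⟩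
        rw [abs_le]; constructor <;> linarith [ht.1, ht.2]
      · refine ⟨t0 - s, by linarith [Real.pi_gt_three], by linarith, fun t ht => ?_⟩
        rw [abs_le]; constructor <;> linarith [ht.1, ht.2]
    have h3 : ∫ t in u..(u + s), (1 / 2 : ℝ) ≤ ∫ t in u..(u + s), H (2 * Real.cos t) :=
      intervalIntegral.integral_mono_on (by linarith) (by simp) (hintg _ _)
        fun t ht => hHs t (hut t ht)
    rw [intervalIntegral.integral_const, smul_eq_mul] at h3
    have h4 : ∫ t in u..(u + s), H (2 * Real.cos t) ≤
        ∫ t in (0 : ℝ)..Real.pi, H (2 * Real.cos t) :=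
      intervalIntegral.integral_mono_interval hu0 (by linarith) hu1
        (Filter.Eventually.of_forall fun t => le_max_left _ _) (hintg _ _)
    have h5 : 8 * ε * Real.pi = 1 / 2 * s := by
      rw [hε, hs]; field_simp; ring
    rw [arcsineMean, one_div, ← div_eq_inv_mul, le_div_iff₀ hpi]
    nlinarith

namespace IntArray

/-- In a long window, every subinterval of the spectrum contains many eigenvalues with large mass. -/
lemma exists_card_ge (k : ℕ) {c Δ α r ν : ℝ} (hk : 1 ≤ k) (hΔ : 0 < Δ) (hΔr : Δ ≤ 4 * r)
    (hr : 0 < r) (hc : |c - α| ≤ 2 * r) (hν : 0 < ν) : ∃ d0 : ℕ, ∀ (Γ : IntArray k) (w l : ℕ),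
    d0 ≤ Γ.d → Γ.Window w l r α → ν * Γ.d ≤ l →
    ν * (Δ / (128 * Real.pi * r)) / 2 * Γ.d ≤ ((Finset.univ.filter fun j => |Γ.θ j - c| < Δ / 2 ∧
      ν * (Δ / (128 * Real.pi * r)) / 4 ≤ Γ.mass w l j).card : ℝ) := by
  have hpi := Real.pi_pos
  have hk' : (1 : ℝ) ≤ k := by exact_mod_cast hk
  obtain ⟨g, hg1, hg2, hg3⟩ := exists_polynomial_bump (c := c) (R := 4 * k) (Δ := Δ) (α := α) (r := r)
    (by linarith) hΔ hr hΔr hc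
  set ε := Δ / (128 * Real.pi * r) with hε
  have hε0 : 0 < ε := by positivity
  obtain ⟨C, hC⟩ := exists_window_moment k g
  obtain ⟨n, hn⟩ := exists_nat_ge (C / (ε * ν))
  refine ⟨n, fun Γ w l hd hw hl => ?_⟩
  have hle := hw.le
  have hd1 : (1 : ℝ) ≤ Γ.d := by have := Γ.two_le; exact_mod_cast (by omega : 1 ≤ Γ.d)
  have hCl : C ≤ ε * l := by
    have h1 : C / (ε * ν) ≤ Γ.d := hn.trans (by exact_mod_cast hd)
    rw [div_le_iff₀ (by positivity)] at h1
    nlinarith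
  have h1 := (_root_.abs_le.1 (hC Γ w l r α hw)).1
  rw [Finset.sum_comm] at h1
  simp only [← Finset.sum_mul] at h1
  set I := Finset.univ.filter fun j => |Γ.θ j - c| < Δ / 2 with hI
  set G := Finset.univ.filter fun j => |Γ.θ j - c| < Δ / 2 ∧
      ν * ε / 4 ≤ Γ.mass w l j with hG
  have h2 : ∀ j ∈ (Finset.univ : Finset (Fin (Γ.d + 1))),
      Γ.mass w l j * g.eval ((Γ.θ j - α) / r) ≤
      (if |Γ.θ j - c| < Δ / 2 then Γ.mass w l j else 0) + ε * Γ.mass w l j := by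
    intro j _
    have hm := mass_nonneg (Γ := Γ) w l j
    have e1 := hw.abs_eta_le j
    have e2 : α + r * ((Γ.θ j - α) / r) - c = Γ.θ j - c := by field_simp; ring
    split_ifs with h
    · have := mul_le_mul_of_nonneg_left (hg1 _ e1) hm
      linarith
    · have := mul_le_mul_of_nonneg_left (hg2 _ e1 (by rw [e2]; linarith)) hm
      linarith
  have h3 := Finset.sum_le_sum h2
  rw [Finset.sum_add_distrib, ← Finset.mul_sum, sum_mass (by omega), ← Finset.sum_filter] at h3
  have h4 : ε * l ≤ ∑ j ∈ I, Γ.mass w l j := by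
    have h5 : (l : ℝ) * (3 * ε) ≤ l * arcsineMean g :=
      mul_le_mul_of_nonneg_left hg3 (by positivity)
    unfold mass at h3 ⊢
    linarith
  have h5 : ∑ j ∈ I, Γ.mass w l j ≤ ∑ j, ((if |Γ.θ j - c| < Δ / 2 ∧ ν * ε / 4 ≤ Γ.mass w l j
      then (1 : ℝ) else 0) + ν * ε / 4) := by
    refine (Finset.sum_le_sum (g := fun j => ((if |Γ.θ j - c| < Δ / 2 ∧ ν * ε / 4 ≤ Γ.mass w l j
      then (1 : ℝ) else 0) + ν * ε / 4)) fun j hj => ?_).trans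
      (Finset.sum_le_sum_of_subset_of_nonneg (Finset.subset_univ _) fun j _ _ => ?_)
    · have h6 := (Finset.mem_filter.1 hj).2
      split_ifs with h7
      · have := mass_le_one (Γ := Γ) (w := w) (l := l) (by omega) j
        have : 0 ≤ ν * ε / 4 := by positivity
        linarith
      · have : Γ.mass w l j < ν * ε / 4 := by
          by_contra h8; exact h7 ⟨h6, not_lt.1 h8⟩
        linarith
    · split_ifs <;> positivity
  rw [Finset.sum_add_distrib, ← Finset.sum_filter, Finset.sum_const, Finset.sum_const,
    nsmul_eq_mul, nsmul_eq_mul, Finset.card_univ, Fintype.card_fin, mul_one] at h5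
  push_cast at h5
  have h6 : ε * (ν * Γ.d) ≤ ε * l := mul_le_mul_of_nonneg_left hl hε0.le
  have h7 : 0 ≤ ν * ε * (Γ.d - 1) := by
    have : 0 ≤ (Γ.d : ℝ) - 1 := by linarith
    positivity
  linarith

lemma prod_abs_sub_le {ι : Type*} [DecidableEq ι] (θ : ι → ℝ) {S G : Finset ι} (hGS : G ⊆ S) {Δ R : ℝ}
    (hR : 1 ≤ R) (hG : ∀ i ∈ G, ∀ j ∈ G, |θ i - θ j| ≤ Δ)
    (hS : ∀ i ∈ S, ∀ j ∈ S, |θ i - θ j| ≤ R) (hΔ0 : 0 < Δ) :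
    ∏ i ∈ S, ∏ j ∈ S.erase i, |θ i - θ j| ≤ Δ ^ (G.card * (G.card - 1)) * R ^ (S.card ^ 2) := by
  have h1 : ∀ i ∈ S, ∏ j ∈ S.erase i, |θ i - θ j| ≤
      (if i ∈ G then Δ ^ (G.card - 1) else 1) * R ^ S.card := by
    intro i hi
    have h2 : ∏ j ∈ S.erase i, |θ i - θ j| ≤
        ∏ j ∈ S.erase i, ((if i ∈ G ∧ j ∈ G then Δ else 1) * R) := by
      refine Finset.prod_le_prod (fun _ _ => abs_nonneg _) fun j hj => ?_
      split_ifs with h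
      · refine (hG i h.1 j h.2).trans ?_
        nlinarith
      · rw [one_mul]; exact hS i hi j (Finset.mem_of_mem_erase hj)
    refine h2.trans ?_
    rw [Finset.prod_mul_distrib]
    have h3 : ∏ j ∈ S.erase i, R ≤ R ^ S.card := by
      rw [Finset.prod_const]
      exact pow_le_pow_right₀ hR (Finset.card_le_card (Finset.erase_subset _ _))
    have h4 : ∏ j ∈ S.erase i, (if i ∈ G ∧ j ∈ G then Δ else 1) =
        if i ∈ G then Δ ^ (G.card - 1) else 1 := by
      by_cases h : i ∈ G
      · simp only [h, true_and, if_true]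
        rw [← Finset.prod_filter, Finset.prod_const]
        congr 1
        rw [← Finset.card_erase_of_mem h]
        congr 1
        ext j
        simp only [Finset.mem_filter, Finset.mem_erase]
        exact ⟨fun h => ⟨h.1.1, h.2⟩, fun h => ⟨⟨h.1, hGS h.2⟩, h.2⟩⟩
      · simp [h]
    rw [h4]
    refine mul_le_mul_of_nonneg_left h3 ?_
    split_ifs <;> positivity
  refine (Finset.prod_le_prod (fun _ _ => Finset.prod_nonneg fun _ _ => abs_nonneg _) h1).trans ?_
  rw [Finset.prod_mul_distrib, Finset.prod_const, ← pow_mul, ← sq]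
  refine mul_le_mul_of_nonneg_right (le_of_eq ?_) (by positivity)
  rw [← Finset.prod_filter, Finset.filter_mem_eq_inter, Finset.inter_eq_right.2 hGS,
    Finset.prod_const, ← pow_mul, mul_comm]

set_option maxHeartbeats 2000000 in
/-- In a long window, the local size of `q` cannot grow very fast in the spectral parameter. -/
theorem exists_not_separated (k : ℕ) {α r x0 x1 κ ν : ℝ} (hk : 1 ≤ k) (hr : 0 < r) (hx : x0 < x1)
    (hκ : 0 < κ) (hI : ∀ x ∈ Set.Icc x0 x1, |x - α| ≤ (2 - κ) * r) (hν : 0 < ν) :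
    ∃ (η0 L : ℝ) (d0 : ℕ), 0 < η0 ∧ ∀ (Γ : IntArray k) (w l : ℕ), d0 ≤ Γ.d → Γ.Window w l r α →
    ν * Γ.d ≤ l → ¬ ∀ x ∈ Set.Icc x0 x1, ∀ y ∈ Set.Icc x0 x1, x + η0 ≤ y → L * Γ.A w x ≤ Γ.A w y := by
  have hpi := Real.pi_pos
  set ρ := x1 - x0 with hρ
  have hρ0 : 0 < ρ := by linarith
  have hρr : ρ ≤ 4 * r := by
    have h1 := _root_.abs_le.1 (hI x0 ⟨le_rfl, hx.le⟩)
    have h2 := _root_.abs_le.1 (hI x1 ⟨hx.le, le_rfl⟩)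
    have : 0 < κ * r := by positivity
    linarith [h1.1, h2.2]
  set R : ℝ := 6 * k + 1 with hR
  have hR1 : 1 ≤ R := by rw [hR]; linarith [(Nat.cast_nonneg k : (0:ℝ) ≤ k)]
  set c1 := ρ / (256 * Real.pi * r) with hc1
  set c2 := ν * c1 / 2 with hc2
  have hc2p : 0 < c2 := by positivity
  set c := c2 / 2 with hc
  set Λ := 2 * Real.log R / c ^ 2 + 1 with hΛ
  obtain ⟨M, hM⟩ := exists_nat_gt (ρ / 2 * Real.exp Λ)
  have hM0 : (0 : ℝ) < M := lt_of_le_of_lt (by positivity) hM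
  have hM1 : (1 : ℝ) ≤ M := by
    have : 0 < M := by exact_mod_cast hM0
    exact_mod_cast this
  set Δ := ρ / (2 * M) with hΔ
  have hΔ0 : 0 < Δ := by positivity
  have hΔρ : Δ ≤ ρ := by
    rw [hΔ, div_le_iff₀ (by positivity)]; nlinarith
  have hΔlog : Real.log Δ ≤ -Λ := by
    rw [Real.log_le_iff_le_exp hΔ0, hΔ, Real.exp_neg, div_le_iff₀ (by positivity)]
    have := Real.exp_pos Λ
    field_simp
    linarith
  have hMΔ : 2 * M * Δ = ρ := by rw [hΔ]; field_simp
  set cen : ℕ → ℝ := fun m => x0 + 2 * m * Δ + Δ / 2 with hcen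
  have hIm : ∀ m < M, ∀ x, |x - cen m| < Δ / 2 → x ∈ Set.Icc x0 x1 := by
    intro m hm x hx
    obtain ⟨h1, h2⟩ := abs_lt.1 hx
    have h3 : (m : ℝ) + 1 ≤ M := by exact_mod_cast hm
    have h4 : (m : ℝ) * Δ + Δ ≤ M * Δ := by nlinarith
    have h5 : 0 ≤ (m : ℝ) * Δ := by positivity
    simp only [hcen] at h1 h2
    constructor
    · linarith
    · linarith
  have hcount : ∀ m < M, ∃ d0 : ℕ, ∀ (Γ : IntArray k) (w l : ℕ),
      d0 ≤ Γ.d → Γ.Window w l r α → ν * Γ.d ≤ l →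
      ν * (Δ / (128 * Real.pi * r)) / 2 * Γ.d ≤ ((Finset.univ.filter fun j =>
        |Γ.θ j - cen m| < Δ / 2 ∧
        ν * (Δ / (128 * Real.pi * r)) / 4 ≤ Γ.mass w l j).card : ℝ) := by
    intro m hm
    refine exists_card_ge k hk hΔ0 (hΔρ.trans hρr) hr ?_ hν
    have h1 := hI (cen m) (hIm m hm _ (by simpa using hΔ0))
    nlinarith
  choose! D hD using hcount
  set ε := Δ / (128 * Real.pi * r) with hε
  have hε0 : 0 < ε := by positivity
  have hεM : ν * ε / 2 * M = c2 := by
    rw [hc2, hc1, hε, hΔ]; field_simp; ring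
  set δ := ν * ε / 4 with hδ
  have hδ0 : 0 < δ := by positivity
  obtain ⟨d1, hd1⟩ := exists_nat_ge (2 * M / c2)
  refine ⟨Δ, 32 / (κ ^ 2 * δ) + 1, ∑ m ∈ Finset.range M, D m + d1, hΔ0,
    fun Γ w l hd hw hl hsep => ?_⟩
  classical
  have hd2 : (2 : ℝ) ≤ Γ.d := by exact_mod_cast Γ.two_le
  have hl0 : (0 : ℝ) < l := lt_of_lt_of_le (by positivity) hl
  set G : ℕ → Finset (Fin (Γ.d + 1)) := fun m => Finset.univ.filter fun j =>
    |Γ.θ j - cen m| < Δ / 2 ∧ δ ≤ Γ.mass w l j with hG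
  have hGc : ∀ m < M, ν * ε / 2 * Γ.d ≤ (G m).card := by
    intro m hm
    refine hD m hm Γ w l ?_ hw hl
    have := Finset.single_le_sum (f := D) (fun _ _ => Nat.zero_le _) (Finset.mem_range.2 hm)
    omega
  have hGF : ∀ m m', m < m' → m' < M → ∀ i ∈ G m, ∀ j ∈ G m', Γ.F (Γ.θ i) < Γ.F (Γ.θ j) := by
    intro m m' hmm hm' i hi j hj
    obtain ⟨hi1, hi2⟩ := (Finset.mem_filter.1 hi).2
    obtain ⟨hj1, hj2⟩ := (Finset.mem_filter.1 hj).2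
    have hiI := hIm m (by omega) _ hi1
    have hjI := hIm m' hm' _ hj1
    have h1 := hw.F_le hκ hδ0 (hI _ hiI) hi2
    have h2 := hw.le_F hκ (hI _ hjI)
    have h3 : Γ.θ i + Δ ≤ Γ.θ j := by
      obtain ⟨e1, e2⟩ := abs_lt.1 hi1
      obtain ⟨e3, e4⟩ := abs_lt.1 hj1
      have e5 : (m : ℝ) + 1 ≤ m' := by exact_mod_cast hmm
      simp only [hcen] at e1 e2 e3 e4
      nlinarith
    have h4 := hsep _ hiI _ hjI h3
    have h5 : 0 < Γ.A w (Γ.θ i) := by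
      rcases (Γ.A_nonneg w (Γ.θ i)).eq_or_lt with h | h
      · rw [← h, mul_zero] at h1
        linarith [Γ.one_le_F (Γ.θ i)]
      · exact h
    have h6 : (l : ℝ) * (κ / 8) * ((32 / (κ ^ 2 * δ) + 1) * Γ.A w (Γ.θ i)) ≤
        l * (κ / 8) * Γ.A w (Γ.θ j) := mul_le_mul_of_nonneg_left h4 (by positivity)
    have h7 : (l : ℝ) * (κ / 8) * ((32 / (κ ^ 2 * δ) + 1) * Γ.A w (Γ.θ i)) =
        l * (4 / κ) / δ * Γ.A w (Γ.θ i) + l * (κ / 8) * Γ.A w (Γ.θ i) := by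
      field_simp; ring
    have h8 : 0 < (l : ℝ) * (κ / 8) * Γ.A w (Γ.θ i) := by positivity
    linarith
  set S : ℕ → Finset (Fin (Γ.d + 1)) := fun m => Finset.univ.filter fun j =>
    ∃ i ∈ G m, Γ.F (Γ.θ i) = Γ.F (Γ.θ j) with hS
  have hdisj : ∀ m ∈ Finset.range M, ∀ m' ∈ Finset.range M, m ≠ m' → Disjoint (S m) (S m') := by
    intro m hm m' hm' hne
    rw [Finset.mem_range] at hm hm'
    rw [Finset.disjoint_left]
    intro j hj hj'
    obtain ⟨i, hi, hij⟩ := (Finset.mem_filter.1 hj).2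
    obtain ⟨i', hi', hij'⟩ := (Finset.mem_filter.1 hj').2
    rcases lt_or_gt_of_ne hne with h | h
    · have := hGF m m' h hm' i hi i' hi'
      linarith
    · have := hGF m' m h hm i' hi' i hi
      linarith
  obtain ⟨m, hm, hSm⟩ : ∃ m ∈ Finset.range M, ((S m).card : ℝ) ≤ 2 * Γ.d / M := by
    by_contra! hcon
    have h1 : ∑ m ∈ Finset.range M, (2 * Γ.d / M : ℝ) ≤ ∑ m ∈ Finset.range M, ((S m).card : ℝ) :=
      Finset.sum_le_sum fun m hm => (hcon m hm).le
    have h2 : ∑ m ∈ Finset.range M, (S m).card ≤ Γ.d + 1 := by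
      rw [← Finset.card_biUnion hdisj]
      refine (Finset.card_le_univ _).trans (by simp)
    have h3 : ∑ m ∈ Finset.range M, ((S m).card : ℝ) ≤ Γ.d + 1 := by exact_mod_cast h2
    rw [Finset.sum_const, Finset.card_range, nsmul_eq_mul, mul_div_cancel₀ _ hM0.ne'] at h1
    linarith
  rw [Finset.mem_range] at hm
  have hGS : G m ⊆ S m := fun i hi => Finset.mem_filter.2 ⟨Finset.mem_univ _, i, hi, rfl⟩
  have hdisc := Γ.one_le_disc (S m) (fun i hi j hij => by
    obtain ⟨i', hi', hii'⟩ := (Finset.mem_filter.1 hi).2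
    exact Finset.mem_filter.2 ⟨Finset.mem_univ _, i', hi', hii'.trans hij⟩) 0 1 le_rfl
    Finset.univ (fun i hi => absurd (Finset.mem_univ i) hi)
  simp only [η, Nat.cast_one, Real.sqrt_one, one_pow, one_mul, Nat.cast_zero, sub_zero,
    div_one] at hdisc
  have hup := prod_abs_sub_le Γ.θ hGS (Δ := Δ) hR1 (fun i hi j hj => by
    obtain ⟨e1, e2⟩ := abs_lt.1 (Finset.mem_filter.1 hi).2.1
    obtain ⟨e3, e4⟩ := abs_lt.1 (Finset.mem_filter.1 hj).2.1
    rw [_root_.abs_le]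
    constructor <;> linarith) (fun i _ j _ => by
    refine (abs_sub _ _).trans ?_
    linarith [Γ.abs_θ_le i, Γ.abs_θ_le j]) hΔ0
  have hfin := hdisc.trans hup
  have hlog := Real.log_nonneg hfin
  rw [Real.log_mul (by positivity) (by positivity), Real.log_pow, Real.log_pow] at hlog
  have hg := hGc m hm
  set g := (G m).card with hgdef
  set s := (S m).card with hsdef
  have hg' : c2 * Γ.d / M ≤ g := by
    refine le_trans (le_of_eq ?_) hg
    rw [← hεM]; field_simp
  have hg2 : (2 : ℝ) ≤ g := by
    refine le_trans ?_ hg'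
    rw [le_div_iff₀ hM0]
    have h1 : 2 * M / c2 ≤ Γ.d := hd1.trans (by exact_mod_cast (by omega : d1 ≤ Γ.d))
    rw [div_le_iff₀ hc2p] at h1
    linarith
  have hgs : c * s ≤ g := by
    have h1 : c * s ≤ c * (2 * Γ.d / M) := mul_le_mul_of_nonneg_left hSm (by positivity)
    refine h1.trans (le_trans (le_of_eq ?_) hg')
    rw [hc]; field_simp
  have hs2 : (2 : ℝ) ≤ s := hg2.trans (by exact_mod_cast Finset.card_le_card hGS)
  have hg1 : 1 ≤ g := by
    have : (1 : ℝ) ≤ g := by linarith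
    exact_mod_cast this
  push_cast [Nat.cast_sub hg1] at hlog
  have hcp : 0 < c := by positivity
  have e1 : c ^ 2 * (s : ℝ) ^ 2 / 2 ≤ (g : ℝ) * (g - 1) := by
    have e2 : (c * s) ^ 2 ≤ (g : ℝ) ^ 2 := pow_le_pow_left₀ (by positivity) hgs 2
    nlinarith
  have e2 : 0 ≤ Λ := by
    have := Real.log_nonneg hR1
    positivity
  have e3 : (g : ℝ) * (g - 1) * Real.log Δ ≤ -(c ^ 2 * (s : ℝ) ^ 2 / 2 * Λ) := by
    have e4 : 0 ≤ (g : ℝ) * (g - 1) := le_trans (by positivity) e1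
    nlinarith
  have e5 : c ^ 2 * (s : ℝ) ^ 2 / 2 * Λ = (s : ℝ) ^ 2 * Real.log R + c ^ 2 * (s : ℝ) ^ 2 / 2 := by
    rw [hΛ]; field_simp
  have e6 : 0 < c ^ 2 * (s : ℝ) ^ 2 / 2 := by positivity
  linarith

end IntArray

namespace IntArray

variable {k : ℕ} (Γ : IntArray k)

/-- A constant governing the one step growth of `A`. -/
noncomputable def stepC (k : ℕ) : ℝ := 1 + 34 * (k : ℝ) ^ 2

lemma one_le_stepC (k : ℕ) : 1 ≤ stepC k := by
  have : 0 ≤ 34 * (k : ℝ) ^ 2 := by positivity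
  unfold stepC; linarith

lemma A_step {i : ℕ} (hi : i + 1 < Γ.d) {x : ℝ} (hx : |x| ≤ 3 * k) :
    Γ.A (i + 1) x ≤ stepC k * Γ.A i x ∧ Γ.A i x ≤ stepC k * Γ.A (i + 1) x := by
  have h1 := Γ.q_rec_succ hi x
  have r0 := Γ.one_le_r (i := i) (by omega)
  have r1 := Γ.one_le_r (i := i + 1) hi
  have s0 := Γ.r_le (i := i) (by omega)
  have s1 := Γ.r_le (i := i + 1) hi
  have ha : (Γ.a (i + 1) : ℝ) ≤ k := by exact_mod_cast Γ.a_le (i := i + 1) (by omega)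
  have hxa : |x - Γ.a (i + 1)| ≤ 4 * k := by
    refine (abs_sub _ _).trans ?_
    have h2 : |(Γ.a (i + 1) : ℝ)| = Γ.a (i + 1) := abs_of_nonneg (Nat.cast_nonneg _)
    rw [h2]
    linarith
  have key : ∀ r r' p p' p'' : ℝ, 1 ≤ r → 0 ≤ r' → r' ≤ k →
      r * p'' = (x - Γ.a (i + 1)) * p' - r' * p → p' ^ 2 + p'' ^ 2 ≤ stepC k * (p ^ 2 + p' ^ 2) := by
    intro r r' p p' p'' hr hr0 hr' h
    have e1 : p'' ^ 2 ≤ (r * p'') ^ 2 := by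
      rw [mul_pow]
      exact le_mul_of_one_le_left (sq_nonneg _) (one_le_pow₀ hr)
    have e2 : (r * p'') ^ 2 ≤ 2 * ((x - Γ.a (i + 1)) * p') ^ 2 + 2 * (r' * p) ^ 2 := by
      rw [h]; nlinarith [sq_nonneg ((x - Γ.a (i + 1)) * p' + r' * p)]
    have e3 : ((x - Γ.a (i + 1)) * p') ^ 2 ≤ 16 * (k : ℝ) ^ 2 * p' ^ 2 := by
      rw [mul_pow]
      refine mul_le_mul_of_nonneg_right ?_ (sq_nonneg _)
      have := pow_le_pow_left₀ (abs_nonneg _) hxa 2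
      rw [sq_abs] at this
      nlinarith
    have e4 : (r' * p) ^ 2 ≤ (k : ℝ) ^ 2 * p ^ 2 := by
      rw [mul_pow]
      exact mul_le_mul_of_nonneg_right (pow_le_pow_left₀ hr0 hr' 2) (sq_nonneg _)
    unfold stepC
    have : 0 ≤ (k : ℝ) ^ 2 * p ^ 2 := by positivity
    have : 0 ≤ (k : ℝ) ^ 2 * p' ^ 2 := by positivity
    nlinarith [sq_nonneg p]
  constructor
  · exact key _ _ _ _ _ r1 (by linarith) s0 h1
  · have := key (Γ.r i) (Γ.r (i + 1)) (Γ.q (i + 2) x) (Γ.q (i + 1) x) (Γ.q i x) r0 (by linarith) s1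
      (by linarith)
    unfold A
    linarith

lemma A_iterate {i n : ℕ} (hi : i + n < Γ.d) {x : ℝ} (hx : |x| ≤ 3 * k) :
    Γ.A (i + n) x ≤ stepC k ^ n * Γ.A i x ∧ Γ.A i x ≤ stepC k ^ n * Γ.A (i + n) x := by
  induction n with
  | zero => simp
  | succ n ih =>
    obtain ⟨h1, h2⟩ := ih (by omega)
    obtain ⟨h3, h4⟩ := Γ.A_step (i := i + n) (by omega) hx
    have hC := one_le_stepC k
    have hCn : 0 ≤ stepC k ^ n := by positivity
    rw [← add_assoc]
    constructor
    · calc _ ≤ _ := h3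
        _ ≤ stepC k * (stepC k ^ n * Γ.A i x) := mul_le_mul_of_nonneg_left h1 (by linarith)
        _ = _ := by ring
    · calc _ ≤ _ := h2
        _ ≤ stepC k ^ n * (stepC k * Γ.A (i + n + 1) x) := mul_le_mul_of_nonneg_left h4 hCn
        _ = _ := by ring

lemma A_pos {i : ℕ} (hi : i < Γ.d) {x : ℝ} (hx : |x| ≤ 3 * k) : 0 < Γ.A i x := by
  have h1 := (Γ.A_iterate (i := 0) (n := i) (by omega) hx).2
  have h2 : 1 ≤ Γ.A 0 x := by
    unfold A; rw [q_zero]; nlinarith [sq_nonneg (Γ.q (0 + 1) x)]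
  rw [zero_add] at h1
  by_contra h3
  have : 0 < stepC k ^ i := by have := one_le_stepC k; positivity
  nlinarith

/-- Monotone growth of `q` to the right of the local spectra. -/
lemma q_growth {s : ℕ} (hs : s < Γ.d) {β γ : ℝ} (hγ : 0 < γ) (hγβ : γ ≤ β) (hb : β ≤ Γ.b s)
    (hc : Γ.c s ≤ γ) {x : ℝ} (hx : k - (Real.sqrt β - Real.sqrt γ) ^ 2 ≤ x) :
    ∀ i ≤ s, 0 < Γ.q i x ∧ Γ.b i / Real.sqrt (β / γ) * Γ.q i x ≤ Γ.r i * Γ.q (i + 1) x := by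
  have hβ : 0 < β := by linarith
  set κ := Real.sqrt (β / γ) with hκ
  have hκ1 : 1 ≤ κ := Real.one_le_sqrt.2 ((one_le_div hγ).2 hγβ)
  have hκ0 : 0 < κ := by linarith
  have hsγ : 0 < Real.sqrt γ := Real.sqrt_pos.2 hγ
  have hκe : Real.sqrt β = κ * Real.sqrt γ := by
    rw [hκ, Real.sqrt_div hβ.le]; field_simp
  have hsq : Real.sqrt γ ^ 2 = γ := Real.sq_sqrt hγ.le
  have hsqβ : β = κ ^ 2 * γ := by rw [← hsq, ← mul_pow, ← hκe, Real.sq_sqrt hβ.le]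
  have key : ∀ i ≤ s, Γ.b i / κ ≤ x - Γ.a i - Γ.c i * κ := by
    intro i hi
    have h1 : (Γ.a i : ℝ) + Γ.b i + Γ.c i = k := by exact_mod_cast Γ.sum_eq i (by omega)
    have h2 : β ≤ Γ.b i := hb.trans (by exact_mod_cast Γ.banti i s hi (by omega))
    have h3 : (Γ.c i : ℝ) ≤ γ := le_trans (by exact_mod_cast Γ.cmono i s hi (by omega)) hc
    rw [hκe] at hx
    have h4 : (κ * Real.sqrt γ - Real.sqrt γ) ^ 2 = (κ - 1) ^ 2 * γ := by
      linear_combination (κ - 1) ^ 2 * hsq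
    rw [h4] at hx
    rw [div_le_iff₀ hκ0]
    nlinarith [mul_nonneg (sub_nonneg.2 hκ1) (sub_nonneg.2 h2),
      mul_nonneg (mul_nonneg hκ0.le (sub_nonneg.2 hκ1)) (sub_nonneg.2 h3)]
  intro i
  induction i with
  | zero =>
    intro _
    rw [q_zero, q_rec_zero, mul_one]
    have := key 0 (Nat.zero_le _)
    rw [Γ.a0, Γ.c0] at this
    simp only [Nat.cast_zero] at this
    exact ⟨one_pos, by linarith⟩
  | succ i ih =>
    intro hi
    obtain ⟨h1, h2⟩ := ih (by omega)
    have hr : 0 < Γ.r i := Γ.r_pos (by omega)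
    have hbi : (0 : ℝ) < Γ.b i := by exact_mod_cast Γ.bpos i (by omega)
    have hpos : 0 < Γ.q (i + 1) x := by
      have : 0 < Γ.b i / κ * Γ.q i x := by positivity
      exact pos_of_mul_pos_right (this.trans_le h2) hr.le
    refine ⟨hpos, ?_⟩
    rw [Γ.q_rec_succ (by omega)]
    have h3 := mul_le_mul_of_nonneg_right (key (i + 1) hi) hpos.le
    have h4 : Γ.r i * Γ.q i x ≤ Γ.c (i + 1) * κ * Γ.q (i + 1) x := by
      have h5 : Γ.b i * (Γ.r i * Γ.q i x) ≤ Γ.b i * (Γ.c (i + 1) * κ * Γ.q (i + 1) x) := by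
        have h6 := mul_le_mul_of_nonneg_left h2 (mul_nonneg hκ0.le hr.le)
        have h7 : κ * Γ.r i * (Γ.b i / κ * Γ.q i x) = Γ.b i * (Γ.r i * Γ.q i x) := by
          field_simp
        have h8 : κ * Γ.r i * (Γ.r i * Γ.q (i + 1) x) =
            Γ.b i * (Γ.c (i + 1) * κ * Γ.q (i + 1) x) := by
          have := Γ.r_sq i
          linear_combination κ * Γ.q (i + 1) x * this
        linarith
      exact le_of_mul_le_mul_left h5 hbi
    linarith

lemma q_growth_ratio {s : ℕ} (hs : s < Γ.d) {β γ : ℝ} (hγ : 0 < γ) (hγβ : γ ≤ β) (hb : β ≤ Γ.b s)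
    (hc : Γ.c s ≤ γ) {x y : ℝ} (hx : k - (Real.sqrt β - Real.sqrt γ) ^ 2 ≤ x) (hxy : x ≤ y)
    (hyk : y ≤ k) :
    ∀ i ≤ s + 1, (1 + (y - x) / k) ^ i * Γ.q i x ≤ Γ.q i y := by
  have hk : (0 : ℝ) < k := by
    have := Γ.bpos 0 (by omega)
    rw [Γ.b0] at this
    exact_mod_cast this
  have gx := Γ.q_growth hs hγ hγβ hb hc hx
  have gy := Γ.q_growth hs hγ hγβ hb hc (hx.trans hxy)
  set τ := 1 + (y - x) / k with hτ
  have hτ1 : 1 ≤ τ := by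
    have : 0 ≤ (y - x) / k := div_nonneg (by linarith) hk.le
    linarith
  have hfin : ∀ i p p', 0 < Γ.q i x → 0 < Γ.q i y → 0 < Γ.r i →
      Γ.r i * Γ.q (i + 1) x = (x - p) * Γ.q i x → 0 ≤ p →
      Γ.r i * Γ.q (i + 1) y = (y - p') * Γ.q i y → p' ≤ p →
      τ * (Γ.q (i + 1) x * Γ.q i y) ≤ Γ.q (i + 1) y * Γ.q i x := by
    intro i p p' h1 h2 h3 h4 h5 h6 h7
    have h8 : τ * (x - p) ≤ y - p' := by
      have : (y - x) / k * (x - p) ≤ y - x := by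
        rw [div_mul_eq_mul_div, div_le_iff₀ hk]
        nlinarith
      rw [hτ]; linarith
    have h9 : Γ.r i * (τ * (Γ.q (i + 1) x * Γ.q i y)) ≤
        Γ.r i * (Γ.q (i + 1) y * Γ.q i x) := by
      have e1 : Γ.r i * (τ * (Γ.q (i + 1) x * Γ.q i y)) = τ * (x - p) * (Γ.q i x * Γ.q i y) := by
        linear_combination τ * Γ.q i y * h4
      have e2 : Γ.r i * (Γ.q (i + 1) y * Γ.q i x) = (y - p') * (Γ.q i x * Γ.q i y) := by
        linear_combination Γ.q i x * h6
      rw [e1, e2]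
      exact mul_le_mul_of_nonneg_right h8 (by positivity)
    exact le_of_mul_le_mul_left h9 h3
  have key : ∀ i ≤ s, τ * (Γ.q (i + 1) x * Γ.q i y) ≤ Γ.q (i + 1) y * Γ.q i x := by
    intro i
    induction i with
    | zero =>
      intro _
      refine hfin 0 0 0 (by simp [q_zero]) (by simp [q_zero]) (Γ.r_pos (by omega)) ?_ le_rfl ?_ le_rfl
      · rw [q_rec_zero, q_zero]; ring
      · rw [q_rec_zero, q_zero]; ring
    | succ i ih =>
      intro hi
      have h0 := ih (by omega)
      have px := (gx i (by omega)).1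
      have py := (gy i (by omega)).1
      have px1 := (gx (i + 1) hi).1
      have py1 := (gy (i + 1) hi).1
      have hr : 0 < Γ.r i := Γ.r_pos (by omega)
      refine hfin (i + 1) (Γ.a (i + 1) + Γ.r i * Γ.q i x / Γ.q (i + 1) x)
        (Γ.a (i + 1) + Γ.r i * Γ.q i y / Γ.q (i + 1) y) px1 py1 (Γ.r_pos (by omega)) ?_ ?_ ?_ ?_
      · rw [Γ.q_rec_succ (by omega)]; field_simp; ring
      · positivity
      · rw [Γ.q_rec_succ (by omega)]; field_simp; ring
      · refine add_le_add_right ?_ _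
        rw [div_le_div_iff₀ py1 px1, mul_assoc, mul_assoc]
        refine mul_le_mul_of_nonneg_left ?_ hr.le
        have : 0 ≤ Γ.q (i + 1) x * Γ.q i y := by positivity
        nlinarith
  intro i
  induction i with
  | zero => intro _; simp [q_zero]
  | succ i ih =>
    intro hi
    have h1 := ih (by omega)
    have h2 := key i (by omega)
    have px := (gx i (by omega)).1
    have py := (gy i (by omega)).1
    have px1 : 0 < Γ.q (i + 1) x := by
      have h3 := (gx i (by omega)).2
      have hr : 0 < Γ.r i := Γ.r_pos (by omega)
      have hbi : (0 : ℝ) < Γ.b i := by exact_mod_cast Γ.bpos i (by omega)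
      have h4 : 0 < Real.sqrt (β / γ) := Real.sqrt_pos.2 (div_pos (by linarith) hγ)
      have : 0 < Γ.b i / Real.sqrt (β / γ) * Γ.q i x := by positivity
      exact pos_of_mul_pos_right (this.trans_le h3) hr.le
    refine le_of_mul_le_mul_right (le_trans ?_ h2) px
    have h5 := mul_le_mul_of_nonneg_left h1 (by positivity : 0 ≤ τ * Γ.q (i + 1) x)
    calc _ = τ * Γ.q (i + 1) x * (τ ^ i * Γ.q i x) := by ring
      _ ≤ _ := h5
      _ = _ := by ring

end IntArray

namespace IntArray

lemma sub_sq_le_two_mul (a b : ℝ) : (a - b) ^ 2 ≤ 2 * (a ^ 2 + b ^ 2) := by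
  linarith [sq_nonneg (a + b), sub_sq a b, add_sq a b]

lemma sub_mul_sq_le (u v s : ℝ) : (u - s * v) ^ 2 ≤ (1 + s ^ 2) * (v ^ 2 + u ^ 2) := by
  nlinarith [sq_nonneg (s * u + v)]

lemma mul_le_of_nonpos {L a b : ℝ} (hL : L ≤ 0) (ha : 0 ≤ a) (hb : 0 ≤ b) : L * a ≤ b :=
  (mul_nonpos_of_nonpos_of_nonneg hL ha).trans hb

lemma mul_sq_le_sq_of_mul_le {t u v : ℝ} (ht : 1 ≤ t) (hu : 0 ≤ u) (huv : t * u ≤ v) :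
    t * u ^ 2 ≤ v ^ 2 := by
  have h1 : (t * u) ^ 2 ≤ v ^ 2 := pow_le_pow_left₀ (by positivity) huv 2
  have h2 : 0 ≤ t * (t - 1) * u ^ 2 :=
    mul_nonneg (mul_nonneg (by linarith) (by linarith)) (sq_nonneg _)
  linarith

/-- Local sizes to the right of the local spectra of a long initial segment are separated. -/
lemma exists_separated_initial (k : ℕ) (hk : 1 ≤ k) (L : ℝ) {η0 : ℝ} (hη : 0 < η0) :
    ∃ s0 : ℕ, ∀ (Γ : IntArray k) (s : ℕ) (β γ : ℝ), s0 ≤ s → s + 1 < Γ.d → 0 < γ → γ ≤ β →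
    β ≤ Γ.b s → Γ.c s ≤ γ → ∀ x y : ℝ, k - (Real.sqrt β - Real.sqrt γ) ^ 2 ≤ x → y ≤ k →
    x + η0 ≤ y → L * Γ.A (s + 1) x ≤ Γ.A (s + 1) y := by
  have hk0 : (0 : ℝ) < k := by exact_mod_cast hk
  have hC := one_le_stepC k
  have hτ : 1 < 1 + η0 / k := by
    have : 0 < η0 / k := by positivity
    linarith
  obtain ⟨s0, hs0⟩ := pow_unbounded_of_one_lt (L * stepC k ^ 2) hτ
  refine ⟨s0, fun Γ s β γ hs hsd hγ hγβ hb hc x y hx hy hxy => ?_⟩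
  have hβk : β ≤ k := hb.trans (by exact_mod_cast Γ.b_le (i := s) (by omega))
  have hx0 : 0 ≤ x := by
    have h1 : Real.sqrt γ ≤ Real.sqrt β := Real.sqrt_le_sqrt hγβ
    have h2 := Real.sqrt_nonneg γ
    have h3 := Real.sq_sqrt (show 0 ≤ β by linarith)
    nlinarith
  have hx3 : |x| ≤ 3 * k := by rw [abs_of_nonneg hx0]; linarith
  have hy3 : |y| ≤ 3 * k := by rw [abs_of_nonneg (by linarith)]; linarith
  have hq := Γ.q_growth_ratio (by omega) hγ hγβ hb hc hx (by linarith : x ≤ y) hy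
  have gx := Γ.q_growth (by omega) hγ hγβ hb hc hx
  set τ := 1 + (y - x) / k with hτd
  have hττ : 1 + η0 / k ≤ τ := by
    have : η0 / k ≤ (y - x) / k := div_le_div_of_nonneg_right (by linarith) hk0.le
    linarith
  have hτ1 : 1 ≤ τ := by linarith
  have px := (gx s le_rfl).1
  have px1 : 0 ≤ Γ.q (s + 1) x := by
    have h3 := (gx s le_rfl).2
    have hr : 0 < Γ.r s := Γ.r_pos (by omega)
    have : 0 ≤ Γ.b s / Real.sqrt (β / γ) * Γ.q s x := by positivity
    exact nonneg_of_mul_nonneg_right (this.trans h3) hr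
  have h1 : τ ^ s * Γ.A s x ≤ Γ.A s y := by
    have e1 : (1 : ℝ) ≤ τ ^ s := one_le_pow₀ hτ1
    have e2 := hq s (by omega)
    have e3 := hq (s + 1) le_rfl
    have e4 : τ ^ s * Γ.q (s + 1) x ≤ Γ.q (s + 1) y := by
      refine le_trans (mul_le_mul_of_nonneg_right ?_ px1) e3
      exact pow_le_pow_right₀ hτ1 (by omega)
    unfold A
    have := mul_sq_le_sq_of_mul_le e1 px.le e2
    have := mul_sq_le_sq_of_mul_le e1 px1 e4
    linarith
  have h2 := (Γ.A_step hsd hx3).1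
  have h3 := (Γ.A_step hsd hy3).2
  have h4 : L * stepC k ^ 2 ≤ τ ^ s := by
    refine hs0.le.trans ?_
    exact (pow_le_pow_right₀ hτ.le hs).trans (pow_le_pow_left₀ (by linarith) hττ s)
  have h5 := Γ.A_nonneg s x
  have h6 := Γ.A_nonneg (s + 1) x
  rcases le_or_gt L 0 with hL | hL
  · exact mul_le_of_nonpos hL h6 (Γ.A_nonneg _ _)
  have hC0 : 0 < stepC k := by linarith
  refine le_of_mul_le_mul_left ?_ hC0
  calc stepC k * (L * Γ.A (s + 1) x) ≤ stepC k * (L * (stepC k * Γ.A s x)) := by gcongr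
    _ = L * stepC k ^ 2 * Γ.A s x := by ring
    _ ≤ τ ^ s * Γ.A s x := by gcongr
    _ ≤ Γ.A s y := h1
    _ ≤ _ := h3

/-- Exact exponential behaviour in a window outside of its spectral zone. -/
lemma Window.growing {k : ℕ} {Γ : IntArray k} {w l : ℕ} {r α : ℝ} (h : Γ.Window w l r α)
    {x ρ : ℝ} (hρ : 0 < ρ) (hx : ρ + ρ⁻¹ = (x - α) / r) {n : ℕ} (hn : n < l) :
    Γ.q (w + n + 1) x - ρ⁻¹ * Γ.q (w + n) x = ρ ^ n * (Γ.q (w + 1) x - ρ⁻¹ * Γ.q w x) := by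
  induction n with
  | zero => simp
  | succ n ih =>
    have h1 := h.recur (i := w + n + 1) (by omega) (by omega) x
    rw [← hx, Nat.add_sub_cancel] at h1
    rw [← add_assoc, h1, pow_succ, mul_comm (ρ ^ n) ρ, mul_assoc, ← ih (by omega)]
    have : ρ * ρ⁻¹ = 1 := mul_inv_cancel₀ hρ.ne'
    linear_combination (Γ.q (w + n) x) * this

set_option maxHeartbeats 1000000 in
/-- The window estimates used to compare the local sizes of two points. -/
lemma Window.growth_bounds {k : ℕ} {Γ : IntArray k} {w l : ℕ} {r α : ℝ} (h : Γ.Window w l r α)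
    {x ρ κ R e0 C0 : ℝ} (hρ : 1 < ρ) (hx : ρ + ρ⁻¹ = (x - α) / r) (hκ : 0 < κ)
    (hκρ : κ ≤ ρ - ρ⁻¹) (hR : ρ ≤ R) (he0 : 0 < e0)
    (hE : e0 ≤ |Γ.q w x ^ 2 - (x - α) / r * Γ.q w x * Γ.q (w + 1) x + Γ.q (w + 1) x ^ 2|)
    (hA : Γ.A w x ≤ C0) {n : ℕ} (hn : n < l) :
    e0 ^ 2 / (4 * (1 + R ^ 2) * C0) * (ρ ^ n) ^ 2 ≤ Γ.A (w + n) x ∧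
    Γ.A (w + n) x ≤ 4 * (1 + R ^ 2) ^ 2 / κ ^ 2 * C0 * (ρ ^ n) ^ 2 := by
  have hρ0 : 0 < ρ := by linarith
  have hi1 : ρ⁻¹ ≤ 1 := inv_le_one_of_one_le₀ hρ.le
  have hi0 : 0 < ρ⁻¹ := by positivity
  have hy := h.growing hρ0 hx hn
  have hz := h.growing (ρ := ρ⁻¹) hi0 (by rw [inv_inv, ← hx]; ring) hn
  rw [inv_inv] at hz
  have hEq : Γ.q w x ^ 2 - (x - α) / r * Γ.q w x * Γ.q (w + 1) x + Γ.q (w + 1) x ^ 2 =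
      (Γ.q (w + 1) x - ρ⁻¹ * Γ.q w x) * (Γ.q (w + 1) x - ρ * Γ.q w x) := by
    rw [← hx]
    have : ρ * ρ⁻¹ = 1 := mul_inv_cancel₀ hρ0.ne'
    linear_combination (-Γ.q w x ^ 2) * this
  rw [hEq] at hE
  unfold A at hA ⊢
  set P := Γ.q (w + n) x
  set Q := Γ.q (w + n + 1) x
  set p := Γ.q w x
  set q := Γ.q (w + 1) x
  have hC0 : p ^ 2 + q ^ 2 ≤ C0 := hA
  set y := q - ρ⁻¹ * p
  set z := q - ρ * p
  have hR1 : 1 ≤ R := by linarith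
  have hcs := sub_mul_sq_le
  have hρR : ρ ^ 2 ≤ R ^ 2 := pow_le_pow_left₀ hρ0.le hR 2
  have hiR : ρ⁻¹ ^ 2 ≤ 1 := pow_le_one₀ hi0.le hi1
  have hz2 : z ^ 2 ≤ (1 + R ^ 2) * C0 := by
    refine (hcs q p ρ).trans ?_
    exact mul_le_mul (by linarith) hC0 (by positivity) (by positivity)
  have hy2 : y ^ 2 ≤ 2 * C0 := by
    refine (hcs q p ρ⁻¹).trans ?_
    exact mul_le_mul (by linarith) hC0 (by positivity) (by positivity)
  have hE2 : e0 ^ 2 ≤ y ^ 2 * z ^ 2 := by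
    rw [← mul_pow, ← sq_abs (y * z)]
    exact pow_le_pow_left₀ he0.le hE 2
  have hCpos : 0 < C0 := by
    by_contra hneg
    have h1 : y ^ 2 = 0 := le_antisymm (by linarith) (sq_nonneg y)
    have h2 : 0 < e0 ^ 2 := by positivity
    rw [h1, zero_mul] at hE2
    linarith
  constructor
  · have h1 : (Q - ρ⁻¹ * P) ^ 2 ≤ 2 * (P ^ 2 + Q ^ 2) := by
      refine (hcs Q P ρ⁻¹).trans ?_
      exact mul_le_mul_of_nonneg_right (by linarith) (by positivity)
    rw [hy, mul_pow] at h1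
    have h2 : e0 ^ 2 ≤ y ^ 2 * ((1 + R ^ 2) * C0) :=
      hE2.trans (mul_le_mul_of_nonneg_left hz2 (sq_nonneg _))
    rw [div_mul_eq_mul_div, div_le_iff₀ (by positivity)]
    calc e0 ^ 2 * (ρ ^ n) ^ 2 ≤ y ^ 2 * ((1 + R ^ 2) * C0) * (ρ ^ n) ^ 2 := by gcongr
      _ = ((ρ ^ n) ^ 2 * y ^ 2) * ((1 + R ^ 2) * C0) := by ring
      _ ≤ (2 * (P ^ 2 + Q ^ 2)) * ((1 + R ^ 2) * C0) := by gcongr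
      _ ≤ _ := by
        have : 0 ≤ (P ^ 2 + Q ^ 2) * ((1 + R ^ 2) * C0) := by positivity
        linarith
  · have hY : (Q - ρ⁻¹ * P) ^ 2 ≤ 2 * C0 * (ρ ^ n) ^ 2 := by
      rw [hy, mul_pow, mul_comm]
      gcongr
    have hZ : (Q - ρ * P) ^ 2 ≤ (1 + R ^ 2) * C0 * (ρ ^ n) ^ 2 := by
      rw [hz, mul_pow, mul_comm]
      have : (ρ⁻¹ ^ n) ^ 2 ≤ (ρ ^ n) ^ 2 := by
        have : ρ⁻¹ ≤ ρ := by linarith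
        gcongr
      gcongr
    have e1 : (ρ - ρ⁻¹) ^ 2 * (P ^ 2 + Q ^ 2) ≤
        2 * ((1 + R ^ 2) * (Q - ρ⁻¹ * P) ^ 2 + 2 * (Q - ρ * P) ^ 2) := by
      have f1 : (ρ - ρ⁻¹) ^ 2 * P ^ 2 ≤ 2 * ((Q - ρ⁻¹ * P) ^ 2 + (Q - ρ * P) ^ 2) := by
        have : (ρ - ρ⁻¹) * P = (Q - ρ⁻¹ * P) - (Q - ρ * P) := by ring
        rw [← mul_pow, this]
        exact sub_sq_le_two_mul _ _
      have f2 : (ρ - ρ⁻¹) ^ 2 * Q ^ 2 ≤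
          2 * (ρ ^ 2 * (Q - ρ⁻¹ * P) ^ 2 + ρ⁻¹ ^ 2 * (Q - ρ * P) ^ 2) := by
        have : (ρ - ρ⁻¹) * Q = ρ * (Q - ρ⁻¹ * P) - ρ⁻¹ * (Q - ρ * P) := by
          ring
        rw [← mul_pow, this, ← mul_pow, ← mul_pow]
        exact sub_sq_le_two_mul _ _
      have f3 : ρ ^ 2 * (Q - ρ⁻¹ * P) ^ 2 ≤ R ^ 2 * (Q - ρ⁻¹ * P) ^ 2 :=
        mul_le_mul_of_nonneg_right hρR (sq_nonneg _)
      have f4 : ρ⁻¹ ^ 2 * (Q - ρ * P) ^ 2 ≤ 1 * (Q - ρ * P) ^ 2 :=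
        mul_le_mul_of_nonneg_right hiR (sq_nonneg _)
      linarith
    have e2 : κ ^ 2 * (P ^ 2 + Q ^ 2) ≤ (ρ - ρ⁻¹) ^ 2 * (P ^ 2 + Q ^ 2) :=
      mul_le_mul_of_nonneg_right (pow_le_pow_left₀ hκ.le hκρ 2) (by positivity)
    have e3 : 2 * ((1 + R ^ 2) * (Q - ρ⁻¹ * P) ^ 2 + 2 * (Q - ρ * P) ^ 2) ≤
        2 * ((1 + R ^ 2) * (2 * C0 * (ρ ^ n) ^ 2) + 2 * ((1 + R ^ 2) * C0 * (ρ ^ n) ^ 2)) := by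
      gcongr
    have e4 : 2 * ((1 + R ^ 2) * (2 * C0 * (ρ ^ n) ^ 2) + 2 * ((1 + R ^ 2) * C0 * (ρ ^ n) ^ 2)) ≤
        4 * (1 + R ^ 2) ^ 2 * C0 * (ρ ^ n) ^ 2 := by
      have f1 : 0 ≤ (1 + R ^ 2) * C0 * (ρ ^ n) ^ 2 := by positivity
      have f2 : 1 ≤ R ^ 2 := one_le_pow₀ hR1
      have f3 := mul_nonneg f1 (sub_nonneg.2 f2)
      linarith
    have e5 : 4 * (1 + R ^ 2) ^ 2 / κ ^ 2 * C0 * (ρ ^ n) ^ 2 =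
        4 * (1 + R ^ 2) ^ 2 * C0 * (ρ ^ n) ^ 2 / κ ^ 2 := by ring
    rw [e5, le_div_iff₀ (by positivity)]
    linarith

/-- The larger root of `ρ + ρ⁻¹ = u`. -/
lemma exists_add_inv_eq {u κ : ℝ} (hκ : 0 < κ) (hu : 2 + κ ≤ u) :
    ∃ ρ, 1 < ρ ∧ ρ + ρ⁻¹ = u ∧ ρ ≤ u ∧ min κ 1 ≤ ρ - ρ⁻¹ := by
  set s := Real.sqrt (u ^ 2 - 4) with hs
  have h1 : s ^ 2 = u ^ 2 - 4 := Real.sq_sqrt (by nlinarith)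
  have h2 : 0 < s := Real.sqrt_pos.2 (by nlinarith)
  have h3 : s < u := by nlinarith
  have h4 : ((u + s) / 2)⁻¹ = (u - s) / 2 := by
    refine inv_eq_of_mul_eq_one_left ?_
    linear_combination -h1 / 4
  refine ⟨(u + s) / 2, by linarith, by rw [h4]; ring, by linarith, ?_⟩
  rw [h4]
  have h5 : κ ≤ s := by nlinarith
  have := min_le_left κ 1
  linarith

set_option maxHeartbeats 1000000 in
/-- The local sizes at points outside of the spectral zone of a long window are separated, even
some time after that window. -/
lemma exists_separated_outer (k : ℕ) (hk : 1 ≤ k) {α r x0 x1 κ e0 C0 η0 : ℝ} (L : ℝ) (hr : 1 ≤ r)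
    (hrk : r ≤ k) (hα : |α| ≤ k) (hκ : 0 < κ) (h0 : -(3 * k) ≤ x0) (h1 : x1 ≤ 3 * k)
    (hI : ∀ x ∈ Set.Icc x0 x1, 2 + κ ≤ (x - α) / r) (he0 : 0 < e0) (hη : 0 < η0) :
    ∃ N n0 : ℕ, ∀ (Γ : IntArray k) (s l : ℕ), Γ.Window s l r α →
    (∀ x ∈ Set.Icc x0 x1, e0 ≤
      |Γ.q s x ^ 2 - (x - α) / r * Γ.q s x * Γ.q (s + 1) x + Γ.q (s + 1) x ^ 2|) →
    (∀ x ∈ Set.Icc x0 x1, Γ.A s x ≤ C0) → ∀ n m : ℕ, n0 ≤ n → N * m ≤ n → n < l →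
    s + n + m < Γ.d → ∀ x ∈ Set.Icc x0 x1, ∀ y ∈ Set.Icc x0 x1, x + η0 ≤ y →
    L * Γ.A (s + n + m) x ≤ Γ.A (s + n + m) y := by
  have hk0 : (0 : ℝ) < k := by exact_mod_cast hk
  set R : ℝ := 4 * k with hR
  set μ := min κ 1 with hμ
  have hμ0 : 0 < μ := lt_min hκ one_pos
  set τ := 1 + η0 / (k * R) with hτ
  have hτ1 : 1 < τ := by
    have : 0 < η0 / (k * R) := by positivity
    linarith
  have hC := one_le_stepC k
  have hC0' : 0 < stepC k := by linarith
  obtain ⟨N, hN⟩ := pow_unbounded_of_one_lt (stepC k ^ 2) hτ1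
  set c1 := e0 ^ 2 / (4 * (1 + R ^ 2) * C0) with hc1
  set c2 := 4 * (1 + R ^ 2) ^ 2 / μ ^ 2 * C0 with hc2
  obtain ⟨n0, hn0⟩ := pow_unbounded_of_one_lt (L * c2 / c1) hτ1
  refine ⟨N, n0, fun Γ s l hW hE hA n m hn hm hl hd x hx y hy hxy => ?_⟩
  have hr0 : 0 < r := by linarith
  have hle : ∀ x ∈ Set.Icc x0 x1, (x - α) / r ≤ R := by
    intro x hx
    rw [div_le_iff₀ hr0]
    have := (_root_.abs_le.1 hα).1
    have : R ≤ R * r := le_mul_of_one_le_right (by positivity) hr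
    linarith [hx.2]
  have h3k : ∀ x ∈ Set.Icc x0 x1, |x| ≤ 3 * k := fun x hx =>
    _root_.abs_le.2 ⟨h0.trans hx.1, hx.2.trans h1⟩
  have hApos := (Γ.A_pos (i := s) (by have := hW.le; omega) (h3k x hx)).trans_le (hA x hx)
  have hc1p : 0 < c1 := by positivity
  have hc2p : 0 < c2 := by positivity
  obtain ⟨ρ, hρ1, hρe, hρu, hρμ⟩ := exists_add_inv_eq hκ (hI x hx)
  obtain ⟨σ, hσ1, hσe, hσu, hσμ⟩ := exists_add_inv_eq hκ (hI y hy)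
  have b1 := (hW.growth_bounds hρ1 hρe hμ0 hρμ (hρu.trans (hle x hx)) he0 (hE x hx) (hA x hx) hl).2
  have b2 := (hW.growth_bounds hσ1 hσe hμ0 hσμ (hσu.trans (hle y hy)) he0 (hE y hy) (hA y hy) hl).1
  have t1 := (Γ.A_iterate hd (h3k x hx)).1
  have t2 := (Γ.A_iterate hd (h3k y hy)).2
  have hτρ : τ * ρ ≤ σ := by
    have e1 : η0 / k ≤ (σ + σ⁻¹) - (ρ + ρ⁻¹) := by
      rw [hσe, hρe, ← sub_div, sub_sub_sub_cancel_right]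
      exact (div_le_div_of_nonneg_left hη.le hr0 hrk).trans
        (div_le_div_of_nonneg_right (by linarith) hr0.le)
    have e2 : 0 < η0 / k := by positivity
    have e3 : ρ ≤ σ := by
      by_contra hlt
      push Not at hlt
      have : ρ⁻¹ ≤ σ⁻¹ := inv_anti₀ (by linarith) hlt.le
      have e4 : (σ + σ⁻¹) - (ρ + ρ⁻¹) = (σ - ρ) * (1 - (ρ * σ)⁻¹) := by
        field_simp; ring
      have e5 : (ρ * σ)⁻¹ ≤ 1 := inv_le_one_of_one_le₀
        (one_le_mul_of_one_le_of_one_le hρ1.le hσ1.le)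
      have e6 := mul_nonpos_of_nonpos_of_nonneg (sub_nonpos.2 hlt.le) (sub_nonneg.2 e5)
      linarith
    have e4 : σ⁻¹ ≤ ρ⁻¹ := inv_anti₀ (by linarith) e3
    have e5 : η0 / (k * R) * ρ ≤ η0 / k := by
      rw [← div_div, div_mul_eq_mul_div, div_le_iff₀ (by positivity)]
      exact mul_le_mul_of_nonneg_left (hρu.trans (hle x hx)) e2.le
    rw [hτ]; linarith
  have hpow : L * c2 * stepC k ^ m * stepC k ^ m * (ρ ^ n) ^ 2 ≤ c1 * (σ ^ n) ^ 2 ∨ L ≤ 0 := by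
    rcases le_or_gt L 0 with hL | hL
    · exact Or.inr hL
    left
    have e1 : L * c2 ≤ c1 * τ ^ n := by
      have := hn0.le.trans (pow_le_pow_right₀ hτ1.le hn)
      rw [div_le_iff₀ hc1p] at this
      linarith
    have e2 : stepC k ^ m * stepC k ^ m ≤ τ ^ n := by
      calc stepC k ^ m * stepC k ^ m = (stepC k ^ 2) ^ m := by rw [← mul_pow, sq]
        _ ≤ (τ ^ N) ^ m := pow_le_pow_left₀ (by positivity) hN.le m
        _ = τ ^ (N * m) := (pow_mul _ _ _).symm
        _ ≤ τ ^ n := pow_le_pow_right₀ hτ1.le hm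
    have e3 : (τ ^ n) ^ 2 * (ρ ^ n) ^ 2 ≤ (σ ^ n) ^ 2 := by
      rw [← mul_pow, ← mul_pow]
      have : 0 ≤ τ * ρ := by positivity
      gcongr
    calc L * c2 * stepC k ^ m * stepC k ^ m * (ρ ^ n) ^ 2
        = (L * c2) * (stepC k ^ m * stepC k ^ m) * (ρ ^ n) ^ 2 := by ring
      _ ≤ (c1 * τ ^ n) * τ ^ n * (ρ ^ n) ^ 2 := by gcongr
      _ = c1 * ((τ ^ n) ^ 2 * (ρ ^ n) ^ 2) := by ring
      _ ≤ _ := by gcongr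
  rcases hpow with hpow | hL
  · by_cases hL : L ≤ 0
    · exact mul_le_of_nonpos hL (Γ.A_nonneg _ _) (Γ.A_nonneg _ _)
    push Not at hL
    refine le_of_mul_le_mul_left ?_ (show 0 < stepC k ^ m by positivity)
    calc stepC k ^ m * (L * Γ.A (s + n + m) x)
        ≤ stepC k ^ m * (L * (stepC k ^ m * Γ.A (s + n) x)) := by gcongr
      _ ≤ stepC k ^ m * (L * (stepC k ^ m * (c2 * (ρ ^ n) ^ 2))) := by gcongr
      _ = L * c2 * stepC k ^ m * stepC k ^ m * (ρ ^ n) ^ 2 := by ring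
      _ ≤ _ := hpow
      _ ≤ _ := b2
      _ ≤ _ := t2
  · exact mul_le_of_nonpos hL (Γ.A_nonneg _ _) (Γ.A_nonneg _ _)

end IntArray

lemma hasSum_neg_log_one_sub {ρ : ℝ} (h0 : 0 ≤ ρ) (h1 : ρ < 1) (φ : ℝ) :
    HasSum (fun n : ℕ => 2 * (ρ ^ n / n * Real.cos (n * φ)))
      (-Real.log (1 - 2 * ρ * Real.cos φ + ρ ^ 2)) := by
  set z : ℂ := ρ * Complex.exp (φ * Complex.I) with hz
  have hzn : ‖z‖ < 1 := by
    rw [hz, norm_mul, Complex.norm_exp_ofReal_mul_I, mul_one, Complex.norm_real,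
      Real.norm_of_nonneg h0]
    exact h1
  have h2 := (Complex.hasSum_re (Complex.hasSum_taylorSeries_neg_log hzn)).mul_left 2
  have hsq : ‖1 - z‖ ^ 2 = 1 - 2 * ρ * Real.cos φ + ρ ^ 2 := by
    rw [← Complex.normSq_eq_norm_sq, Complex.normSq_apply, hz]
    simp only [Complex.sub_re, Complex.one_re, Complex.sub_im, Complex.one_im, Complex.re_ofReal_mul,
      Complex.im_ofReal_mul, Complex.exp_ofReal_mul_I_re, Complex.exp_ofReal_mul_I_im]
    linear_combination ρ ^ 2 * Real.sin_sq_add_cos_sq φ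
  have h3 : 2 * (-Complex.log (1 - z)).re = -Real.log (1 - 2 * ρ * Real.cos φ + ρ ^ 2) := by
    rw [← hsq, Real.log_pow, Complex.neg_re, Complex.log_re]
    push_cast; ring
  rw [h3] at h2
  have h4 : ∀ n : ℕ, ρ ^ n / n * Real.cos (n * φ) = (z ^ n / n).re := by
    intro n
    rw [hz, mul_pow, ← Complex.exp_nat_mul, ← Complex.ofReal_pow, mul_div_right_comm,
      ← Complex.ofReal_natCast, ← Complex.ofReal_div, Complex.re_ofReal_mul, ← mul_assoc,
      ← Complex.ofReal_mul, Complex.exp_ofReal_mul_I_re]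
  simp only [h4]
  exact h2

lemma one_sub_two_mul_cos_pos {ρ : ℝ} (h0 : 0 ≤ ρ) (h1 : ρ < 1) (φ : ℝ) :
    (1 - ρ) ^ 2 ≤ 1 - 2 * ρ * Real.cos φ + ρ ^ 2 ∧ 0 < 1 - 2 * ρ * Real.cos φ + ρ ^ 2 := by
  have h2 := mul_le_mul_of_nonneg_left (Real.cos_le_one φ) h0
  have h3 : 0 < (1 - ρ) ^ 2 := by have : 0 < 1 - ρ := by linarith
                                  positivity
  constructor <;> nlinarith

/-- The regularized logarithmic energy of points on a circle. -/
lemma sum_log_regularized_le {ι : Type*} (S : Finset ι) (a : ι → ℝ) {ρ : ℝ} (h0 : 0 ≤ ρ)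
    (h1 : ρ < 1) (m : ℕ) :
    ∑ i ∈ S, ∑ j ∈ S, (Real.log (1 - 2 * ρ * Real.cos (a i + a j) + ρ ^ 2) +
      Real.log (1 - 2 * ρ * Real.cos (a i - a j) + ρ ^ 2)) ≤
    -(4 * (ρ ^ m / m) * (∑ i ∈ S, Real.cos (m * a i)) ^ 2) := by
  have h2 : HasSum (fun n : ℕ => ∑ i ∈ S, ∑ j ∈ S, (2 * (ρ ^ n / n * Real.cos (n * (a i + a j))) +
      2 * (ρ ^ n / n * Real.cos (n * (a i - a j)))))
      (∑ i ∈ S, ∑ j ∈ S, (-Real.log (1 - 2 * ρ * Real.cos (a i + a j) + ρ ^ 2) +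
      -Real.log (1 - 2 * ρ * Real.cos (a i - a j) + ρ ^ 2))) :=
    hasSum_sum fun i _ => hasSum_sum fun j _ =>
      (hasSum_neg_log_one_sub h0 h1 _).add (hasSum_neg_log_one_sub h0 h1 _)
  have h3 : ∀ n : ℕ, ∑ i ∈ S, ∑ j ∈ S, (2 * (ρ ^ n / n * Real.cos (n * (a i + a j))) +
      2 * (ρ ^ n / n * Real.cos (n * (a i - a j)))) =
      4 * (ρ ^ n / n) * (∑ i ∈ S, Real.cos (n * a i)) ^ 2 := by
    intro n
    rw [sq, Finset.sum_mul_sum, Finset.mul_sum]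
    refine Finset.sum_congr rfl fun i _ => ?_
    rw [Finset.mul_sum]
    refine Finset.sum_congr rfl fun j _ => ?_
    rw [mul_add, mul_sub, Real.cos_add, Real.cos_sub]
    ring
  simp only [h3] at h2
  have h4 := le_hasSum h2 m fun n _ => by positivity
  have h5 : ∑ i ∈ S, ∑ j ∈ S, (-Real.log (1 - 2 * ρ * Real.cos (a i + a j) + ρ ^ 2) +
      -Real.log (1 - 2 * ρ * Real.cos (a i - a j) + ρ ^ 2)) =
      -∑ i ∈ S, ∑ j ∈ S, (Real.log (1 - 2 * ρ * Real.cos (a i + a j) + ρ ^ 2) +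
      Real.log (1 - 2 * ρ * Real.cos (a i - a j) + ρ ^ 2)) := by
    simp only [← neg_add, Finset.sum_neg_distrib]
  linarith

lemma log_abs_two_cos_sub_le {ρ : ℝ} (h0 : 0 ≤ ρ) (h1 : ρ < 1) {a b : ℝ}
    (hab : 2 * Real.cos a - 2 * Real.cos b ≠ 0) :
    2 * Real.log |2 * Real.cos a - 2 * Real.cos b| ≤ 4 * (1 - ρ) +
      (Real.log (1 - 2 * ρ * Real.cos (a + b) + ρ ^ 2) +
      Real.log (1 - 2 * ρ * Real.cos (a - b) + ρ ^ 2)) := by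
  have p1 := (one_sub_two_mul_cos_pos h0 h1 (a + b)).2
  have p2 := (one_sub_two_mul_cos_pos h0 h1 (a - b)).2
  have hρ : 0 < 1 + ρ := by linarith
  have key : ∀ φ, 2 - 2 * Real.cos φ ≤ 4 / (1 + ρ) ^ 2 * (1 - 2 * ρ * Real.cos φ + ρ ^ 2) := by
    intro φ
    rw [div_mul_eq_mul_div, le_div_iff₀ (by positivity)]
    have := mul_nonneg (sq_nonneg (1 - ρ)) (by linarith [Real.neg_one_le_cos φ] : 0 ≤ 1 + Real.cos φ)
    nlinarith
  have hsq : |2 * Real.cos a - 2 * Real.cos b| ^ 2 =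
      (2 - 2 * Real.cos (a + b)) * (2 - 2 * Real.cos (a - b)) := by
    rw [sq_abs, Real.cos_add, Real.cos_sub]
    have e1 := Real.sin_sq_add_cos_sq a
    have e2 : Real.sin b ^ 2 = 1 - Real.cos b ^ 2 := by linarith [Real.sin_sq_add_cos_sq b]
    linear_combination (4 * Real.sin b ^ 2) * e1 + (4 - 4 * Real.cos a ^ 2) * e2
  have h2 : |2 * Real.cos a - 2 * Real.cos b| ^ 2 ≤ (4 / (1 + ρ) ^ 2) ^ 2 *
      ((1 - 2 * ρ * Real.cos (a + b) + ρ ^ 2) * (1 - 2 * ρ * Real.cos (a - b) + ρ ^ 2)) := by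
    rw [hsq]
    calc _ ≤ _ := mul_le_mul (key (a + b)) (key (a - b)) (by linarith [Real.cos_le_one (a - b)])
          (by positivity)
      _ = _ := by ring
  have h3 : 0 < |2 * Real.cos a - 2 * Real.cos b| := abs_pos.2 hab
  have h4 := Real.log_le_log (by positivity) h2
  rw [Real.log_pow, Real.log_mul (by positivity) (by positivity), Real.log_pow,
    Real.log_mul p1.ne' p2.ne'] at h4
  have h5 : Real.log (4 / (1 + ρ) ^ 2) ≤ 2 * (1 - ρ) := by
    have e : 4 / (1 + ρ) ^ 2 = (2 / (1 + ρ)) ^ 2 := by rw [div_pow]; norm_num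
    rw [e, Real.log_pow]
    have e2 := Real.log_le_sub_one_of_pos (show 0 < 2 / (1 + ρ) by positivity)
    have e3 : 2 / (1 + ρ) - 1 ≤ 1 - ρ := by
      rw [div_sub_one hρ.ne', div_le_iff₀ hρ]; nlinarith
    push_cast; linarith
  push_cast at h4
  linarith

/-- The logarithmic energy of points in `[-2, 2]` controls the Chebyshev moments. -/
theorem sum_log_abs_sub_le {ι : Type*} [DecidableEq ι] (S : Finset ι) (u : ι → ℝ)
    (hu : ∀ i ∈ S, |u i| ≤ 2) (hinj : ∀ i ∈ S, ∀ j ∈ S, u i = u j → i = j) {ρ : ℝ} (h0 : 0 ≤ ρ)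
    (h1 : ρ < 1) (m : ℕ) :
    ∑ i ∈ S, ∑ j ∈ S.erase i, Real.log |u i - u j| ≤ 2 * (1 - ρ) * (S.card : ℝ) ^ 2 -
      2 * Real.log (1 - ρ) * S.card -
      (ρ ^ m / m) / 2 * (∑ i ∈ S, (Polynomial.Chebyshev.C ℝ m).eval (u i)) ^ 2 := by
  set a : ι → ℝ := fun i => Real.arccos (u i / 2) with ha
  have hua : ∀ i ∈ S, u i = 2 * Real.cos (a i) := by
    intro i hi
    have := abs_le.1 (hu i hi)
    rw [ha, Real.cos_arccos (by linarith) (by linarith)]; ring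
  set K : ι → ι → ℝ := fun i j => Real.log (1 - 2 * ρ * Real.cos (a i + a j) + ρ ^ 2) +
      Real.log (1 - 2 * ρ * Real.cos (a i - a j) + ρ ^ 2) with hK
  have h2 : ∑ i ∈ S, ∑ j ∈ S, K i j ≤ -(4 * (ρ ^ m / m) * (∑ i ∈ S, Real.cos (m * a i)) ^ 2) :=
    sum_log_regularized_le S a h0 h1 m
  have h3 : ∀ i ∈ S, ∑ j ∈ S.erase i, 2 * Real.log |u i - u j| ≤
      ∑ j ∈ S, K i j + 4 * (1 - ρ) * S.card - 4 * Real.log (1 - ρ) := by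
    intro i hi
    have e1 : ∑ j ∈ S.erase i, 2 * Real.log |u i - u j| ≤
        ∑ j ∈ S.erase i, (4 * (1 - ρ) + K i j) := by
      refine Finset.sum_le_sum fun j hj => ?_
      obtain ⟨hji, hj⟩ := Finset.mem_erase.1 hj
      rw [hua i hi, hua j hj]
      refine log_abs_two_cos_sub_le h0 h1 ?_
      rw [← hua i hi, ← hua j hj]
      intro hz
      exact hji (hinj i hi j hj (sub_eq_zero.1 hz)).symm
    rw [Finset.sum_add_distrib, Finset.sum_const, nsmul_eq_mul] at e1
    have e2 := Finset.add_sum_erase S (K i) hi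
    have e3 : 4 * Real.log (1 - ρ) ≤ K i i := by
      have l1 := Real.log_le_log (by have : 0 < 1 - ρ := by linarith
                                     positivity) (one_sub_two_mul_cos_pos h0 h1 (a i + a i)).1
      have l2 := Real.log_le_log (by have : 0 < 1 - ρ := by linarith
                                     positivity) (one_sub_two_mul_cos_pos h0 h1 (a i - a i)).1
      rw [Real.log_pow] at l1 l2
      push_cast at l1 l2
      simp only [hK]
      linarith
    have e4 : ((S.erase i).card : ℝ) * (4 * (1 - ρ)) ≤ S.card * (4 * (1 - ρ)) := by
      refine mul_le_mul_of_nonneg_right ?_ (by linarith)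
      exact_mod_cast Finset.card_le_card (Finset.erase_subset _ _)
    linarith
  have h4 := Finset.sum_le_sum h3
  simp only [Finset.sum_sub_distrib, Finset.sum_add_distrib, Finset.sum_const, nsmul_eq_mul,
    ← Finset.mul_sum] at h4
  have h5 : ∑ i ∈ S, (Polynomial.Chebyshev.C ℝ m).eval (u i) =
      2 * ∑ i ∈ S, Real.cos (m * a i) := by
    rw [Finset.mul_sum]
    refine Finset.sum_congr rfl fun i hi => ?_
    rw [hua i hi, Polynomial.Chebyshev.C_two_mul_real_cos]
    simp
  rw [h5]
  nlinarith

namespace IntArray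

variable {k : ℕ} (Γ : IntArray k)

lemma sum_mul_neighbours_le (n : ℕ) (v : ℕ → ℝ) (hv : v (n + 1) = 0) (σ : ℝ) (hσ : σ ^ 2 = 1) :
    ∑ i ∈ Finset.range (n + 1), v i * (σ * (v (i + 1) + if i = 0 then 0 else v (i - 1))) ≤
      2 * ∑ i ∈ Finset.range (n + 1), v i ^ 2 := by
  have h1 : ∑ i ∈ Finset.range (n + 1), v (i + 1) ^ 2 ≤ ∑ i ∈ Finset.range (n + 1), v i ^ 2 := by
    have e1 := Finset.sum_range_succ (fun i => v i ^ 2) (n + 1)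
    rw [Finset.sum_range_succ'] at e1
    simp only [hv] at e1
    nlinarith [sq_nonneg (v 0)]
  have h2 : ∑ i ∈ Finset.range (n + 1), (if i = 0 then 0 else v (i - 1)) ^ 2 ≤
      ∑ i ∈ Finset.range (n + 1), v i ^ 2 := by
    rw [Finset.sum_range_succ', Finset.sum_range_succ (fun i => v i ^ 2)]
    simp
    positivity
  have h3 : ∀ i ∈ Finset.range (n + 1),
      v i * (σ * (v (i + 1) + if i = 0 then 0 else v (i - 1))) ≤
      v i ^ 2 + (v (i + 1) ^ 2 + (if i = 0 then 0 else v (i - 1)) ^ 2) / 2 := by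
    intro i _
    generalize (if i = 0 then 0 else v (i - 1)) = z
    have e1 := sq_nonneg (v i - σ * v (i + 1))
    have e2 := sq_nonneg (v i - σ * z)
    have e3 : (σ * v (i + 1)) ^ 2 = v (i + 1) ^ 2 := by rw [mul_pow, hσ, one_mul]
    have e4 : (σ * z) ^ 2 = z ^ 2 := by rw [mul_pow, hσ, one_mul]
    nlinarith
  refine (Finset.sum_le_sum h3).trans ?_
  rw [Finset.sum_add_distrib, ← Finset.sum_div, Finset.sum_add_distrib]
  linarith

/-- The number of rescaled eigenvalues on one side of `[-2, 2]`. -/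
lemma card_lt_η_le (α N : ℕ) (hN : 1 ≤ N) (B : Finset (Fin (Γ.d + 1)))
    (hB : ∀ i, i ∉ B → Γ.GoodRow α N i) (σ : ℝ) (hσ : σ ^ 2 = 1) :
    (Finset.univ.filter fun j => 2 < σ * Γ.η α N j).card ≤ B.card := by
  by_contra hlt
  push Not at hlt
  set S := Finset.univ.filter fun j => 2 < σ * Γ.η α N j with hS
  have hsN : 0 < Real.sqrt N := Real.sqrt_pos.2 (by exact_mod_cast hN)
  have hker := LinearMap.ker_ne_bot_of_finrank_lt
    (f := Matrix.mulVecLin (Matrix.of fun (i : B) (j : S) => Γ.ev j (i : Fin (Γ.d + 1))))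
    (by simpa using hlt)
  obtain ⟨c, hc, hc0⟩ := (Submodule.ne_bot_iff _).1 hker
  set e : Fin (Γ.d + 1) → ℝ := fun j => if h : j ∈ S then c ⟨j, h⟩ else 0 with he
  set v : ℕ → ℝ := fun i => ∑ j, e j * Γ.ev j i with hv
  have hvB : ∀ i ∈ B, v i = 0 := by
    intro i hi
    have h1 := congrFun (LinearMap.mem_ker.1 hc) ⟨i, hi⟩
    rw [Matrix.mulVecLin_apply] at h1
    simp only [Matrix.mulVec, dotProduct, Matrix.of_apply, Pi.zero_apply] at h1
    rw [← h1, hv]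
    simp only
    rw [← Finset.sum_subset (Finset.subset_univ S), ← Finset.sum_coe_sort S]
    · refine Finset.sum_congr rfl fun j _ => ?_
      simp [he, mul_comm]
    · intro j _ hj
      simp [he, hj]
  have hgen : ∀ f g : Fin (Γ.d + 1) → ℝ, ∑ i : Fin (Γ.d + 1), (∑ j, f j * Γ.ev j i) *
      (∑ j, g j * Γ.ev j i) = ∑ j, f j * g j := by
    intro f g
    simp only [Finset.sum_mul_sum]
    rw [Finset.sum_comm]
    refine Finset.sum_congr rfl fun j _ => ?_
    rw [Finset.sum_comm]
    have : ∀ j', ∑ i : Fin (Γ.d + 1), f j * Γ.ev j i * (g j' * Γ.ev j' i) =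
        if j = j' then f j * g j' else 0 := by
      intro j'
      have h1 := Γ.sum_ev_mul_ev j j'
      calc _ = f j * g j' * ∑ i : Fin (Γ.d + 1), Γ.ev j i * Γ.ev j' i := by
            rw [Finset.mul_sum]; exact Finset.sum_congr rfl fun _ _ => by ring
        _ = _ := by rw [h1]; simp
    simp [this]
  have hrow : ∀ i : Fin (Γ.d + 1), v i * ∑ j, (σ * Γ.η α N j * e j) * Γ.ev j i =
      v i * (σ * (v (i + 1) + if (i : ℕ) = 0 then 0 else v (i - 1))) := by
    intro i
    by_cases hi : i ∈ B
    · rw [hvB i hi]; ring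
    obtain ⟨g1, g2, g3⟩ := hB i hi
    congr 1
    have h1 : ∀ j, Γ.η α N j * Γ.ev j i = Γ.ev j (i + 1) +
        if (i : ℕ) = 0 then 0 else Γ.ev j (i - 1) := by
      intro j
      have h2 := Γ.ev_row j (i := i) (by omega)
      rw [g1] at h2
      have h3 : Γ.r i * Γ.ev j (i + 1) = Real.sqrt N * Γ.ev j (i + 1) := by
        by_cases hid : (i : ℕ) < Γ.d
        · rw [g3 hid]
        · rw [Γ.ev_big j (i + 1) (by omega)]; ring
      rw [h3] at h2
      unfold η
      rw [div_mul_eq_mul_div, div_eq_iff hsN.ne']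
      by_cases hi0 : (i : ℕ) = 0
      · simp only [hi0, if_true] at h2 ⊢
        linarith
      · simp only [hi0, if_false] at h2 ⊢
        rw [g2 (by omega)] at h2
        linarith
    have h2 : ∀ j, σ * Γ.η α N j * e j * Γ.ev j i = σ * (e j * Γ.ev j (i + 1)) +
        σ * (if (i : ℕ) = 0 then 0 else e j * Γ.ev j (i - 1)) := by
      intro j
      have := h1 j
      split_ifs at this ⊢ <;> linear_combination σ * e j * this
    simp only [h2, hv]
    rw [Finset.sum_add_distrib, ← Finset.mul_sum, ← Finset.mul_sum, mul_add]
    congr 2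
    split_ifs <;> simp
  have h1 := hgen e fun j => σ * Γ.η α N j * e j
  have h2 := hgen e e
  have h3 := sum_mul_neighbours_le Γ.d v (by simp [hv, Γ.ev_big]) σ hσ
  rw [← Fin.sum_univ_eq_sum_range (fun i => v i * (σ * (v (i + 1) + if i = 0 then 0 else v (i - 1)))),
    ← Fin.sum_univ_eq_sum_range (fun i => v i ^ 2)] at h3
  rw [← Finset.sum_congr rfl fun i _ => hrow i] at h3
  simp only [sq] at h3
  rw [h1, h2, Finset.mul_sum] at h3
  refine absurd h3 (not_le.2 ?_)
  obtain ⟨j0, hj0⟩ := Function.ne_iff.1 hc0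
  refine Finset.sum_lt_sum (fun j _ => ?_) ⟨j0, Finset.mem_univ _, ?_⟩
  · by_cases hj : j ∈ S
    · have h4 : 2 < σ * Γ.η α N j := (Finset.mem_filter.1 hj).2
      nlinarith [mul_self_nonneg (e j)]
    · simp [he, hj]
  · have h4 : 2 < σ * Γ.η α N j0 := (Finset.mem_filter.1 j0.2).2
    have h5 : e j0 ≠ 0 := by simpa [he] using hj0
    have := mul_self_pos.2 h5
    nlinarith

lemma card_abs_η_le (α N : ℕ) (hN : 1 ≤ N) (B : Finset (Fin (Γ.d + 1)))
    (hB : ∀ i, i ∉ B → Γ.GoodRow α N i) :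
    (Finset.univ.filter fun j => 2 < |Γ.η α N j|).card ≤ 2 * B.card := by
  have h1 := Γ.card_lt_η_le α N hN B hB 1 (by norm_num)
  have h2 := Γ.card_lt_η_le α N hN B hB (-1) (by norm_num)
  have h3 : (Finset.univ.filter fun j => 2 < |Γ.η α N j|) ⊆
      (Finset.univ.filter fun j => 2 < 1 * Γ.η α N j) ∪
      (Finset.univ.filter fun j => 2 < -1 * Γ.η α N j) := by
    intro j hj
    simp only [Finset.mem_filter, Finset.mem_univ, true_and, Finset.mem_union] at hj ⊢
    rcases lt_abs.1 hj with h | h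
    · left; linarith
    · right; linarith
  have := (Finset.card_le_card h3).trans (Finset.card_union_le _ _)
  omega

lemma η_injective (α N : ℕ) (hN : 1 ≤ N) : Function.Injective (Γ.η α N) := by
  intro i j h
  have hsN : 0 < Real.sqrt N := Real.sqrt_pos.2 (by exact_mod_cast hN)
  unfold η at h
  rw [div_left_inj' hsN.ne'] at h
  exact Γ.θ_injective (by linarith)

lemma abs_η_le {α N : ℕ} (hα : α ≤ k) (hN : 1 ≤ N) (j : Fin (Γ.d + 1)) :
    |Γ.η α N j| ≤ 4 * k := by
  have hsN : 1 ≤ Real.sqrt N := Real.one_le_sqrt.2 (by exact_mod_cast hN)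
  have hα' : (α : ℝ) ≤ k := by exact_mod_cast hα
  unfold η
  rw [abs_div, abs_of_pos (show 0 < Real.sqrt N by linarith),
    div_le_iff₀ (show 0 < Real.sqrt N by linarith)]
  have h1 := (abs_sub (Γ.θ j) (α : ℝ)).trans (add_le_add (Γ.abs_θ_le j)
    (le_of_eq (abs_of_nonneg (Nat.cast_nonneg α))))
  have : 4 * (k : ℝ) ≤ 4 * k * Real.sqrt N := le_mul_of_one_le_right (by positivity) hsN
  linarith

end IntArray

lemma Finset.sum_sum_erase_le {ι : Type*} [DecidableEq ι] (S T : Finset ι) (L : ι → ι → ℝ) {M : ℝ}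
    (hM : 0 ≤ M) (hL : ∀ i ∈ S, ∀ j ∈ S, L i j ≤ M) (hT : T ⊆ S) :
    ∑ i ∈ S, ∑ j ∈ S.erase i, L i j ≤
      ∑ i ∈ S \ T, ∑ j ∈ (S \ T).erase i, L i j + 2 * M * T.card * S.card := by
  rw [← Finset.sum_sdiff hT]
  have h1 : ∑ i ∈ T, ∑ j ∈ S.erase i, L i j ≤ T.card * (S.card * M) := by
    rw [← nsmul_eq_mul]
    refine Finset.sum_le_card_nsmul _ _ _ fun i hi => ?_
    refine (Finset.sum_le_card_nsmul _ _ M fun j hj => hL i (hT hi) j (Finset.mem_of_mem_erase hj)).trans ?_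
    rw [nsmul_eq_mul]
    refine mul_le_mul_of_nonneg_right ?_ hM
    exact_mod_cast Finset.card_le_card (Finset.erase_subset _ _)
  have h2 : ∑ i ∈ S \ T, ∑ j ∈ S.erase i, L i j ≤
      ∑ i ∈ S \ T, (∑ j ∈ (S \ T).erase i, L i j + T.card * M) := by
    refine Finset.sum_le_sum fun i hi => ?_
    obtain ⟨hiS, hiT⟩ := Finset.mem_sdiff.1 hi
    have h3 : T ⊆ S.erase i := fun j hj =>
      Finset.mem_erase.2 ⟨fun h => hiT (h ▸ hj), hT hj⟩
    rw [← Finset.sum_sdiff h3]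
    have h4 : S.erase i \ T = (S \ T).erase i := by
      ext j; simp only [Finset.mem_sdiff, Finset.mem_erase]; tauto
    rw [h4, add_le_add_iff_left, ← nsmul_eq_mul]
    exact Finset.sum_le_card_nsmul _ _ M fun j hj => hL i hiS j (hT hj)
  rw [Finset.sum_add_distrib, Finset.sum_const, nsmul_eq_mul] at h2
  have h5 : ((S \ T).card : ℝ) * (T.card * M) ≤ S.card * (T.card * M) := by
    refine mul_le_mul_of_nonneg_right ?_ (by positivity)
    exact_mod_cast Finset.card_le_card Finset.sdiff_subset
  linarith

namespace IntArray

variable {k : ℕ} (Γ : IntArray k)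

lemma chebyshev_sum_sq_le (hk : 1 ≤ k) {α N : ℕ} (hα : α ≤ k) (hN : 1 ≤ N) (hNk : N ≤ k ^ 2)
    (B : Finset (Fin (Γ.d + 1))) (hB : ∀ i, i ∉ B → Γ.GoodRow α N i)
    (S : Finset (Fin (Γ.d + 1))) (hS : ∀ i ∈ S, ∀ j, Γ.F (Γ.θ i) = Γ.F (Γ.θ j) → j ∈ S)
    {ρ : ℝ} (h0 : 0 ≤ ρ) (h1 : ρ < 1) (m : ℕ) :
    (ρ ^ m / m) / 2 *
      (∑ j ∈ S.filter (fun j => |Γ.η α N j| ≤ 2),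
        (Polynomial.Chebyshev.C ℝ m).eval (Γ.η α N j)) ^ 2 ≤
    2 * (1 - ρ) * ((Γ.d : ℝ) + 1) ^ 2 + (-(2 * Real.log (1 - ρ)) + 6 * Real.log (8 * k) * B.card) *
      ((Γ.d : ℝ) + 1) := by
  classical
  have hk0 : (1 : ℝ) ≤ k := by exact_mod_cast hk
  set M := Real.log (8 * k) with hM
  have hM0 : 0 ≤ M := Real.log_nonneg (by linarith)
  set T := S.filter (fun j => 2 < |Γ.η α N j|) with hT
  have hST : S \ T = S.filter (fun j => |Γ.η α N j| ≤ 2) := by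
    ext j; simp only [hT, Finset.mem_sdiff, Finset.mem_filter, not_and, not_lt]; tauto
  rw [← hST]
  have hTc : T.card ≤ 2 * B.card :=
    (Finset.card_le_card (Finset.filter_subset_filter _ (Finset.subset_univ S))).trans
      (Γ.card_abs_η_le α N hN B hB)
  have hSc : (S.card : ℝ) ≤ Γ.d + 1 := by
    have := Finset.card_le_univ S
    rw [Fintype.card_fin] at this
    exact_mod_cast this
  have hinj := Γ.η_injective α N hN
  have hdisc := Γ.one_le_disc S hS α N hN B hB
  have hsN : 1 ≤ Real.sqrt N := Real.one_le_sqrt.2 (by exact_mod_cast hN)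
  have hsN' : Real.sqrt N ≤ 8 * k := by
    have : Real.sqrt N ≤ k := by
      rw [Real.sqrt_le_left (by positivity)]
      exact_mod_cast hNk
    linarith
  have hne : ∀ i ∈ S, ∀ j ∈ S.erase i, |Γ.η α N i - Γ.η α N j| ≠ 0 := by
    intro i _ j hj h
    rw [abs_eq_zero, sub_eq_zero] at h
    exact (Finset.mem_erase.1 hj).1 (hinj h).symm
  have hlog := Real.log_nonneg hdisc
  rw [Real.log_mul (by positivity) (Finset.prod_ne_zero_iff.2 fun i hi =>
    Finset.prod_ne_zero_iff.2 (hne i hi)), Real.log_pow,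
    Real.log_prod fun i hi => Finset.prod_ne_zero_iff.2 (hne i hi),
    Finset.sum_congr rfl fun i hi => Real.log_prod (hne i hi)] at hlog
  have hL : ∀ i ∈ S, ∀ j ∈ S, Real.log |Γ.η α N i - Γ.η α N j| ≤ M := by
    intro i _ j _
    by_cases hij : Γ.η α N i - Γ.η α N j = 0
    · rw [hij]; simpa using hM0
    refine Real.log_le_log (abs_pos.2 hij) ((abs_sub _ _).trans ?_)
    have := Γ.abs_η_le hα hN i
    have := Γ.abs_η_le hα hN j
    linarith
  have h2 := Finset.sum_sum_erase_le S T (fun i j => Real.log |Γ.η α N i - Γ.η α N j|) hM0 hL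
    (Finset.filter_subset _ _)
  have h3 := sum_log_abs_sub_le (S \ T) (Γ.η α N)
    (fun i hi => by rw [hST] at hi; exact (Finset.mem_filter.1 hi).2)
    (fun i _ j _ h => hinj h) h0 h1 m
  have hlN : Real.log (Real.sqrt N) ≤ M := Real.log_le_log (by linarith) hsN'
  have hTc' : (T.card : ℝ) ≤ 2 * B.card := by exact_mod_cast hTc
  have e1 : ((2 * B.card * S.card : ℕ) : ℝ) * Real.log (Real.sqrt N) ≤
      2 * B.card * (Γ.d + 1) * M := by
    push_cast
    exact mul_le_mul (mul_le_mul_of_nonneg_left hSc (by positivity)) hlN (Real.log_nonneg hsN)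
      (by positivity)
  have e2 : 2 * M * T.card * S.card ≤ 2 * M * (2 * B.card) * (Γ.d + 1) :=
    mul_le_mul (mul_le_mul_of_nonneg_left hTc' (by positivity)) hSc (by positivity) (by positivity)
  have hUc : ((S \ T).card : ℝ) ≤ Γ.d + 1 := by
    refine le_trans ?_ hSc
    exact_mod_cast Finset.card_le_card Finset.sdiff_subset
  have e3 : 2 * (1 - ρ) * ((S \ T).card : ℝ) ^ 2 ≤ 2 * (1 - ρ) * ((Γ.d : ℝ) + 1) ^ 2 :=
    mul_le_mul_of_nonneg_left (pow_le_pow_left₀ (by positivity) hUc 2) (by linarith)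
  have e4 : -(2 * Real.log (1 - ρ)) * (S \ T).card ≤ -(2 * Real.log (1 - ρ)) * (Γ.d + 1) := by
    refine mul_le_mul_of_nonneg_left hUc ?_
    have := Real.log_nonpos (by linarith : 0 ≤ 1 - ρ) (by linarith)
    linarith
  linarith

/-- If almost all rows are good, then the rescaled eigenvalues in a union of level sets of `F` are
equidistributed with respect to the arcsine distribution. -/
theorem exists_equidistribution (k : ℕ) (hk : 1 ≤ k) (g : Polynomial ℝ) : ∀ ε : ℝ, 0 < ε →
    ∃ ε' : ℝ, 0 < ε' ∧ ∃ d0 : ℕ, ∀ Γ : IntArray k, d0 ≤ Γ.d → ∀ α N : ℕ, α ≤ k → 1 ≤ N → N ≤ k ^ 2 →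
    ∀ B : Finset (Fin (Γ.d + 1)), (∀ i, i ∉ B → Γ.GoodRow α N i) → B.card ≤ ε' * Γ.d →
    ∀ S : Finset (Fin (Γ.d + 1)), (∀ i ∈ S, ∀ j, Γ.F (Γ.θ i) = Γ.F (Γ.θ j) → j ∈ S) →
    |∑ j ∈ S, g.eval (Γ.η α N j) - S.card * arcsineMean g| ≤ ε * Γ.d := by
  induction g using Polynomial.chebyshev_C_induction with
  | hadd f g hf hg =>
    intro ε hε
    obtain ⟨ε1, h1, d1, H1⟩ := hf (ε / 2) (by linarith)
    obtain ⟨ε2, h2, d2, H2⟩ := hg (ε / 2) (by linarith)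
    refine ⟨min ε1 ε2, lt_min h1 h2, max d1 d2, fun Γ hd α N hα hN hNk B hB hBc S hS => ?_⟩
    have hd0 : (0 : ℝ) ≤ Γ.d := by positivity
    have e1 := H1 Γ ((le_max_left _ _).trans hd) α N hα hN hNk B hB
      (hBc.trans (mul_le_mul_of_nonneg_right (min_le_left _ _) hd0)) S hS
    have e2 := H2 Γ ((le_max_right _ _).trans hd) α N hα hN hNk B hB
      (hBc.trans (mul_le_mul_of_nonneg_right (min_le_right _ _) hd0)) S hS
    simp only [Polynomial.eval_add, Finset.sum_add_distrib, arcsineMean_add]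
    rw [_root_.abs_le] at e1 e2 ⊢
    constructor <;> linarith [e1.1, e1.2, e2.1, e2.2]
  | hsmul c f hf =>
    intro ε hε
    have hc : 0 < |c| + 1 := by positivity
    obtain ⟨ε1, h1, d1, H1⟩ := hf (ε / (|c| + 1)) (by positivity)
    refine ⟨ε1, h1, d1, fun Γ hd α N hα hN hNk B hB hBc S hS => ?_⟩
    have e1 := H1 Γ hd α N hα hN hNk B hB hBc S hS
    simp only [Polynomial.eval_mul, Polynomial.eval_C, ← Finset.mul_sum, arcsineMean_C_mul]
    rw [show c * ∑ j ∈ S, f.eval (Γ.η α N j) - S.card * (c * arcsineMean f) =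
      c * (∑ j ∈ S, f.eval (Γ.η α N j) - S.card * arcsineMean f) by ring, abs_mul]
    have e2 := mul_le_mul_of_nonneg_left e1 (abs_nonneg c)
    refine e2.trans ?_
    have e3 : 0 ≤ ε / (|c| + 1) * Γ.d := by positivity
    have e4 : (|c| + 1) * (ε / (|c| + 1) * Γ.d) = ε * Γ.d := by field_simp
    linarith
  | hC m =>
    intro ε hε
    rcases Nat.eq_zero_or_pos m with rfl | hm
    · refine ⟨1, one_pos, 0, fun Γ hd α N hα hN hNk B hB hBc S hS => ?_⟩
      rw [arcsineMean_C_zero]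
      simp [Polynomial.Chebyshev.C_zero]
      positivity
    rw [arcsineMean_C_pos hm]
    obtain ⟨M, hM0, hM⟩ := (Polynomial.Chebyshev.C ℝ m).exists_bound_abs_eval (4 * k)
    set Q : ℝ := 2 * m * 2 ^ m with hQ
    have hQ0 : 0 < Q := by positivity
    set δ : ℝ := min (1 / 2) (ε ^ 2 / (96 * Q)) with hδ
    have hδ0 : 0 < δ := lt_min (by norm_num) (by positivity)
    have hδ1 : δ ≤ 1 / 2 := min_le_left _ _
    have hδ2 : 8 * Q * δ ≤ ε ^ 2 / 12 := by
      have := min_le_right (1 / 2) (ε ^ 2 / (96 * Q))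
      rw [← hδ, le_div_iff₀ (by positivity)] at this
      linarith
    set E : ℝ := 6 * Real.log (8 * k) with hE
    have hE0 : 0 ≤ E := mul_nonneg (by norm_num) (Real.log_nonneg (by
      have : (1 : ℝ) ≤ k := by exact_mod_cast hk
      linarith))
    set U : ℝ := -(2 * Real.log δ) with hU
    have hU0 : 0 ≤ U := by
      have := Real.log_nonpos hδ0.le (by linarith)
      linarith
    set ε' : ℝ := min (ε / (4 * (M + 1))) (ε ^ 2 / (24 * Q * (E + 1))) with hε'
    have hε'0 : 0 < ε' := lt_min (by positivity) (by positivity)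
    have hε1 : 4 * M * ε' ≤ ε := by
      have := min_le_left (ε / (4 * (M + 1))) (ε ^ 2 / (24 * Q * (E + 1)))
      rw [← hε', le_div_iff₀ (by positivity)] at this
      linarith
    have hε2 : 2 * Q * E * ε' ≤ ε ^ 2 / 12 := by
      have := min_le_right (ε / (4 * (M + 1))) (ε ^ 2 / (24 * Q * (E + 1)))
      rw [← hε', le_div_iff₀ (by positivity)] at this
      have : 0 ≤ ε' * (24 * Q) := by positivity
      linarith
    obtain ⟨d0, hd0⟩ := exists_nat_ge (24 * Q * U / ε ^ 2)
    refine ⟨ε', hε'0, max d0 1, fun Γ hd α N hα hN hNk B hB hBc S hS => ?_⟩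
    have hd1 : (1 : ℝ) ≤ Γ.d := by exact_mod_cast (le_max_right _ _).trans hd
    have hdd : 24 * Q * U ≤ ε ^ 2 * Γ.d := by
      have h1 : 24 * Q * U / ε ^ 2 ≤ Γ.d := hd0.trans (by exact_mod_cast (le_max_left _ _).trans hd)
      rw [div_le_iff₀ (by positivity)] at h1
      linarith
    have key := Γ.chebyshev_sum_sq_le hk hα hN hNk B hB S hS (ρ := 1 - δ) (by linarith) (by linarith) m
    rw [sub_sub_cancel, ← hE, ← hU] at key
    set X := ∑ j ∈ S.filter (fun j => |Γ.η α N j| ≤ 2),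
        (Polynomial.Chebyshev.C ℝ m).eval (Γ.η α N j) with hX
    have hX2 : X ^ 2 ≤ (ε / 2 * Γ.d) ^ 2 := by
      have e1 : 1 / Q ≤ ((1 - δ) ^ m / m) / 2 := by
        rw [div_div, div_le_div_iff₀ hQ0 (by positivity), hQ]
        have e2 : (1 : ℝ) ≤ (1 - δ) ^ m * 2 ^ m := by
          rw [← mul_pow]; exact one_le_pow₀ (by linarith)
        have : (0 : ℝ) ≤ 2 * m := by positivity
        nlinarith
      have e2 := (mul_le_mul_of_nonneg_right e1 (sq_nonneg X)).trans key
      rw [one_div_mul_eq_div, div_le_iff₀ hQ0] at e2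
      have e3 : ((Γ.d : ℝ) + 1) ^ 2 ≤ 4 * (Γ.d : ℝ) ^ 2 := by nlinarith
      have e4 : 2 * δ * ((Γ.d : ℝ) + 1) ^ 2 ≤ 2 * δ * (4 * (Γ.d : ℝ) ^ 2) :=
        mul_le_mul_of_nonneg_left e3 (by positivity)
      have e5 : (U + E * B.card) * ((Γ.d : ℝ) + 1) ≤ (U + E * (ε' * Γ.d)) * (2 * Γ.d) :=
        mul_le_mul (add_le_add le_rfl (mul_le_mul_of_nonneg_left hBc hE0)) (by linarith)
          (by positivity) (by positivity)
      have e6 : X ^ 2 ≤ (2 * δ * (4 * (Γ.d : ℝ) ^ 2) + (U + E * (ε' * Γ.d)) * (2 * Γ.d)) * Q :=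
        e2.trans (mul_le_mul_of_nonneg_right (by linarith) hQ0.le)
      have e7 := mul_le_mul_of_nonneg_right hδ2 (sq_nonneg (Γ.d : ℝ))
      have e8 := mul_le_mul_of_nonneg_right hε2 (sq_nonneg (Γ.d : ℝ))
      have e9 := mul_le_mul_of_nonneg_right hdd (show (0 : ℝ) ≤ Γ.d by positivity)
      linarith
    have hX3 : |X| ≤ ε / 2 * Γ.d := abs_le_of_sq_le_sq hX2 (by positivity)
    have hY : |∑ j ∈ S.filter (fun j => ¬ |Γ.η α N j| ≤ 2),
        (Polynomial.Chebyshev.C ℝ m).eval (Γ.η α N j)| ≤ ε / 2 * Γ.d := by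
      refine (Finset.abs_sum_le_sum_abs _ _).trans ?_
      refine (Finset.sum_le_card_nsmul _ _ M fun j _ => hM _ (Γ.abs_η_le hα hN j)).trans ?_
      have e1 : (S.filter (fun j => ¬ |Γ.η α N j| ≤ 2)).card ≤ 2 * B.card := by
        simp only [not_le]
        exact (Finset.card_le_card (Finset.filter_subset_filter _ (Finset.subset_univ S))).trans
          (Γ.card_abs_η_le α N hN B hB)
      have e2 : ((S.filter (fun j => ¬ |Γ.η α N j| ≤ 2)).card : ℝ) ≤ 2 * (ε' * Γ.d) := by
        refine le_trans (by exact_mod_cast e1) (mul_le_mul_of_nonneg_left hBc (by norm_num))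
      rw [nsmul_eq_mul]
      have e3 := mul_le_mul_of_nonneg_right e2 hM0
      have e4 := mul_le_mul_of_nonneg_right hε1 (show (0 : ℝ) ≤ Γ.d by positivity)
      linarith
    rw [mul_zero, sub_zero, ← Finset.sum_filter_add_sum_filter_not S (fun j => |Γ.η α N j| ≤ 2)]
    exact (abs_add_le _ _).trans (by linarith)

end IntArray

namespace IntArray

variable {k : ℕ} (Γ : IntArray k)

/-- The quadratic form in two consecutive terms of `q` that is constant along a window. -/
noncomputable def E (i : ℕ) (r α x : ℝ) : ℝ :=
  Γ.q i x ^ 2 - (x - α) / r * Γ.q i x * Γ.q (i + 1) x + Γ.q (i + 1) x ^ 2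

variable {Γ} {w l : ℕ} {r α : ℝ}

lemma Window.E_eq (h : Γ.Window w l r α) (x : ℝ) {t : ℕ} (ht : t < l) :
    Γ.E (w + t) r α x = Γ.E w r α x := h.invariant x ht

lemma Window.E_eq_sub (h : Γ.Window w l r α) (x : ℝ) {i : ℕ} (h1 : w < i) (h2 : i < w + l) :
    Γ.E w r α x = Γ.q i x * Γ.q i x - Γ.q (i + 1) x * Γ.q (i - 1) x := by
  obtain ⟨t, rfl⟩ : ∃ t, i = w + t := ⟨i - w, by omega⟩
  rw [← h.E_eq x (by omega : t < l), E, h.recur h1 h2]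
  ring

/-- The polynomial `2 - η ^ 2 / 2`. -/
noncomputable def arcsineWeight : Polynomial ℝ :=
  1 - Polynomial.C (1 / 2) * Polynomial.Chebyshev.C ℝ 2

lemma arcsineWeight_eval (x : ℝ) : arcsineWeight.eval x = 2 - x ^ 2 / 2 := by
  simp [arcsineWeight, Polynomial.Chebyshev.C_two]; ring

lemma arcsineMean_arcsineWeight_mul_C (m : ℕ) :
    arcsineMean (arcsineWeight * Polynomial.Chebyshev.C ℝ m) =
      (if m = 0 then 2 else 0) - (if m = 2 then 1 else 0) := by
  have h0 : arcsineWeight * Polynomial.Chebyshev.C ℝ m = Polynomial.Chebyshev.C ℝ m +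
      Polynomial.C (-1 / 2) * (Polynomial.Chebyshev.C ℝ (m + 2) +
        Polynomial.Chebyshev.C ℝ (m - 2)) := by
    rw [← Polynomial.Chebyshev.C_mul_C, arcsineWeight, neg_div, Polynomial.C_neg]
    ring
  have h2 := arcsineMean_C_pos (m := m + 2) (by omega)
  push_cast at h2
  rw [h0, arcsineMean_add, arcsineMean_C_mul, arcsineMean_add, h2]
  match m with
  | 0 =>
    have h3 := arcsineMean_C_pos (m := 2) (by omega)
    have h1 := arcsineMean_C_zero
    simp only [Nat.cast_zero, zero_sub, Polynomial.Chebyshev.C_neg] at h1 h3 ⊢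
    push_cast at h3
    rw [h1, h3]; norm_num
  | 1 =>
    have h3 := arcsineMean_C_pos (m := 1) (by omega)
    have e : ((1 : ℕ) : ℤ) - 2 = -((1 : ℕ) : ℤ) := by norm_num
    rw [e, Polynomial.Chebyshev.C_neg, h3]; norm_num
  | m + 2 =>
    have h3 := arcsineMean_C_pos (m := m + 2) (by omega)
    have e : ((m + 2 : ℕ) : ℤ) - 2 = (m : ℤ) := by push_cast; ring
    rw [e, h3]
    rcases Nat.eq_zero_or_pos m with rfl | hm
    · rw [arcsineMean_C_zero]; norm_num
    · rw [arcsineMean_C_pos hm]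
      simp [hm.ne']

/-- The spectral moments of the invariant form of a long window. -/
theorem exists_sum_w_mul_E (g : Polynomial ℝ) : ∃ M : ℕ, ∀ (k : ℕ) (Γ : IntArray k)
    (w l : ℕ) (r α : ℝ), Γ.Window w l r α → M ≤ l →
    ∑ j, Γ.w j * (Γ.E w r α (Γ.θ j) * g.eval ((Γ.θ j - α) / r)) =
      arcsineMean (arcsineWeight * g) := by
  induction g using Polynomial.chebyshev_C_induction with
  | hadd f g hf hg =>
    obtain ⟨M1, h1⟩ := hf
    obtain ⟨M2, h2⟩ := hg
    refine ⟨max M1 M2, fun k Γ w l r α h hl => ?_⟩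
    rw [mul_add, arcsineMean_add, ← h1 k Γ w l r α h ((le_max_left _ _).trans hl),
      ← h2 k Γ w l r α h ((le_max_right _ _).trans hl), ← Finset.sum_add_distrib]
    refine Finset.sum_congr rfl fun j _ => ?_
    rw [Polynomial.eval_add]; ring
  | hsmul c f hf =>
    obtain ⟨M1, h1⟩ := hf
    refine ⟨M1, fun k Γ w l r α h hl => ?_⟩
    rw [mul_left_comm, arcsineMean_C_mul, ← h1 k Γ w l r α h hl, Finset.mul_sum]
    refine Finset.sum_congr rfl fun j _ => ?_
    rw [Polynomial.eval_mul, Polynomial.eval_C]; ring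
  | hC m =>
    refine ⟨2 * m + 4, fun k Γ w l r α h hl => ?_⟩
    have hle := h.le
    have h1 : ∀ x, Γ.E w r α x * (Polynomial.Chebyshev.C ℝ m).eval ((x - α) / r) =
        Γ.q (w + m + 1 + m) x * Γ.q (w + m + 1) x + Γ.q (w + 1) x * Γ.q (w + m + 1) x -
        (Γ.q (w + m + 2 + m) x * Γ.q (w + m) x + Γ.q (w + 2) x * Γ.q (w + m) x) := by
      intro x
      have e1 := h.chebyshev x m (w + m + 1) (by omega) (by omega)
      have e2 := h.chebyshev x m (w + m + 1 + 1) (by omega) (by omega)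
      rw [show w + m + 1 - m = w + 1 by omega] at e1
      rw [show w + m + 1 + 1 - m = w + 2 by omega] at e2
      rw [h.E_eq_sub x (i := w + m + 1) (by omega) (by omega), Nat.add_sub_cancel]
      linear_combination Γ.q (w + m + 1) x * e1 - Γ.q (w + m) x * e2
    simp only [h1, mul_sub, mul_add, Finset.sum_sub_distrib, Finset.sum_add_distrib]
    rw [Γ.sum_w_q_q (by omega) (by omega), Γ.sum_w_q_q (by omega) (by omega),
      Γ.sum_w_q_q (by omega) (by omega), Γ.sum_w_q_q (by omega) (by omega),
      arcsineMean_arcsineWeight_mul_C]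
    rw [if_neg (by omega : ¬ w + m + 2 + m = w + m)]
    rcases Nat.eq_zero_or_pos m with rfl | hm
    · norm_num
    · rw [if_neg (by omega : ¬ w + m + 1 + m = w + m + 1), if_neg (by omega : ¬ w + 1 = w + m + 1),
        if_neg hm.ne']
      by_cases h2 : m = 2
      · subst h2; norm_num
      · rw [if_neg h2, if_neg (by omega)]; norm_num

end IntArray

/-- A layer-cake estimate. -/
lemma abs_sum_mul_le_of_levels {ι : Type*} [Fintype ι] (h G : ι → ℝ) {M δ : ℝ} (hM : 0 ≤ M)
    (h0 : ∀ i, 0 ≤ h i) (hh : ∀ i, h i ≤ M)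
    (hS : ∀ y, 0 ≤ y → y < M → |∑ i ∈ Finset.univ.filter (fun i => y < h i), G i| ≤ δ) :
    |∑ i, h i * G i| ≤ M * δ := by
  have h1 : ∀ i, MeasureTheory.IntegrableOn ((Set.Iio (h i)).indicator fun _ => G i)
      (Set.Ico 0 M) := fun i =>
    (MeasureTheory.integrableOn_const (by simp)).indicator measurableSet_Iio
  have h2 : ∀ i, ∫ y in Set.Ico 0 M, (Set.Iio (h i)).indicator (fun _ => G i) y = h i * G i := by
    intro i
    rw [MeasureTheory.setIntegral_indicator measurableSet_Iio, Set.Ico_inter_Iio, min_eq_right (hh i)]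
    simp [h0 i]
  have h3 : ∑ i, h i * G i = ∫ y in Set.Ico 0 M,
      ∑ i, (Set.Iio (h i)).indicator (fun _ => G i) y := by
    rw [MeasureTheory.integral_finsetSum _ fun i _ => h1 i]
    simp only [h2]
  have h4 : ∀ y, ∑ i, (Set.Iio (h i)).indicator (fun _ => G i) y =
      ∑ i ∈ Finset.univ.filter (fun i => y < h i), G i := by
    intro y
    rw [Finset.sum_filter]
    refine Finset.sum_congr rfl fun i _ => ?_
    simp [Set.indicator_apply]
  rw [h3]
  have h5 := MeasureTheory.norm_setIntegral_le_of_norm_le_const (μ := MeasureTheory.volume)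
    (s := Set.Ico 0 M) (f := fun y => ∑ i, (Set.Iio (h i)).indicator (fun _ => G i) y) (C := δ)
    (by simp) (fun y hy => by rw [h4 y]; exact hS y hy.1 hy.2)
  rw [Real.norm_eq_abs] at h5
  refine h5.trans (le_of_eq ?_)
  simp [MeasureTheory.Measure.real, hM]; ring

/-- The arcsine mean is definite. -/
lemma eq_zero_of_arcsineMean_mul_self {p : Polynomial ℝ} (hp : arcsineMean (p * p) = 0) : p = 0 := by
  have hpi := Real.pi_pos
  have hc : Continuous fun t => (p * p).eval (2 * Real.cos t) :=
    (p * p).continuous.comp (by fun_prop)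
  by_contra hne
  have hex : ∃ t ∈ Set.Icc 0 Real.pi, 0 < (p * p).eval (2 * Real.cos t) := by
    by_contra hcon
    push Not at hcon
    apply hne
    refine Polynomial.eq_zero_of_infinite_isRoot p (Set.Infinite.mono ?_ (Set.Icc_infinite
      (by norm_num : (-1 : ℝ) < 1)))
    intro x hx
    have h1 := hcon (Real.arccos (x / 2)) ⟨Real.arccos_nonneg _, Real.arccos_le_pi _⟩
    rw [Real.cos_arccos (by linarith [hx.1]) (by linarith [hx.2]), mul_div_cancel₀ _ two_ne_zero,
      Polynomial.eval_mul] at h1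
    exact mul_self_eq_zero.1 (le_antisymm h1 (mul_self_nonneg _))
  obtain ⟨t, ht, hpt⟩ := hex
  have := intervalIntegral.integral_pos hpi hc.continuousOn
    (fun t _ => by rw [Polynomial.eval_mul]; exact mul_self_nonneg _) ⟨t, ht, hpt⟩
  rw [arcsineMean] at hp
  rcases mul_eq_zero.1 hp with h | h
  · exact (one_div_pos.2 hpi).ne' h
  · exact this.ne' h

namespace IntArray

variable {k : ℕ} {Γ : IntArray k} {w l : ℕ} {r α : ℝ}

lemma sum_w : ∑ j, Γ.w j = 1 := by
  have := Γ.sum_w_q_q (i := 0) (i' := 0) (by omega) (by omega)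
  simpa [q_zero] using this

lemma Window.w_mul_abs_E_le (h : Γ.Window w l r α) (j : Fin (Γ.d + 1)) :
    l * (Γ.w j * |Γ.E w r α (Γ.θ j)|) ≤ 2 * (1 + 4 * k) := by
  have hle := h.le
  have h1 : ∀ t ∈ Finset.range l, |Γ.E w r α (Γ.θ j)| ≤
      (1 + 4 * k) * (Γ.q (w + t) (Γ.θ j) ^ 2 + Γ.q (w + 1 + t) (Γ.θ j) ^ 2) := by
    intro t ht
    rw [← h.E_eq _ (Finset.mem_range.1 ht), E, show w + 1 + t = w + t + 1 by ring]
    have h2 := h.abs_eta_le j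
    set η := (Γ.θ j - α) / r
    generalize Γ.q (w + t) (Γ.θ j) = a
    generalize Γ.q (w + t + 1) (Γ.θ j) = b
    have h3 : |η * a * b| ≤ (4 * k) * (a ^ 2 + b ^ 2) := by
      rw [mul_assoc, abs_mul]
      refine mul_le_mul h2 ?_ (abs_nonneg _) (by positivity)
      rw [_root_.abs_le]
      constructor <;> nlinarith [sq_nonneg (a - b), sq_nonneg (a + b)]
    obtain ⟨h4, h5⟩ := _root_.abs_le.1 h3
    rw [_root_.abs_le]
    constructor <;> linarith [sq_nonneg a, sq_nonneg b]
  have h2 := Finset.sum_le_sum h1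
  rw [Finset.sum_const, Finset.card_range, nsmul_eq_mul, ← Finset.mul_sum,
    Finset.sum_add_distrib] at h2
  have h3 := sum_q_sq_le_F (Γ := Γ) (w := w) (l := l) (by omega) (Γ.θ j)
  have h4 := sum_q_sq_le_F (Γ := Γ) (w := w + 1) (l := l) (by omega) (Γ.θ j)
  have h5 : l * |Γ.E w r α (Γ.θ j)| ≤ (1 + 4 * k) * (2 * Γ.F (Γ.θ j)) :=
    h2.trans (mul_le_mul_of_nonneg_left (by linarith) (by positivity))
  have h6 := mul_le_mul_of_nonneg_left h5 (Γ.w_pos j).le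
  have h7 := Γ.w_mul_F j
  calc l * (Γ.w j * |Γ.E w r α (Γ.θ j)|) = Γ.w j * (l * |Γ.E w r α (Γ.θ j)|) := by ring
    _ ≤ _ := h6
    _ = 2 * (1 + 4 * k) * (Γ.w j * Γ.F (Γ.θ j)) := by ring
    _ = _ := by rw [h7, mul_one]

lemma abs_sum_sub_truncated_le (α N s : ℕ) {C Cg K ε V : ℝ} (hK : 0 < K) (hC : 0 ≤ C)
    (hCg : 0 ≤ Cg) {P g : Polynomial ℝ}
    (hE : ∀ j, Γ.E s (Real.sqrt N) α (Γ.θ j) = P.eval (Γ.η α N j))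
    (hw : ∀ j, Γ.w j * |Γ.E s (Real.sqrt N) α (Γ.θ j)| ≤ C / Γ.d)
    (hg : ∀ j, |g.eval (Γ.η α N j)| ≤ Cg)
    (hV : ∑ j, Γ.w j * (Γ.E s (Real.sqrt N) α (Γ.θ j) * g.eval (Γ.η α N j)) = V)
    (hS : ∀ S : Finset (Fin (Γ.d + 1)),
      (∀ i ∈ S, ∀ j, Γ.F (Γ.θ i) = Γ.F (Γ.θ j) → j ∈ S) →
      |∑ j ∈ S, (P * g).eval (Γ.η α N j) - S.card * arcsineMean (P * g)| ≤ ε * Γ.d) :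
    |V - (∑ j, min (Γ.w j) (K / Γ.d)) * arcsineMean (P * g)| ≤ C * Cg / K + K * ε := by
  have hd : (0 : ℝ) < Γ.d := by exact_mod_cast (by have := Γ.two_le; omega : 0 < Γ.d)
  have hKd : 0 < K / Γ.d := by positivity
  have hwF : ∀ j, Γ.w j = (Γ.F (Γ.θ j))⁻¹ := fun j => eq_inv_of_mul_eq_one_left (Γ.w_mul_F j)
  have h1 : |∑ j, min (Γ.w j) (K / Γ.d) * ((P * g).eval (Γ.η α N j) - arcsineMean (P * g))| ≤
      K / Γ.d * (ε * Γ.d) := by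
    refine abs_sum_mul_le_of_levels _ _ hKd.le (fun j => le_min (Γ.w_pos j).le hKd.le)
      (fun j => min_le_right _ _) fun y _ _ => ?_
    rw [Finset.sum_sub_distrib, Finset.sum_const, nsmul_eq_mul]
    refine hS _ fun i hi j hij => ?_
    simp only [Finset.mem_filter, Finset.mem_univ, true_and] at hi ⊢
    rwa [hwF, ← hij, ← hwF]
  rw [show K / Γ.d * (ε * Γ.d) = K * ε by field_simp] at h1
  have h2 : |∑ j, (Γ.w j - min (Γ.w j) (K / Γ.d)) * (P * g).eval (Γ.η α N j)| ≤ C * Cg / K := by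
    have h3 : ∀ j, |(Γ.w j - min (Γ.w j) (K / Γ.d)) * (P * g).eval (Γ.η α N j)| ≤
        if K / Γ.d < Γ.w j then C / Γ.d * Cg else 0 := by
      intro j
      split_ifs with h4
      · rw [abs_mul, Polynomial.eval_mul, abs_mul, ← hE, ← mul_assoc]
        refine mul_le_mul (le_trans ?_ (hw j)) (hg j) (abs_nonneg _) (by positivity)
        refine mul_le_mul_of_nonneg_right ?_ (abs_nonneg _)
        rw [min_eq_right h4.le, abs_of_nonneg (by linarith)]
        linarith
      · rw [min_eq_left (not_lt.1 h4)]; simp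
    refine (Finset.abs_sum_le_sum_abs _ _).trans ((Finset.sum_le_sum fun j _ => h3 j).trans ?_)
    rw [← Finset.sum_filter, Finset.sum_const, nsmul_eq_mul]
    set T := Finset.univ.filter (fun j => K / Γ.d < Γ.w j) with hT
    have h4 : (T.card : ℝ) * (K / Γ.d) ≤ 1 := by
      rw [← Γ.sum_w, ← nsmul_eq_mul]
      refine (Finset.card_nsmul_le_sum T _ _ fun j hj => ?_).trans
        (Finset.sum_le_sum_of_subset_of_nonneg (Finset.subset_univ T) fun j _ _ => (Γ.w_pos j).le)
      rw [hT, Finset.mem_filter] at hj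
      exact hj.2.le
    calc (T.card : ℝ) * (C / Γ.d * Cg) = (T.card * (K / Γ.d)) * (C * Cg / K) := by
          field_simp
      _ ≤ 1 * (C * Cg / K) := mul_le_mul_of_nonneg_right h4 (by positivity)
      _ = _ := one_mul _
  have h5 : V - (∑ j, min (Γ.w j) (K / Γ.d)) * arcsineMean (P * g) =
      ∑ j, (Γ.w j - min (Γ.w j) (K / Γ.d)) * (P * g).eval (Γ.η α N j) +
      ∑ j, min (Γ.w j) (K / Γ.d) * ((P * g).eval (Γ.η α N j) - arcsineMean (P * g)) := by
    rw [← hV, Finset.sum_mul, ← Finset.sum_sub_distrib, ← Finset.sum_add_distrib]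
    refine Finset.sum_congr rfl fun j _ => ?_
    rw [hE, Polynomial.eval_mul]; ring
  rw [h5]
  exact (abs_add_le _ _).trans (add_le_add h2 h1)

lemma abs_mul_sub_le_of_approx {κ u v z δ : ℝ} (h1 : |1 - κ * u| ≤ δ) (h2 : |v - κ * z| ≤ δ) :
    |v * u - z| ≤ δ * (|u| + |z|) := by
  have e : v * u - z = (v - κ * z) * u - (1 - κ * u) * z := by ring
  rw [e, mul_add]
  refine (abs_sub _ _).trans (add_le_add ?_ ?_)
  · rw [abs_mul]; exact mul_le_mul_of_nonneg_right h2 (abs_nonneg _)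
  · rw [abs_mul]; exact mul_le_mul_of_nonneg_right h1 (abs_nonneg _)

/-- If a fixed proportion of the array after a bounded initial segment is constant and almost all
rows are good with the same parameters, then the invariant form of the constant part is the one of
the arcsine law. -/
theorem eq_smul_arcsineWeight {k : ℕ} (hk : 1 ≤ k) {𝒰 : Filter ℕ} [NeBot 𝒰] (Γ : ℕ → IntArray k)
    (hd : Tendsto (fun n => (Γ n).d) 𝒰 atTop) {α N s : ℕ} (hα : α ≤ k) (hN : 1 ≤ N)
    (hNk : N ≤ k ^ 2)
    (hbad : ∀ ε : ℝ, 0 < ε → ∀ᶠ n in 𝒰, ∃ B : Finset (Fin ((Γ n).d + 1)),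
      (∀ i ∉ B, (Γ n).GoodRow α N i) ∧ B.card ≤ ε * (Γ n).d)
    {ν : ℝ} (hν : 0 < ν)
    (hwin : ∀ᶠ n in 𝒰, ∃ l : ℕ, ν * (Γ n).d ≤ l ∧ (Γ n).Window s l (Real.sqrt N) α)
    {P : Polynomial ℝ}
    (hP : ∀ᶠ n in 𝒰, ∀ x, (Γ n).E s (Real.sqrt N) α x = P.eval ((x - α) / Real.sqrt N)) :
    ∃ u : ℝ, u ≠ 0 ∧ P = Polynomial.C u * arcsineWeight := by
  set C : ℝ := 2 * (1 + 4 * k) / ν with hC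
  have hC0 : 0 < C := by positivity
  have hdr : Tendsto (fun n => ((Γ n).d : ℝ)) 𝒰 atTop := tendsto_natCast_atTop_atTop.comp hd
  have main : ∀ g : Polynomial ℝ, ∀ δ : ℝ, 0 < δ → ∃ κ : ℝ,
      |arcsineMean (arcsineWeight * 1) - κ * arcsineMean (P * 1)| ≤ δ ∧
      |arcsineMean (arcsineWeight * g) - κ * arcsineMean (P * g)| ≤ δ := by
    intro g δ hδ
    obtain ⟨Cg, hCg0, hCg⟩ := g.exists_bound_abs_eval (4 * k)
    set D := max Cg 1 with hD
    have hD1 : 1 ≤ D := le_max_right _ _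
    set K := 2 * C * D / δ with hK
    have hK0 : 0 < K := by positivity
    set ε := δ / (2 * K) with hε
    have hε0 : 0 < ε := by positivity
    have hfin : C * D / K + K * ε = δ := by rw [hε, hK]; field_simp; ring
    obtain ⟨ε1, hε1, d1, h1⟩ := exists_equidistribution k hk (P * 1) ε hε0
    obtain ⟨ε2, hε2, d2, h2⟩ := exists_equidistribution k hk (P * g) ε hε0
    obtain ⟨M1, hM1⟩ := exists_sum_w_mul_E 1
    obtain ⟨M2, hM2⟩ := exists_sum_w_mul_E g
    obtain ⟨n, hn1, hn2, hn3, hn4, hn5, hn6, hn7, hn8⟩ := ((hd.eventually_ge_atTop d1).and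
      ((hd.eventually_ge_atTop d2).and ((hdr.eventually_ge_atTop (M1 / ν)).and
      ((hdr.eventually_ge_atTop (M2 / ν)).and ((hbad ε1 hε1).and ((hbad ε2 hε2).and
      (hwin.and hP))))))).exists
    obtain ⟨l, hl, hw⟩ := hn7
    obtain ⟨B1, hB1, hB1c⟩ := hn5
    obtain ⟨B2, hB2, hB2c⟩ := hn6
    have hdn : (0 : ℝ) < (Γ n).d := by
      exact_mod_cast (by have := (Γ n).two_le; omega : 0 < (Γ n).d)
    rw [div_le_iff₀ hν] at hn3 hn4
    have hl1 : M1 ≤ l := by exact_mod_cast hn3.trans (le_trans (by rw [mul_comm]) hl)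
    have hl2 : M2 ≤ l := by exact_mod_cast hn4.trans (le_trans (by rw [mul_comm]) hl)
    have hwE : ∀ j, (Γ n).w j * |(Γ n).E s (Real.sqrt N) α ((Γ n).θ j)| ≤ C / (Γ n).d := by
      intro j
      have h3 := hw.w_mul_abs_E_le j
      rw [hC, div_div, le_div_iff₀ (by positivity), mul_comm]
      exact (mul_le_mul_of_nonneg_right hl (mul_nonneg ((Γ n).w_pos j).le (abs_nonneg _))).trans h3
    refine ⟨∑ j, min ((Γ n).w j) (K / (Γ n).d), ?_, ?_⟩
    · rw [← hfin]
      refine abs_sum_sub_truncated_le α N s hK0 hC0.le (zero_le_one.trans hD1)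
        (fun j => hn8 _) hwE (fun j => ?_) (hM1 k (Γ n) s l _ _ hw hl1)
        (h1 (Γ n) hn1 α N hα hN hNk B1 hB1 hB1c)
      simpa using hD1
    · rw [← hfin]
      refine abs_sum_sub_truncated_le α N s hK0 hC0.le (zero_le_one.trans hD1)
        (fun j => hn8 _) hwE (fun j => ?_) (hM2 k (Γ n) s l _ _ hw hl2)
        (h2 (Γ n) hn2 α N hα hN hNk B2 hB2 hB2c)
      exact (hCg _ ((Γ n).abs_η_le hα hN j)).trans (le_max_left _ _)
  set u := arcsineMean P with hu
  have h1 : arcsineMean (arcsineWeight * 1) = 1 := by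
    have h2 := arcsineMean_arcsineWeight_mul_C 0
    have h3 : arcsineWeight * Polynomial.Chebyshev.C ℝ (0 : ℕ) =
        Polynomial.C 2 * (arcsineWeight * 1) := by
      rw [Nat.cast_zero, Polynomial.Chebyshev.C_zero, mul_one, mul_comm]; rfl
    rw [h3, arcsineMean_C_mul] at h2
    norm_num at h2
    rw [mul_one]; exact h2
  rw [mul_one] at h1
  simp only [mul_one, h1, ← hu] at main
  have hu0 : u ≠ 0 := by
    intro h0
    obtain ⟨κ, hκ, -⟩ := main 1 (1 / 2) (by norm_num)
    rw [h0] at hκ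
    norm_num at hκ
  have h2 : ∀ g, arcsineMean (arcsineWeight * g) * u = arcsineMean (P * g) := by
    intro g
    by_contra hne
    set z := |u| + |arcsineMean (P * g)| with hz
    have hz0 : 0 < z := add_pos_of_pos_of_nonneg (abs_pos.2 hu0) (abs_nonneg _)
    have hx : 0 < |arcsineMean (arcsineWeight * g) * u - arcsineMean (P * g)| :=
      abs_pos.2 (sub_ne_zero.2 hne)
    set y := |arcsineMean (arcsineWeight * g) * u - arcsineMean (P * g)|
    obtain ⟨κ, hκ1, hκ2⟩ := main g (y / (2 * z)) (by positivity)
    have h3 := abs_mul_sub_le_of_approx hκ1 hκ2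
    rw [← hz] at h3
    have h4 : y / (2 * z) * z = y / 2 := by field_simp
    rw [h4] at h3
    change y ≤ y / 2 at h3
    linarith
  refine ⟨u, hu0, sub_eq_zero.1 (eq_zero_of_arcsineMean_mul_self ?_)⟩
  have h3 : ∀ g, arcsineMean ((P - Polynomial.C u * arcsineWeight) * g) = 0 := by
    intro g
    have e : (P - Polynomial.C u * arcsineWeight) * g =
        P * g + Polynomial.C (-u) * (arcsineWeight * g) := by
      rw [Polynomial.C_neg]; ring
    rw [e, arcsineMean_add, arcsineMean_C_mul, ← h2]; ring
  exact h3 _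

end IntArray

namespace IntArray

variable {k : ℕ} {Γ : IntArray k} {w l : ℕ} {r α : ℝ}

/-- The leading coefficient of the polynomial function `q i`. -/
noncomputable def lead (Γ : IntArray k) (i : ℕ) : ℝ := ∏ h ∈ Finset.range i, (Γ.r h)⁻¹

lemma lead_pos {i : ℕ} (hi : i ≤ Γ.d) : 0 < Γ.lead i :=
  Finset.prod_pos fun h hh => inv_pos.2 (Γ.r_pos (by rw [Finset.mem_range] at hh; omega))

lemma tendsto_linear_div (c : ℝ) : Tendsto (fun x : ℝ => (x - c) / x) atTop (nhds 1) := by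
  have h1 : Tendsto (fun x : ℝ => 1 - c * x⁻¹) atTop (nhds (1 - c * 0)) :=
    tendsto_const_nhds.sub (tendsto_inv_atTop_zero.const_mul c)
  rw [mul_zero, sub_zero] at h1
  refine h1.congr' ?_
  filter_upwards [eventually_gt_atTop 0] with x hx
  field_simp

lemma tendsto_q_div_pow (i : ℕ) : i ≤ Γ.d →
    Tendsto (fun x => Γ.q i x / x ^ i) atTop (nhds (Γ.lead i)) := by
  induction i using Nat.twoStepInduction with
  | zero => intro _; simp [q_zero, lead]
  | one =>
    intro hi
    have h0 := (Γ.r_pos (by omega : 0 < Γ.d)).ne'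
    refine (tendsto_const_nhds (x := Γ.lead 1)).congr' ?_
    filter_upwards [eventually_gt_atTop 0] with x hx
    have h1 := Γ.q_rec_zero x
    simp only [lead, Finset.prod_range_one, pow_one]
    rw [eq_div_iff hx.ne', inv_mul_eq_iff_eq_mul₀ h0, h1]
  | more i ih1 ih2 =>
    intro hi
    have h0 := (Γ.r_pos (by omega : i + 1 < Γ.d)).ne'
    have h1 := ((tendsto_linear_div (Γ.a (i + 1))).mul (ih2 (by omega))).sub
      (((ih1 (by omega)).const_mul (Γ.r i)).mul
        ((tendsto_inv_atTop_zero (𝕜 := ℝ)).mul tendsto_inv_atTop_zero))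
    have h2 := h1.const_mul (Γ.r (i + 1))⁻¹
    rw [show (Γ.r (i + 1))⁻¹ * (1 * Γ.lead (i + 1) - Γ.r i * Γ.lead i * (0 * 0)) =
      Γ.lead (i + 2) by simp only [lead]; rw [Finset.prod_range_succ _ (i + 1)]; ring] at h2
    refine h2.congr' ?_
    filter_upwards [eventually_gt_atTop 0] with x hx
    have h3 := Γ.q_rec_succ (i := i) (by omega) x
    field_simp
    linear_combination (-(x ^ 2 * x ^ (i + 1) * x ^ i)) * h3

lemma eq_of_tendsto_div_pow {f : ℝ → ℝ} {p p' : ℕ} {A B : ℝ} (hA : A ≠ 0) (hB : B ≠ 0)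
    (h1 : Tendsto (fun x => f x / x ^ p) atTop (nhds A))
    (h2 : Tendsto (fun x => f x / x ^ p') atTop (nhds B)) : p = p' := by
  have key : ∀ {p p' : ℕ} {A B : ℝ}, B ≠ 0 → Tendsto (fun x => f x / x ^ p) atTop (nhds A) →
      Tendsto (fun x => f x / x ^ p') atTop (nhds B) → ¬ p < p' := by
    intro p p' A B hB h1 h2 hlt
    have h3 := h1.mul ((tendsto_pow_atTop (by omega : p' - p ≠ 0)).inv_tendsto_atTop (𝕜 := ℝ))
    rw [mul_zero] at h3
    refine hB (tendsto_nhds_unique h2 (h3.congr' ?_))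
    filter_upwards [eventually_gt_atTop 0] with x hx
    obtain ⟨m, rfl⟩ : ∃ m, p' = p + m := ⟨p' - p, by omega⟩
    simp only [Pi.inv_apply, Nat.add_sub_cancel_left, pow_add]
    field_simp
  rcases lt_trichotomy p p' with h | h | h
  · exact (key hB h1 h2 h).elim
  · exact h
  · exact (key hA h2 h1 h).elim

lemma sq_mul_E {I : ℕ} (hI : I + 1 < Γ.d) (hr : Γ.r (I + 1) = r) (hr0 : r ≠ 0) (x : ℝ) :
    r ^ 2 * Γ.E (I + 1) r α x = r ^ 2 * Γ.q (I + 1) x ^ 2 +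
      ((x - Γ.a (I + 1)) * Γ.q (I + 1) x - Γ.r I * Γ.q I x) *
      ((α - Γ.a (I + 1)) * Γ.q (I + 1) x - Γ.r I * Γ.q I x) := by
  have h := Γ.q_rec_succ hI x
  rw [hr] at h
  rw [← h, E]
  have h2 : (α - Γ.a (I + 1)) * Γ.q (I + 1) x - Γ.r I * Γ.q I x =
      r * Γ.q (I + 2) x - (x - α) * Γ.q (I + 1) x := by rw [h]; ring
  rw [h2]
  field_simp
  ring

lemma tendsto_E_div_odd {I : ℕ} (hI : I + 1 < Γ.d) (hr : Γ.r (I + 1) = r) (hr0 : r ≠ 0) :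
    Tendsto (fun x => r ^ 2 * Γ.E (I + 1) r α x / x ^ (2 * I + 3)) atTop
      (nhds ((α - Γ.a (I + 1)) * Γ.lead (I + 1) ^ 2)) := by
  have h1 := tendsto_q_div_pow (Γ := Γ) (I + 1) (by omega)
  have h0 := tendsto_q_div_pow (Γ := Γ) I (by omega)
  have hi := tendsto_inv_atTop_zero (𝕜 := ℝ)
  have h2 := (((h1.mul h1).mul hi).const_mul (r ^ 2)).add
    ((((tendsto_linear_div (Γ.a (I + 1))).mul h1).sub ((h0.const_mul (Γ.r I)).mul (hi.mul hi))).mul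
      ((h1.const_mul (α - Γ.a (I + 1))).sub ((h0.const_mul (Γ.r I)).mul hi)))
  rw [show r ^ 2 * (Γ.lead (I + 1) * Γ.lead (I + 1) * 0) +
    (1 * Γ.lead (I + 1) - Γ.r I * Γ.lead I * (0 * 0)) * ((α - Γ.a (I + 1)) * Γ.lead (I + 1) -
      Γ.r I * Γ.lead I * 0) = (α - Γ.a (I + 1)) * Γ.lead (I + 1) ^ 2 by ring] at h2
  refine h2.congr' ?_
  filter_upwards [eventually_gt_atTop 0] with x hx
  rw [sq_mul_E hI hr hr0]
  field_simp
  ring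

lemma tendsto_E_div_even {I : ℕ} (hI : I + 1 < Γ.d) (hr : Γ.r (I + 1) = r) (hr0 : r ≠ 0)
    (hα : (Γ.a (I + 1) : ℝ) = α) :
    Tendsto (fun x => r ^ 2 * Γ.E (I + 1) r α x / x ^ (2 * I + 2)) atTop
      (nhds ((r ^ 2 - Γ.r I ^ 2) * Γ.lead (I + 1) ^ 2)) := by
  have h1 := tendsto_q_div_pow (Γ := Γ) (I + 1) (by omega)
  have h0 := tendsto_q_div_pow (Γ := Γ) I (by omega)
  have hi := tendsto_inv_atTop_zero (𝕜 := ℝ)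
  have h2 := ((h1.mul h1).const_mul (r ^ 2)).add
    ((((tendsto_linear_div (Γ.a (I + 1))).mul h1).sub ((h0.const_mul (Γ.r I)).mul (hi.mul hi))).mul
      (h0.const_mul (-Γ.r I)))
  have hl : Γ.lead I = Γ.r I * Γ.lead (I + 1) := by
    rw [lead, lead, Finset.prod_range_succ]
    have := (Γ.r_pos (by omega : I < Γ.d)).ne'
    field_simp
  rw [show r ^ 2 * (Γ.lead (I + 1) * Γ.lead (I + 1)) +
    (1 * Γ.lead (I + 1) - Γ.r I * Γ.lead I * (0 * 0)) * (-Γ.r I * Γ.lead I) =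
      (r ^ 2 - Γ.r I ^ 2) * Γ.lead (I + 1) ^ 2 by rw [hl]; ring] at h2
  refine h2.congr' ?_
  filter_upwards [eventually_gt_atTop 0] with x hx
  rw [sq_mul_E hI hr hr0, hα]
  field_simp
  ring

lemma tendsto_arcsine_div {r u α : ℝ} (hr : r ≠ 0) :
    Tendsto (fun x => r ^ 2 * (u * (2 - ((x - α) / r) ^ 2 / 2)) / x ^ 2) atTop
      (nhds (- (r ^ 2 * u / r ^ 2 / 2))) := by
  have hi := tendsto_inv_atTop_zero (𝕜 := ℝ)
  have h1 := tendsto_linear_div α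
  have h2 := ((hi.mul hi).const_mul (r ^ 2 * u * 2)).sub ((h1.mul h1).const_mul (r ^ 2 * u / r ^ 2 / 2))
  rw [show r ^ 2 * u * 2 * (0 * 0) - r ^ 2 * u / r ^ 2 / 2 * (1 * 1) = - (r ^ 2 * u / r ^ 2 / 2) by
    ring] at h2
  refine h2.congr' ?_
  filter_upwards [eventually_gt_atTop 0] with x hx
  field_simp

lemma k_eq_of_arcsine {k R u α : ℝ} (hk : k ≠ 0) (hR : R ≠ 0)
    (h : ∀ x, x ^ 2 / k - (x - α) * x / R + k / R = u * (2 - (x - α) ^ 2 / R / 2)) :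
    α = 0 ∧ k = 2 * R := by
  have h0 := h 0
  have h1 := h 1
  have h2 := h (-1)
  field_simp at h0 h1 h2
  have e0 : 2 * k = u * (4 * R - α ^ 2) :=
    mul_left_cancel₀ hk (by linear_combination h0)
  have e1 : α = u * α := by
    have : k * (α - u * α) = 0 := by linarith
    rcases mul_eq_zero.1 this with h | h
    · exact (hk h).elim
    · linarith
  have e2 : 2 * (R - k) = - u * k := by
    linarith
  have key : α = 0 := by
    by_contra hα
    have hu : u = 1 := by
      have : (u - 1) * α = 0 := by linarith
      rcases mul_eq_zero.1 this with h | h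
      · linarith
      · exact (hα h).elim
    rw [hu] at e0 e2
    apply hα
    have : α ^ 2 = 0 := by linarith
    exact pow_eq_zero_iff two_ne_zero |>.1 this
  refine ⟨key, ?_⟩
  rw [key] at e0
  have : (k - 2 * R) ^ 2 = 0 := by
    have e3 : 2 * (R - k) * (2 * R) = - k * k := by
      rw [e2]; linear_combination k * e0 / 2
    linear_combination e3
  have := pow_eq_zero_iff two_ne_zero |>.1 this
  linarith

/-- The invariant form of a window cannot be the one of the arcsine law. -/
theorem Window.E_ne_arcsine (hk : 3 ≤ k) {s : ℕ} (hl : 2 ≤ l) (h : Γ.Window s l r α) {u : ℝ}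
    (hu : u ≠ 0) : ¬ ∀ x, Γ.E s r α x = u * (2 - ((x - α) / r) ^ 2 / 2) := by
  induction s generalizing l with
  | zero =>
    intro hE
    have hr := h.one_le
    have h1 : ∀ x, Γ.q 1 x = x / r := by
      intro x
      have h2 := Γ.q_rec_zero x
      rw [h.r_eq 0 le_rfl (by omega)] at h2
      rw [eq_div_iff (by linarith), mul_comm]; exact h2
    have e0 := hE α
    have e1 := hE (α + r)
    have e2 := hE (α - r)
    have hr0 : r ≠ 0 := by linarith
    simp only [E, q_zero, h1] at e0 e1 e2
    apply hu
    field_simp at e0 e1 e2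
    have : r ^ 2 * u = 0 := by nlinarith
    rcases mul_eq_zero.1 this with h | h
    · exact (pow_ne_zero 2 hr0 h).elim
    · exact h
  | succ I ih =>
    intro hE
    have hr := h.one_le
    have hr0 : r ≠ 0 := by linarith
    have hle := h.le
    have hr1 := h.r_eq (I + 1) le_rfl (by omega)
    have hlead := (Γ.lead_pos (by omega : I + 1 ≤ Γ.d)).ne'
    have hT := tendsto_arcsine_div (u := u) (α := α) hr0
    simp only [← hE] at hT
    have hu2 : - (r ^ 2 * u / r ^ 2 / 2) ≠ 0 := by
      rw [neg_ne_zero, mul_div_cancel_left₀ _ (pow_ne_zero 2 hr0)]; exact div_ne_zero hu two_ne_zero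
    by_cases ha : (Γ.a (I + 1) : ℝ) = α
    · by_cases hρ : Γ.r I = r
      · have hw : Γ.Window I (l + 1) r α := by
          refine ⟨by omega, fun i h1 h2 => ?_, fun i h1 h2 => ?_, h.one_le, h.abs_le⟩
          · rcases h1.eq_or_lt with rfl | h1
            · exact hρ
            · exact h.r_eq i h1 (by omega)
          · rcases (Nat.succ_le_of_lt h1).eq_or_lt with rfl | h1
            · exact ha
            · exact h.a_eq i h1 (by omega)
        refine ih (by omega) hw fun x => ?_
        rw [← hE, ← hw.E_eq x (t := 1) (by omega)]
      · have h1 := tendsto_E_div_even (by omega) hr1 hr0 ha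
        have hne : (r ^ 2 - Γ.r I ^ 2) * Γ.lead (I + 1) ^ 2 ≠ 0 := by
          refine mul_ne_zero (fun h0 => hρ ?_) (pow_ne_zero 2 hlead)
          exact (pow_left_inj₀ (Γ.r_nonneg I) (by linarith) two_ne_zero).1 (by linarith)
        have h2 := eq_of_tendsto_div_pow hne hu2 h1 hT
        obtain rfl : I = 0 := by omega
        have hsq : Γ.r 0 ^ 2 = k := by rw [Γ.r_sq, Γ.b0, Γ.c1]; simp
        have hr00 := (Γ.r_pos (by omega : 0 < Γ.d)).ne'
        have hk0 : (k : ℝ) ≠ 0 := by rw [← hsq]; exact pow_ne_zero 2 hr00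
        obtain ⟨hα, hk2⟩ := k_eq_of_arcsine (k := k) (R := r ^ 2) (u := u) (α := α) hk0
          (pow_ne_zero 2 hr0) fun x => by
            have h3 := sq_mul_E (α := α) (by omega) hr1 hr0 x
            have h4 : Γ.q 1 x = x / Γ.r 0 := by
              rw [eq_div_iff hr00, mul_comm]; exact Γ.q_rec_zero x
            simp only [zero_add] at h3 hE ha
            rw [hE, ha, q_zero, h4, sub_self, zero_mul, zero_sub, mul_one] at h3
            rw [← hsq]
            field_simp at h3 ⊢
            linear_combination -h3
        have h3 := Γ.r_sq 1
        have h4 := Γ.sum_eq 1 (by omega)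
        have h5 := Γ.cpos 2 (by omega) (by omega)
        have h6 : Γ.a 1 = 0 := by rw [hα] at ha; exact_mod_cast ha
        simp only [zero_add] at hr1
        rw [hr1] at h3
        rw [h3] at hk2
        have h7 : k = 2 * (Γ.b 1 * Γ.c 2) := by exact_mod_cast hk2
        have := Γ.c1
        nlinarith
    · have h1 := tendsto_E_div_odd (α := α) (by omega) hr1 hr0
      have hne : (α - Γ.a (I + 1)) * Γ.lead (I + 1) ^ 2 ≠ 0 :=
        mul_ne_zero (sub_ne_zero.2 (Ne.symm ha)) (pow_ne_zero 2 hlead)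
      have h2 := eq_of_tendsto_div_pow hne hu2 h1 hT
      omega

end IntArray

lemma exists_interior_margin {x0 x1 α r : ℝ} (hr : 0 < r) (h0 : α - 2 * r < x0) (h1 : x1 < α + 2 * r) :
    ∃ κ : ℝ, 0 < κ ∧ ∀ x ∈ Set.Icc x0 x1, |x - α| ≤ (2 - κ) * r := by
  refine ⟨min (x0 - (α - 2 * r)) (α + 2 * r - x1) / r,
    div_pos (lt_min (by linarith) (by linarith)) hr, fun x hx => ?_⟩
  rw [sub_mul, div_mul_cancel₀ _ hr.ne']
  have h2 := min_le_left (x0 - (α - 2 * r)) (α + 2 * r - x1)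
  have h3 := min_le_right (x0 - (α - 2 * r)) (α + 2 * r - x1)
  rw [abs_le]
  constructor <;> linarith [hx.1, hx.2]

lemma zone_endpoints {k β γ : ℕ} (h : β + γ ≤ k) :
    ((k - β - γ : ℕ) : ℝ) + 2 * Real.sqrt ((β * γ : ℕ) : ℝ) =
      k - (Real.sqrt β - Real.sqrt γ) ^ 2 ∧
    ((k - β - γ : ℕ) : ℝ) - 2 * Real.sqrt ((β * γ : ℕ) : ℝ) =
      k - (Real.sqrt β + Real.sqrt γ) ^ 2 := by
  have h1 : ((k - β - γ : ℕ) : ℝ) = k - β - γ := by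
    rw [Nat.cast_sub (by omega), Nat.cast_sub (by omega)]
  have h2 : Real.sqrt ((β * γ : ℕ) : ℝ) = Real.sqrt β * Real.sqrt γ := by
    rw [Nat.cast_mul, Real.sqrt_mul (Nat.cast_nonneg _)]
  have h3 := Real.sq_sqrt (Nat.cast_nonneg (α := ℝ) β)
  have h4 := Real.sq_sqrt (Nat.cast_nonneg (α := ℝ) γ)
  rw [h1, h2]
  constructor <;> linear_combination h3 + h4

namespace IntArray

lemma Window.of_const {k : ℕ} {Γ : IntArray k} {w l β γ : ℕ} (hle : w + l ≤ Γ.d) (hβ : 1 ≤ β)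
    (hγ : 1 ≤ γ) (h : ∀ i, w ≤ i → i ≤ w + l → Γ.b i = β ∧ Γ.c i = γ) :
    Γ.Window w l (Real.sqrt ((β * γ : ℕ) : ℝ)) ((k - β - γ : ℕ) : ℝ) := by
  refine ⟨hle, fun i h1 h2 => ?_, fun i h1 h2 => ?_, ?_, ?_⟩
  · rw [r, (h i h1 (by omega)).1, (h (i + 1) (by omega) (by omega)).2, Nat.cast_mul]
  · have h3 := Γ.sum_eq i (by omega)
    rw [(h i (by omega) (by omega)).1, (h i (by omega) (by omega)).2] at h3
    exact_mod_cast (by omega : Γ.a i = k - β - γ)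
  · rw [Real.one_le_sqrt]
    exact_mod_cast Nat.one_le_iff_ne_zero.2 (by positivity)
  · rw [abs_of_nonneg (by positivity)]
    exact_mod_cast (by omega : k - β - γ ≤ k)

variable {k : ℕ} {𝒰 : Filter ℕ} [NeBot 𝒰] {Γ : ℕ → IntArray k}

/-- A long constant part cannot be preceded by arbitrarily many rows of a different kind. -/
theorem false_of_long_initial (hk : 1 ≤ k) (hd : Tendsto (fun n => (Γ n).d) 𝒰 atTop)
    {β0 γ0 β' γ' : ℕ} (h1 : 1 ≤ γ') (h2 : γ' ≤ γ0) (h3 : γ0 ≤ β0) (h4 : β0 ≤ β')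
    (hne : ¬ (β' = β0 ∧ γ' = γ0)) (hsum : β0 + γ0 ≤ k) {ν : ℝ} (hν : 0 < ν)
    (hwin : ∀ s0 : ℕ, ∀ᶠ n in 𝒰, ∃ s l : ℕ, s0 ≤ s ∧ (Γ n).b s = β' ∧ (Γ n).c s = γ' ∧
      (Γ n).Window (s + 1) l (Real.sqrt ((β0 * γ0 : ℕ) : ℝ)) ((k - β0 - γ0 : ℕ) : ℝ) ∧
      ν * (Γ n).d ≤ l) : False := by
  set P := Real.sqrt β0 with hP
  set Q := Real.sqrt γ0 with hQ
  set p := Real.sqrt β' with hp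
  set q := Real.sqrt γ' with hq
  have hq0 : 0 < q := Real.sqrt_pos.2 (by exact_mod_cast h1)
  have hqQ : q ≤ Q := Real.sqrt_le_sqrt (by exact_mod_cast h2)
  have hQP : Q ≤ P := Real.sqrt_le_sqrt (by exact_mod_cast h3)
  have hPp : P ≤ p := Real.sqrt_le_sqrt (by exact_mod_cast h4)
  have hlt : P - Q < p - q := by
    by_contra hcon
    apply hne
    have e1 : p = P := by linarith
    have e2 : q = Q := by linarith
    rw [hp, hP, Real.sqrt_inj (by positivity) (by positivity)] at e1
    rw [hq, hQ, Real.sqrt_inj (by positivity) (by positivity)] at e2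
    exact ⟨by exact_mod_cast e1, by exact_mod_cast e2⟩
  obtain ⟨hz1, hz2⟩ := zone_endpoints hsum
  set r := Real.sqrt ((β0 * γ0 : ℕ) : ℝ) with hr
  set α := ((k - β0 - γ0 : ℕ) : ℝ) with hα
  rw [← hP, ← hQ] at hz1 hz2
  have hr0 : 0 < r := Real.sqrt_pos.2 (by
    exact_mod_cast Nat.mul_pos (by omega : 0 < β0) (by omega : 0 < γ0))
  set lo := max (k - (p - q) ^ 2) (k - (P + Q) ^ 2) with hlo
  set hi := (k : ℝ) - (P - Q) ^ 2 with hhi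
  have hlohi : lo < hi := by
    refine max_lt ?_ ?_
    · have : (P - Q) ^ 2 < (p - q) ^ 2 := pow_lt_pow_left₀ hlt (by linarith) two_ne_zero
      linarith
    · rw [hhi]
      have : 0 < P * Q := mul_pos (by linarith) (by linarith)
      linarith [sub_sq P Q, add_sq P Q]
  have hlo1 : k - (p - q) ^ 2 ≤ lo := le_max_left _ _
  have hlo2 : k - (P + Q) ^ 2 ≤ lo := le_max_right _ _
  obtain ⟨x0, hx0, hx0'⟩ := exists_between hlohi
  obtain ⟨x1, hx1, hx1'⟩ := exists_between hx0'
  obtain ⟨κ, hκ, hI⟩ := exists_interior_margin (x0 := x0) (x1 := x1) (α := α) hr0 (by linarith)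
    (by linarith)
  obtain ⟨η0, L, d0, hη, hnot⟩ := exists_not_separated k hk hr0 hx1 hκ hI hν
  obtain ⟨s0, hs0⟩ := exists_separated_initial k hk L hη
  obtain ⟨n, ⟨s, l, hs, hb, hc, hw, hl⟩, hdn⟩ := ((hwin s0).and (hd.eventually_ge_atTop d0)).exists
  refine hnot (Γ n) (s + 1) l hdn hw hl fun x hx y hy hxy => ?_
  have hl0 : 0 < l := by
    have : 0 < (Γ n).d := by have := (Γ n).two_le; omega
    have : (0 : ℝ) < ν * (Γ n).d := by positivity
    exact_mod_cast this.trans_le hl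
  refine hs0 (Γ n) s β' γ' hs (by have := hw.le; omega) (by exact_mod_cast h1)
    (by exact_mod_cast (h2.trans h3).trans h4) (by rw [hb]) (by rw [hc]) x y ?_ ?_ hxy
  · linarith [hx.1]
  · linarith [hy.2, sq_nonneg (P - Q)]

/-- Two long constant parts that are almost adjacent cannot have strictly nested outer edges. -/
theorem false_of_split (hk : 1 ≤ k) (hd : Tendsto (fun n => (Γ n).d) 𝒰 atTop)
    {β0 γ0 β γ s : ℕ} (hsum0 : β0 + γ0 ≤ k) (hβ : 1 ≤ β) (hγ : 1 ≤ γ)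
    (hsum : β + γ ≤ k) (hlt : |Real.sqrt β - Real.sqrt γ| < Real.sqrt β0 - Real.sqrt γ0)
    {pE pA : Polynomial ℝ}
    (hE : ∀ᶠ n in 𝒰, ∀ x, (Γ n).E s (Real.sqrt ((β0 * γ0 : ℕ) : ℝ)) ((k - β0 - γ0 : ℕ) : ℝ) x =
      pE.eval x)
    (hA : ∀ᶠ n in 𝒰, ∀ x, (Γ n).A s x = pA.eval x) {ν : ℝ} (hν : 0 < ν)
    (hwin : ∀ N : ℕ, ∀ᶠ n in 𝒰, ∃ l w l' : ℕ,
      (Γ n).Window s l (Real.sqrt ((β0 * γ0 : ℕ) : ℝ)) ((k - β0 - γ0 : ℕ) : ℝ) ∧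
      (Γ n).Window w l' (Real.sqrt ((β * γ : ℕ) : ℝ)) ((k - β - γ : ℕ) : ℝ) ∧
      ν * (Γ n).d ≤ l ∧ ν * (Γ n).d ≤ l' ∧ s + l ≤ w ∧ N * (w - s - l + 1) + 1 ≤ l) : False := by
  have hdr : Tendsto (fun n => ((Γ n).d : ℝ)) 𝒰 atTop := tendsto_natCast_atTop_atTop.comp hd
  obtain ⟨hz1, hz2⟩ := zone_endpoints hsum
  obtain ⟨hy1, hy2⟩ := zone_endpoints hsum0
  set r0 := Real.sqrt ((β0 * γ0 : ℕ) : ℝ) with hr0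
  set α0 := ((k - β0 - γ0 : ℕ) : ℝ) with hα0
  set r := Real.sqrt ((β * γ : ℕ) : ℝ) with hr
  set α := ((k - β - γ : ℕ) : ℝ) with hα
  have hβs := Real.sq_sqrt (Nat.cast_nonneg (α := ℝ) β)
  have hγs := Real.sq_sqrt (Nat.cast_nonneg (α := ℝ) γ)
  set P := Real.sqrt β0 with hP
  set Q := Real.sqrt γ0 with hQ
  set p := Real.sqrt β with hp
  set q := Real.sqrt γ with hq
  have hp0 : 0 < p := Real.sqrt_pos.2 (by exact_mod_cast hβ)
  have hq0 : 0 < q := Real.sqrt_pos.2 (by exact_mod_cast hγ)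
  have hr_pos : 0 < r := Real.sqrt_pos.2 (by exact_mod_cast Nat.mul_pos hβ hγ)
  set lo := max (k - (P - Q) ^ 2) (k - (p + q) ^ 2) with hlo
  set hi := (k : ℝ) - (p - q) ^ 2 with hhi
  have hlohi : lo < hi := by
    refine max_lt ?_ ?_
    · have : |p - q| ^ 2 < (P - Q) ^ 2 := pow_lt_pow_left₀ hlt (abs_nonneg _) two_ne_zero
      rw [sq_abs] at this
      linarith
    · rw [hhi]
      have : 0 < p * q := mul_pos hp0 hq0
      linarith [sub_sq p q, add_sq p q]
  have hlo1 : k - (P - Q) ^ 2 ≤ lo := le_max_left _ _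
  have hlo2 : k - (p + q) ^ 2 ≤ lo := le_max_right _ _
  have hpE : pE ≠ 0 := by
    rintro rfl
    obtain ⟨M, hM⟩ := exists_sum_w_mul_E 1
    obtain ⟨n, hn1, ⟨l, w, l', hw, -, hl, -⟩, hn3⟩ := (hE.and ((hwin 0).and
      (hdr.eventually_ge_atTop (M / ν)))).exists
    rw [div_le_iff₀ hν] at hn3
    have h1 := hM k (Γ n) s l _ _ hw (by exact_mod_cast hn3.trans (le_trans (by rw [mul_comm]) hl))
    simp only [hn1, Polynomial.eval_zero, zero_mul, mul_zero, Finset.sum_const_zero] at h1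
    have h2 := arcsineMean_arcsineWeight_mul_C 0
    have h3 : arcsineWeight * Polynomial.Chebyshev.C ℝ (0 : ℕ) =
        Polynomial.C 2 * (arcsineWeight * 1) := by
      rw [Nat.cast_zero, Polynomial.Chebyshev.C_zero, mul_one, mul_comm]; rfl
    rw [h3, arcsineMean_C_mul, ← h1] at h2
    norm_num at h2
  obtain ⟨z, hz, hze⟩ : ∃ z ∈ Set.Ioo lo hi, pE.eval z ≠ 0 := by
    by_contra hcon
    push Not at hcon
    exact hpE (Polynomial.eq_zero_of_infinite_isRoot pE ((Set.Ioo_infinite hlohi).mono hcon))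
  set e0 := |pE.eval z| / 2 with he0
  have he00 : 0 < e0 := by have := abs_pos.2 hze; positivity
  have hopen : IsOpen (Set.Ioo lo hi ∩ {x | e0 < |pE.eval x|}) :=
    isOpen_Ioo.inter (isOpen_lt continuous_const pE.continuous.abs)
  obtain ⟨ε, hε, hball⟩ := Metric.isOpen_iff.1 hopen z ⟨hz, by
    have := abs_pos.2 hze
    change e0 < |pE.eval z|
    rw [he0]; linarith⟩
  set x0 := z - ε / 2 with hx0
  set x1 := z + ε / 2 with hx1
  have hI0 : ∀ x ∈ Set.Icc x0 x1, (lo < x ∧ x < hi) ∧ e0 < |pE.eval x| := by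
    intro x hx
    refine hball ?_
    rw [Metric.mem_ball, Real.dist_eq, _root_.abs_lt]
    constructor <;> linarith [hx.1, hx.2]
  have hx01 : x0 < x1 := by linarith
  have hx0m := hI0 x0 ⟨le_rfl, hx01.le⟩
  have hx1m := hI0 x1 ⟨hx01.le, le_rfl⟩
  obtain ⟨κ, hκ, hI⟩ := exists_interior_margin (x0 := x0) (x1 := x1) (α := α) hr_pos
    (by linarith [hx0m.1.1]) (by linarith [hx1m.1.2])
  obtain ⟨η0, L, d0, hη, hnot⟩ := exists_not_separated k hk hr_pos hx01 hκ hI hν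
  obtain ⟨n1, l1, w1, l1', hw1, -, hl1, -, -, -⟩ := (hwin 0).exists
  have hr01 : 1 ≤ r0 := hw1.one_le
  have hl1p : 0 < l1 := by
    have : 0 < (Γ n1).d := by have := (Γ n1).two_le; omega
    have : (0 : ℝ) < ν * (Γ n1).d := by positivity
    exact_mod_cast this.trans_le hl1
  have hr0k : r0 ≤ k := by
    rw [← hw1.r_eq s le_rfl (by omega)]
    exact (Γ n1).r_le (by have := hw1.le; omega)
  obtain ⟨C0, -, hC0⟩ := pA.exists_bound_abs_eval (|x0| + |x1|)
  have hk3 : (β : ℝ) + γ ≤ k := by exact_mod_cast hsum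
  obtain ⟨N, n0, hsep⟩ := exists_separated_outer (C0 := C0) (κ := (x0 - (α0 + 2 * r0)) / r0)
    (x0 := x0) (x1 := x1) k hk L hr01 hr0k hw1.abs_le
    (div_pos (by linarith [hx0m.1.1]) (by linarith))
    (by linarith [hx0m.1.1, sq_nonneg (p - q), add_sq p q, sub_sq p q])
    (by have : (0 : ℝ) ≤ k := Nat.cast_nonneg _
        linarith [hx1m.1.2, sq_nonneg (p - q)])
    (fun x hx => by
      rw [le_div_iff₀ (by linarith), add_mul, div_mul_cancel₀ _ (by linarith : r0 ≠ 0)]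
      linarith [hx.1]) he00 hη
  obtain ⟨n, ⟨l, w, l', hw, hw', hl, hl', hsw, hNl⟩, hn1, hn2, hn3, hn4⟩ := ((hwin N).and
    (hE.and (hA.and ((hd.eventually_ge_atTop d0).and
    (hdr.eventually_ge_atTop ((n0 + 1) / ν)))))).exists
  rw [div_le_iff₀ hν] at hn4
  have hl0 : n0 + 1 ≤ l := by exact_mod_cast hn4.trans (le_trans (by rw [mul_comm]) hl)
  have hl'0 : 0 < l' := by
    have : 0 < (Γ n).d := by have := (Γ n).two_le; omega
    have : (0 : ℝ) < ν * (Γ n).d := by positivity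
    exact_mod_cast this.trans_le hl'
  refine hnot (Γ n) w l' hn3 hw' hl' fun x hx y hy hxy => ?_
  have h1 := hsep (Γ n) s l hw (fun x hx => by
      have := hn1 x
      rw [E] at this
      rw [this]
      exact (hI0 x hx).2.le)
    (fun x hx => by
      rw [hn2]
      refine (le_abs_self _).trans (hC0 x ?_)
      rw [_root_.abs_le]
      constructor
      · linarith [hx.1, neg_abs_le x0, abs_nonneg x1]
      · linarith [hx.2, le_abs_self x1, abs_nonneg x0])
    (l - 1) (w - s - l + 1) (by omega) (by omega) (by omega) (by have := hw'.le; omega) x hx y hy hxy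
  rwa [show s + (l - 1) + (w - s - l + 1) = w by omega] at h1

end IntArray

lemma Ultrafilter.exists_eventually_eq_of_le {ι : Type*} (𝒰 : Ultrafilter ι) {f : ι → ℕ} {k : ℕ}
    (h : ∀ᶠ n in (𝒰 : Filter ι), f n ≤ k) : ∃ v, ∀ᶠ n in (𝒰 : Filter ι), f n = v := by
  induction k with
  | zero => exact ⟨0, h.mono fun n hn => Nat.le_zero.1 hn⟩
  | succ k ih =>
    by_cases h1 : ∀ᶠ n in (𝒰 : Filter ι), f n = k + 1
    · exact ⟨_, h1⟩
    · apply ih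
      filter_upwards [h, Ultrafilter.eventually_not.2 h1] with n h2 h3
      omega

lemma Nat.floor_mul_natCast_le {y : ℝ} (hy : y ≤ 1) (d : ℕ) : ⌊y * d⌋₊ ≤ d := by
  have h : (0 : ℝ) ≤ d := Nat.cast_nonneg d
  exact Nat.floor_le_of_le (by nlinarith)

namespace IntArray

lemma eventually_mul_natCast_ge {k : ℕ} {𝒰 : Filter ℕ} {Γ : ℕ → IntArray k}
    (hd : Tendsto (fun n => (Γ n).d) 𝒰 atTop) {ν : ℝ} (hν : 0 < ν) (K : ℝ) :
    ∀ᶠ n in 𝒰, K ≤ ν * (Γ n).d := by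
  have h := (tendsto_natCast_atTop_atTop (R := ℝ)).comp hd
  filter_upwards [h.eventually_ge_atTop (K / ν)] with n hn
  rw [div_le_iff₀ hν] at hn
  simp only [Function.comp] at hn
  linarith

/-- The limiting shape of a sequence of intersection arrays whose diameters tend to infinity. -/
structure Profile {k : ℕ} (Γ : ℕ → IntArray k) (𝒰 : Filter ℕ) (B C : ℝ → ℕ) : Prop where
  anti : ∀ {y y' : ℝ}, 0 ≤ y → y ≤ y' → y' < 1 → B y' ≤ B y
  mono : ∀ {y y' : ℝ}, 0 ≤ y → y ≤ y' → y' < 1 → C y ≤ C y'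
  cb : ∀ {y y' : ℝ}, 0 ≤ y → 0 < y' → y < 1 → y' < 1 → y + y' ≤ 1 → C y ≤ B y'
  bpos : ∀ {y : ℝ}, 0 ≤ y → y < 1 → 1 ≤ B y
  cpos : ∀ {y : ℝ}, 0 < y → y < 1 → 1 ≤ C y
  add_le : ∀ {y : ℝ}, 0 ≤ y → y < 1 → B y + C y ≤ k
  eventually_eq : ∀ {y : ℝ}, 0 ≤ y → y < 1 → ∀ᶠ n in 𝒰,
    (Γ n).b ⌊y * (Γ n).d⌋₊ = B y ∧ (Γ n).c ⌊y * (Γ n).d⌋₊ = C y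

lemma exists_profile {k : ℕ} {Γ : ℕ → IntArray k} (𝒰 : Ultrafilter ℕ)
    (hd : Tendsto (fun n => (Γ n).d) (𝒰 : Filter ℕ) atTop) :
    ∃ B C : ℝ → ℕ, Profile Γ 𝒰 B C := by
  have hb : ∀ y : ℝ, ∃ v, y < 1 → ∀ᶠ n in (𝒰 : Filter ℕ), (Γ n).b ⌊y * (Γ n).d⌋₊ = v := by
    intro y
    by_cases hy : y < 1
    · obtain ⟨v, hv⟩ := 𝒰.exists_eventually_eq_of_le (k := k)
        (f := fun n => (Γ n).b ⌊y * (Γ n).d⌋₊) (Eventually.of_forall fun n => by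
          have := (Γ n).sum_eq _ (Nat.floor_mul_natCast_le hy.le (Γ n).d)
          omega)
      exact ⟨v, fun _ => hv⟩
    · exact ⟨0, fun h => absurd h hy⟩
  have hc : ∀ y : ℝ, ∃ v, y < 1 → ∀ᶠ n in (𝒰 : Filter ℕ), (Γ n).c ⌊y * (Γ n).d⌋₊ = v := by
    intro y
    by_cases hy : y < 1
    · obtain ⟨v, hv⟩ := 𝒰.exists_eventually_eq_of_le (k := k)
        (f := fun n => (Γ n).c ⌊y * (Γ n).d⌋₊) (Eventually.of_forall fun n => by
          have := (Γ n).sum_eq _ (Nat.floor_mul_natCast_le hy.le (Γ n).d)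
          omega)
      exact ⟨v, fun _ => hv⟩
    · exact ⟨0, fun h => absurd h hy⟩
  choose B hB using hb
  choose C hC using hc
  have hfl : ∀ {y y' : ℝ}, y ≤ y' → ∀ d : ℕ, ⌊y * d⌋₊ ≤ ⌊y' * d⌋₊ := fun h d => by
    gcongr
  refine ⟨B, C, ⟨fun {y y'} h0 h h1 => ?_, fun {y y'} h0 h h1 => ?_, fun {y y'} h0 h h1 h2 h3 => ?_,
    fun {y} h0 h1 => ?_, fun {y} h0 h1 => ?_, fun {y} h0 h1 => ?_,
    fun {y} h0 h1 => (hB y h1).and (hC y h1)⟩⟩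
  · obtain ⟨n, h4, h5⟩ := ((hB y (h.trans_lt h1)).and (hB y' h1)).exists
    rw [← h4, ← h5]
    exact (Γ n).banti _ _ (hfl h _) (Nat.floor_mul_natCast_le h1.le _)
  · obtain ⟨n, h4, h5⟩ := ((hC y (h.trans_lt h1)).and (hC y' h1)).exists
    rw [← h4, ← h5]
    exact (Γ n).cmono _ _ (hfl h _) (Nat.floor_mul_natCast_le h1.le _)
  · obtain ⟨n, h4, h5⟩ := ((hC y h1).and (hB y' h2)).exists
    rw [← h4, ← h5]
    refine (Γ n).cb _ _ ?_
    have hd0 : (0 : ℝ) ≤ (Γ n).d := Nat.cast_nonneg _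
    have e1 := Nat.floor_le (mul_nonneg h0 hd0)
    have e2 := Nat.floor_le (mul_nonneg h.le hd0)
    have e3 : ((⌊y * (Γ n).d⌋₊ + ⌊y' * (Γ n).d⌋₊ : ℕ) : ℝ) ≤ (Γ n).d := by
      push_cast
      nlinarith
    exact_mod_cast e3
  · obtain ⟨n, h4⟩ := (hB y h1).exists
    rw [← h4]
    refine (Γ n).bpos _ ?_
    have hd0 : (0 : ℝ) < (Γ n).d := by
      have := (Γ n).two_le
      exact_mod_cast (by omega : 0 < (Γ n).d)
    rw [Nat.floor_lt (mul_nonneg h0 hd0.le)]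
    nlinarith
  · obtain ⟨n, h4, h5⟩ := ((hC y h1).and (eventually_mul_natCast_ge hd h0 1)).exists
    rw [← h4]
    exact (Γ n).cpos _ (Nat.le_floor (by exact_mod_cast h5)) (Nat.floor_mul_natCast_le h1.le _)
  · obtain ⟨n, h4, h5⟩ := ((hC y h1).and (hB y h1)).exists
    rw [← h4, ← h5]
    have := (Γ n).sum_eq _ (Nat.floor_mul_natCast_le h1.le (Γ n).d)
    omega

namespace Profile

variable {k : ℕ} {Γ : ℕ → IntArray k} {𝒰 : Filter ℕ} {B C : ℝ → ℕ}

lemma eventually_const (h : Profile Γ 𝒰 B C) {y y' : ℝ} (h0 : 0 ≤ y) (hy : y ≤ y') (h1 : y' < 1)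
    {β γ : ℕ} (hB : B y = β) (hB' : B y' = β) (hC : C y = γ) (hC' : C y' = γ) :
    ∀ᶠ n in 𝒰, ∀ i, ⌊y * (Γ n).d⌋₊ ≤ i → i ≤ ⌊y' * (Γ n).d⌋₊ →
      (Γ n).b i = β ∧ (Γ n).c i = γ := by
  filter_upwards [h.eventually_eq h0 (hy.trans_lt h1), h.eventually_eq (h0.trans hy) h1]
    with n e1 e2 i hi1 hi2
  have hd := Nat.floor_mul_natCast_le h1.le (Γ n).d
  have := (Γ n).banti _ _ hi1 (hi2.trans hd)
  have := (Γ n).banti _ _ hi2 hd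
  have := (Γ n).cmono _ _ hi1 (hi2.trans hd)
  have := (Γ n).cmono _ _ hi2 hd
  omega

lemma exists_right_limit (h : Profile Γ 𝒰 B C) {u : ℝ} (h0 : 0 ≤ u) (h1 : u < 1) :
    ∃ y2, u < y2 ∧ y2 < 1 ∧ ∀ y, u < y → y ≤ y2 → B y = B y2 ∧ C y = C y2 := by
  let S : Set ℕ := {m | ∃ y, u < y ∧ y < 1 ∧ C y + (k - B y) = m}
  have hS : S.Nonempty := ⟨_, (u + 1) / 2, by linarith, by linarith, rfl⟩
  obtain ⟨y2, e1, e2, e3⟩ := Nat.sInf_mem hS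
  refine ⟨y2, e1, e2, fun y e4 e5 => ?_⟩
  have e6 : sInf S ≤ C y + (k - B y) := Nat.sInf_le ⟨y, e4, by linarith, rfl⟩
  have e7 := h.anti (by linarith) e5 e2
  have e8 := h.mono (by linarith) e5 e2
  have e9 := h.add_le (y := y) (by linarith) (by linarith)
  have e10 := h.add_le (y := y2) (by linarith) (by linarith)
  omega

end Profile

end IntArray

namespace IntArray

variable {k : ℕ}

lemma q_congr {Γ Γ' : IntArray k} {m : ℕ}
    (h : ∀ i ≤ m, Γ.a i = Γ'.a i ∧ Γ.b i = Γ'.b i ∧ Γ.c i = Γ'.c i) : Γ.q m = Γ'.q m := by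
  have hP : ∀ i, i ≤ m → arrP Γ.a Γ.b Γ.c i = arrP Γ'.a Γ'.b Γ'.c i := by
    intro i
    induction i using Nat.strong_induction_on with
    | _ i ih =>
      intro hi
      match i, ih, hi with
      | 0, _, _ => simp [arrP]
      | 1, _, _ => simp [arrP]
      | i + 2, ih, hi =>
        rw [arrP, arrP, ih (i + 1) (by omega) (by omega), ih i (by omega) (by omega),
          (h (i + 2) hi).2.2, (h (i + 1) (by omega)).1, (h i (by omega)).2.1]
  have hK : arrK Γ.b Γ.c m = arrK Γ'.b Γ'.c m := by
    refine Finset.prod_congr rfl fun i hi => ?_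
    rw [Finset.mem_range] at hi
    rw [(h i hi.le).2.1, (h (i + 1) hi).2.2]
  funext x
  rw [q, q, hP m le_rfl, hK]

lemma exists_q_eq_eval (Γ : IntArray k) (i : ℕ) :
    ∃ p : Polynomial ℝ, ∀ x, Γ.q i x = p.eval x := by
  refine ⟨(arrP Γ.a Γ.b Γ.c i).map (algebraMap ℚ ℝ) *
    Polynomial.C (Real.sqrt (arrK Γ.b Γ.c i))⁻¹, fun x => ?_⟩
  simp [q, div_eq_mul_inv, Polynomial.aeval_def, Polynomial.eval_map]

lemma exists_prefix_polynomials {Γ : ℕ → IntArray k} (𝒰 : Ultrafilter ℕ)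
    (hd : Tendsto (fun n => (Γ n).d) (𝒰 : Filter ℕ) atTop) (s : ℕ) (r α : ℝ) :
    ∃ pE pA : Polynomial ℝ, ∀ᶠ n in (𝒰 : Filter ℕ), ∀ x,
      (Γ n).E s r α x = pE.eval x ∧ (Γ n).A s x = pA.eval x := by
  have hex : ∃ a b c : ℕ → ℕ, ∀ i, ∀ᶠ n in (𝒰 : Filter ℕ),
      (Γ n).a i = a i ∧ (Γ n).b i = b i ∧ (Γ n).c i = c i := by
    have hle : ∀ i, ∀ᶠ n in (𝒰 : Filter ℕ),
        (Γ n).a i ≤ k ∧ (Γ n).b i ≤ k ∧ (Γ n).c i ≤ k := by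
      intro i
      filter_upwards [hd.eventually_ge_atTop i] with n hn
      exact ⟨(Γ n).a_le hn, (Γ n).b_le hn, (Γ n).c_le hn⟩
    choose a ha using fun i => 𝒰.exists_eventually_eq_of_le ((hle i).mono fun n hn => hn.1)
    choose b hb using fun i => 𝒰.exists_eventually_eq_of_le ((hle i).mono fun n hn => hn.2.1)
    choose c hc using fun i => 𝒰.exists_eventually_eq_of_le ((hle i).mono fun n hn => hn.2.2)
    exact ⟨a, b, c, fun i => (ha i).and ((hb i).and (hc i))⟩
  obtain ⟨a, b, c, habc⟩ := hex
  have hall : ∀ᶠ n in (𝒰 : Filter ℕ), ∀ i ∈ Finset.range (s + 2),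
      (Γ n).a i = a i ∧ (Γ n).b i = b i ∧ (Γ n).c i = c i :=
    (Finset.eventually_all _).2 fun i _ => habc i
  obtain ⟨n0, h0⟩ := hall.exists
  obtain ⟨p0, hp0⟩ := (Γ n0).exists_q_eq_eval s
  obtain ⟨p1, hp1⟩ := (Γ n0).exists_q_eq_eval (s + 1)
  refine ⟨p0 ^ 2 - Polynomial.C r⁻¹ * (Polynomial.X - Polynomial.C α) * p0 * p1 + p1 ^ 2,
    p0 ^ 2 + p1 ^ 2, ?_⟩
  filter_upwards [hall] with n hn x
  have hq : ∀ m ≤ s + 1, (Γ n).q m x = (Γ n0).q m x := by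
    intro m hm
    rw [q_congr fun i hi => ?_]
    obtain ⟨e1, e2, e3⟩ := hn i (Finset.mem_range.2 (by omega))
    obtain ⟨e4, e5, e6⟩ := h0 i (Finset.mem_range.2 (by omega))
    exact ⟨e1.trans e4.symm, e2.trans e5.symm, e3.trans e6.symm⟩
  constructor
  · rw [E, hq s (by omega), hq (s + 1) le_rfl, hp0, hp1]
    simp only [Polynomial.eval_add, Polynomial.eval_sub, Polynomial.eval_mul, Polynomial.eval_pow,
      Polynomial.eval_C, Polynomial.eval_X]
    ring
  · rw [A, hq s (by omega), hq (s + 1) le_rfl, hp0, hp1]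
    simp

variable {Γ : ℕ → IntArray k} {𝒰 : Ultrafilter ℕ} {B C : ℝ → ℕ}

/-- The limiting shape cannot turn at `u` into a part other than the reversed initial part. -/
lemma Profile.false_of_turn (hp : Profile Γ 𝒰 B C) (hk : 1 ≤ k)
    (hd : Tendsto (fun n => (Γ n).d) (𝒰 : Filter ℕ) atTop) {β0 γ0 β γ s : ℕ} {u y2 : ℝ}
    (hu : 0 < u) (huy : u < y2) (hy2 : y2 < 1) (hβ0 : 1 ≤ β0) (hγ0 : 1 ≤ γ0) (hsum0 : β0 + γ0 ≤ k)
    (hlt : |Real.sqrt β - Real.sqrt γ| < Real.sqrt β0 - Real.sqrt γ0)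
    (hs : ∀ y, 0 < y → y < u → ∀ᶠ n in (𝒰 : Filter ℕ), ∀ i, s ≤ i → i ≤ ⌊y * (Γ n).d⌋₊ →
      (Γ n).b i = β0 ∧ (Γ n).c i = γ0)
    (hW : ∀ y, u < y → y ≤ y2 → B y = β ∧ C y = γ) : False := by
  obtain ⟨pE, pA, hpoly⟩ := exists_prefix_polynomials 𝒰 hd s (Real.sqrt ((β0 * γ0 : ℕ) : ℝ))
    ((k - β0 - γ0 : ℕ) : ℝ)
  obtain ⟨hWB, hWC⟩ := hW y2 huy le_rfl
  have hβ : 1 ≤ β := hWB ▸ hp.bpos (by linarith) hy2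
  have hγ : 1 ≤ γ := hWC ▸ hp.cpos (by linarith) hy2
  have hsum : β + γ ≤ k := by
    have := hp.add_le (y := y2) (by linarith) hy2
    omega
  have hν : 0 < min (u / 4) ((y2 - u) / 4) := lt_min (by linarith) (by linarith)
  refine false_of_split hk hd hsum0 hβ hγ hsum hlt (hpoly.mono fun n hn x => (hn x).1)
    (hpoly.mono fun n hn x => (hn x).2) hν fun N => ?_
  obtain ⟨ε, hε, hε1, hε2, hε3⟩ : ∃ ε : ℝ, 0 < ε ∧ ε ≤ u / 4 ∧ ε ≤ (y2 - u) / 2 ∧ N * ε ≤ u / 8 := by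
    have hN : (0 : ℝ) < 8 * (N + 1) := by positivity
    refine ⟨min (u / 4) (min ((y2 - u) / 2) (u / (8 * (N + 1)))), ?_, min_le_left _ _,
      (min_le_right _ _).trans (min_le_left _ _), ?_⟩
    · exact lt_min (by linarith) (lt_min (by linarith) (by positivity))
    · calc N * min (u / 4) (min ((y2 - u) / 2) (u / (8 * (N + 1)))) ≤
          (N + 1) * (u / (8 * (N + 1))) := by
            gcongr
            · linarith
            · exact (min_le_right _ _).trans (min_le_right _ _)
        _ = u / 8 := by field_simp
  have hW1 := hW (u + ε) (by linarith) (by linarith)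
  filter_upwards [hs (u - ε) (by linarith) (by linarith),
    hp.eventually_const (y := u + ε) (y' := y2) (by linarith) (by linarith) hy2 hW1.1 hWB hW1.2 hWC,
    eventually_mul_natCast_ge hd (by linarith : 0 < u / 4) (s + 2 + 3 * N),
    eventually_mul_natCast_ge hd (by linarith : 0 < (y2 - u) / 4) 1] with n h1 h2 h3 h4
  set d := (Γ n).d with hdn
  have hd0 : (0 : ℝ) ≤ d := Nat.cast_nonneg d
  have f1 := Nat.lt_floor_add_one ((u - ε) * d)
  have f2 := Nat.floor_le (a := (u + ε) * d) (by positivity)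
  have f3 := Nat.lt_floor_add_one (y2 * (d : ℝ))
  have g1 : ⌊(u - ε) * d⌋₊ ≤ ⌊(u + ε) * d⌋₊ := by gcongr; linarith
  have g2 : ⌊(u + ε) * d⌋₊ ≤ ⌊y2 * d⌋₊ := by gcongr; linarith
  have g3 : ⌊y2 * d⌋₊ ≤ d := Nat.floor_mul_natCast_le hy2.le d
  set e1 := ⌊(u - ε) * d⌋₊
  set e2 := ⌊(u + ε) * d⌋₊
  set e3 := ⌊y2 * d⌋₊
  have hN0 : (0 : ℝ) ≤ N := Nat.cast_nonneg N
  have m1 : ε * d ≤ u / 4 * d := mul_le_mul_of_nonneg_right hε1 hd0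
  have m2 : ε * d ≤ (y2 - u) / 2 * d := mul_le_mul_of_nonneg_right hε2 hd0
  have m3 : N * ε * d ≤ u / 8 * d := mul_le_mul_of_nonneg_right hε3 hd0
  have hse : s ≤ e1 := by
    have : (s : ℝ) < e1 + 1 := by linarith
    have : s < e1 + 1 := by exact_mod_cast this
    omega
  have c1 : ((e1 - s : ℕ) : ℝ) = e1 - s := Nat.cast_sub hse
  have c2 : ((e3 - e2 : ℕ) : ℝ) = e3 - e2 := Nat.cast_sub g2
  have c3 : ((e2 - s - (e1 - s) : ℕ) : ℝ) = e2 - e1 := by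
    rw [← Nat.cast_sub g1]
    congr 1
    omega
  refine ⟨e1 - s, e2, e3 - e2, Window.of_const (by omega) hβ0 hγ0 fun i i1 i2 => h1 i i1 (by omega),
    Window.of_const (by omega) hβ hγ fun i i1 i2 => h2 i i1 (by omega), ?_, ?_, by omega, ?_⟩
  · rw [c1]
    have := mul_le_mul_of_nonneg_right (min_le_left (u / 4) ((y2 - u) / 4)) hd0
    linarith
  · rw [c2]
    have := mul_le_mul_of_nonneg_right (min_le_right (u / 4) ((y2 - u) / 4)) hd0
    linarith
  · have : (N : ℝ) * ((e2 - s - (e1 - s) : ℕ) + 1) + 1 ≤ ((e1 - s : ℕ) : ℝ) := by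
      rw [c1, c3]
      have : (N : ℝ) * ((e2 : ℝ) - e1 + 1) ≤ N * (2 * (ε * d) + 2) :=
        mul_le_mul_of_nonneg_left (by linarith) hN0
      linarith
    exact_mod_cast this

/-- The limiting shape cannot consist of one part followed by the reversed part. -/
lemma Profile.false_of_reversal (hp : Profile Γ 𝒰 B C) (hk : 3 ≤ k)
    (hd : Tendsto (fun n => (Γ n).d) (𝒰 : Filter ℕ) atTop) {β0 γ0 s : ℕ} {u : ℝ}
    (hu : 0 < u) (hu1 : u ≤ 1) (hβ0 : 1 ≤ β0) (hγ0 : 1 ≤ γ0) (hsum0 : β0 + γ0 ≤ k)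
    (hs : ∀ y, 0 < y → y < u → ∀ᶠ n in (𝒰 : Filter ℕ), ∀ i, s ≤ i → i ≤ ⌊y * (Γ n).d⌋₊ →
      (Γ n).b i = β0 ∧ (Γ n).c i = γ0)
    (hrev : ∀ y, u < y → y < 1 → B y = γ0 ∧ C y = β0) : False := by
  classical
  set N := β0 * γ0 with hN
  set α := k - β0 - γ0 with hα
  have hN1 : 1 ≤ N := Nat.mul_pos hβ0 hγ0
  obtain ⟨pE, pA, hpoly⟩ := exists_prefix_polynomials 𝒰 hd s (Real.sqrt (N : ℝ)) (α : ℝ)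
  have hsN : Real.sqrt N ≠ 0 := (Real.sqrt_pos.2 (by exact_mod_cast hN1)).ne'
  have hwin : ∀ᶠ n in (𝒰 : Filter ℕ), ∃ l : ℕ, u / 4 * (Γ n).d ≤ l ∧
      (Γ n).Window s l (Real.sqrt N) α := by
    filter_upwards [hs (u / 2) (by linarith) (by linarith),
      eventually_mul_natCast_ge hd (by linarith : 0 < u / 4) (s + 1)] with n h1 h2
    have f1 := Nat.lt_floor_add_one (u / 2 * ((Γ n).d : ℝ))
    have hse : s ≤ ⌊u / 2 * ((Γ n).d : ℝ)⌋₊ := Nat.le_floor (by linarith)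
    have g3 : ⌊u / 2 * ((Γ n).d : ℝ)⌋₊ ≤ (Γ n).d := Nat.floor_mul_natCast_le (by linarith) _
    refine ⟨⌊u / 2 * ((Γ n).d : ℝ)⌋₊ - s, ?_, Window.of_const (by omega) hβ0 hγ0
      fun i i1 i2 => h1 i i1 (by omega)⟩
    rw [Nat.cast_sub hse]
    linarith
  have hP : ∀ᶠ n in (𝒰 : Filter ℕ), ∀ x, (Γ n).E s (Real.sqrt N) α x =
      (pE.comp (Polynomial.C (α : ℝ) + Polynomial.C (Real.sqrt N) * Polynomial.X)).eval
        ((x - α) / Real.sqrt N) := by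
    filter_upwards [hpoly] with n hn x
    rw [(hn x).1, Polynomial.eval_comp]
    congr 1
    simp only [Polynomial.eval_add, Polynomial.eval_C, Polynomial.eval_mul, Polynomial.eval_X]
    field_simp
    ring
  have hbad : ∀ ε : ℝ, 0 < ε → ∀ᶠ n in (𝒰 : Filter ℕ), ∃ S : Finset (Fin ((Γ n).d + 1)),
      (∀ i ∉ S, (Γ n).GoodRow α N i) ∧ (S.card : ℝ) ≤ ε * (Γ n).d := by
    intro ε hε
    obtain ⟨δ, hδ, hδ1, hδ2, hδ3⟩ : ∃ δ : ℝ, 0 < δ ∧ δ ≤ u / 2 ∧ δ ≤ 1 / 2 ∧ δ ≤ ε / 4 :=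
      ⟨min (u / 2) (min (1 / 2) (ε / 4)), lt_min (by linarith) (lt_min (by norm_num) (by linarith)),
        min_le_left _ _, (min_le_right _ _).trans (min_le_left _ _),
        (min_le_right _ _).trans (min_le_right _ _)⟩
    have hR : ∀ᶠ n in (𝒰 : Filter ℕ), ∀ i, ⌊(u + δ) * (Γ n).d⌋₊ < i → i < ⌊(1 - δ) * (Γ n).d⌋₊ →
        ∀ j, i ≤ j + 1 → j ≤ i + 1 → (Γ n).b j = γ0 ∧ (Γ n).c j = β0 := by
      by_cases hle : u + δ ≤ 1 - δ
      · have h1 := hrev (u + δ) (by linarith) (by linarith)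
        have h2 := hrev (1 - δ) (by linarith) (by linarith)
        filter_upwards [hp.eventually_const (by linarith) hle (by linarith) h1.1 h2.1 h1.2 h2.2]
          with n hn i i1 i2 j j1 j2
        exact hn j (by omega) (by omega)
      · refine Eventually.of_forall fun n i i1 i2 => ?_
        have : ⌊(1 - δ) * ((Γ n).d : ℝ)⌋₊ ≤ ⌊(u + δ) * ((Γ n).d : ℝ)⌋₊ := by
          gcongr
          linarith
        omega
    filter_upwards [hR, hs (u - δ) (by linarith) (by linarith),
      eventually_mul_natCast_ge hd (by linarith : 0 < ε / 4) (s + 5)] with n h1 h2 h3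
    refine ⟨Finset.univ.filter fun i => ¬ (Γ n).GoodRow α N i, fun i hi => by simpa using hi, ?_⟩
    set d := (Γ n).d with hdn
    have hd0 : (0 : ℝ) ≤ d := Nat.cast_nonneg d
    have f1 := Nat.lt_floor_add_one ((u - δ) * d)
    have f2 := Nat.floor_le (a := (u + δ) * d) (by positivity)
    have f3 := Nat.lt_floor_add_one ((1 - δ) * (d : ℝ))
    have g1 : ⌊(u - δ) * d⌋₊ ≤ ⌊(u + δ) * d⌋₊ := by gcongr; linarith
    have g2 : ⌊(1 - δ) * d⌋₊ ≤ d := Nat.floor_mul_natCast_le (by linarith) d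
    have g3 : ⌊(u - δ) * d⌋₊ ≤ d := Nat.floor_mul_natCast_le (by linarith) d
    set e1 := ⌊(u - δ) * d⌋₊
    set e2 := ⌊(u + δ) * d⌋₊
    set e3 := ⌊(1 - δ) * d⌋₊
    have hgood : ∀ i ≤ d, s < i → (i < e1 ∨ e2 < i) → i < e3 → (Γ n).GoodRow α N i := by
      intro i hid hsi h4 h5
      have hsum := (Γ n).sum_eq i hid
      rcases h4 with h4 | h4
      · obtain ⟨b1, c1⟩ := h2 i hsi.le h4.le
        refine ⟨by omega, fun _ => ?_, fun _ => ?_⟩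
        · obtain ⟨b2, c2⟩ := h2 (i - 1) (by omega) (by omega)
          rw [r, Nat.sub_add_cancel (by omega), b2, c1, hN, Nat.cast_mul]
        · obtain ⟨b2, c2⟩ := h2 (i + 1) (by omega) (by omega)
          rw [r, b1, c2, hN, Nat.cast_mul]
      · have h6 := h1 i h4 h5
        obtain ⟨b1, c1⟩ := h6 i (by omega) (by omega)
        refine ⟨by omega, fun _ => ?_, fun _ => ?_⟩
        · obtain ⟨b2, c2⟩ := h6 (i - 1) (by omega) (by omega)
          rw [r, Nat.sub_add_cancel (by omega), b2, c1, hN, Nat.cast_mul, mul_comm]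
        · obtain ⟨b2, c2⟩ := h6 (i + 1) (by omega) (by omega)
          rw [r, b1, c2, hN, Nat.cast_mul, mul_comm]
    have hcard : (Finset.univ.filter fun i : Fin (d + 1) => ¬ (Γ n).GoodRow α N i).card ≤
        (s + 1) + (e2 + 1 - e1) + (d + 1 - e3) := by
      rw [← Finset.card_map Fin.valEmbedding]
      calc _ ≤ (Finset.range (s + 1) ∪ Finset.Icc e1 e2 ∪ Finset.Icc e3 d).card := by
            apply Finset.card_le_card
            intro i hi
            simp only [Finset.mem_map, Finset.mem_filter, Finset.mem_univ, true_and,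
              Fin.valEmbedding_apply] at hi
            obtain ⟨j, hj, rfl⟩ := hi
            simp only [Finset.mem_union, Finset.mem_range, Finset.mem_Icc]
            by_contra hcon
            exact hj (hgood j (by omega) (by omega) (by omega) (by omega))
        _ ≤ _ := by
            refine (Finset.card_union_le _ _).trans (add_le_add ((Finset.card_union_le _ _).trans ?_) ?_)
            · simp
            · simp
    have hcard' : ((Finset.univ.filter fun i : Fin (d + 1) => ¬ (Γ n).GoodRow α N i).card : ℝ) ≤
        (s + 1) + (e2 + 1 - e1) + (d + 1 - e3) := by
      have h6 : (((s + 1) + (e2 + 1 - e1) + (d + 1 - e3) : ℕ) : ℝ) =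
          (s + 1) + (e2 + 1 - e1) + (d + 1 - e3) := by
        rw [Nat.cast_add, Nat.cast_add, Nat.cast_sub (by omega), Nat.cast_sub (by omega)]
        push_cast
        ring
      rw [← h6]
      exact_mod_cast hcard
    have m1 : δ * d ≤ ε / 4 * d := mul_le_mul_of_nonneg_right hδ3 hd0
    linarith
  obtain ⟨v, hv, hPv⟩ := eq_smul_arcsineWeight (by omega) Γ hd (by omega : α ≤ k) hN1
    (by rw [sq]; exact Nat.mul_le_mul (by omega) (by omega)) hbad (by linarith : 0 < u / 4) hwin hP
  obtain ⟨n, ⟨l, hl, hwl⟩, h1, h2⟩ := (hwin.and (hP.and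
    (eventually_mul_natCast_ge hd (by linarith : 0 < u / 4) 2))).exists
  refine hwl.E_ne_arcsine hk (by exact_mod_cast h2.trans hl) hv fun x => ?_
  rw [h1 x, hPv, Polynomial.eval_mul, Polynomial.eval_C, arcsineWeight_eval]

end IntArray

namespace IntArray

variable {k : ℕ} {Γ : ℕ → IntArray k} {𝒰 : Ultrafilter ℕ} {B C : ℝ → ℕ}

lemma abs_sqrt_sub_sqrt_lt {β0 γ0 β γ : ℕ} (h1 : γ0 ≤ β) (h2 : β ≤ β0) (h3 : γ0 ≤ γ) (h4 : γ ≤ β0)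
    (hne : ¬ (β = β0 ∧ γ = γ0)) (hne' : ¬ (β = γ0 ∧ γ = β0)) :
    |Real.sqrt β - Real.sqrt γ| < Real.sqrt β0 - Real.sqrt γ0 := by
  have key : ∀ {x y : ℕ}, x ≤ β0 → γ0 ≤ y → ¬ (x = β0 ∧ y = γ0) →
      Real.sqrt x - Real.sqrt y < Real.sqrt β0 - Real.sqrt γ0 := by
    intro x y hx hy h
    have a1 : Real.sqrt x ≤ Real.sqrt β0 := Real.sqrt_le_sqrt (by exact_mod_cast hx)
    have a2 : Real.sqrt γ0 ≤ Real.sqrt y := Real.sqrt_le_sqrt (by exact_mod_cast hy)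
    rcases hx.lt_or_eq with hx' | hx'
    · have : Real.sqrt x < Real.sqrt β0 :=
        Real.sqrt_lt_sqrt (Nat.cast_nonneg _) (by exact_mod_cast hx')
      linarith
    · have : Real.sqrt γ0 < Real.sqrt y :=
        Real.sqrt_lt_sqrt (Nat.cast_nonneg _) (by exact_mod_cast (by omega : γ0 < y))
      linarith
  rw [_root_.abs_lt]
  have a1 := key h2 h3 hne
  have a2 := key h4 h1 (fun h => hne' ⟨h.2, h.1⟩)
  constructor <;> linarith

lemma Profile.false_of_forall_initial (hp : Profile Γ 𝒰 B C) (hk : 3 ≤ k)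
    (hd : Tendsto (fun n => (Γ n).d) (𝒰 : Filter ℕ) atTop) {β0 γ0 s : ℕ} {y0 : ℝ}
    (hy0 : 0 < y0) (hy1 : y0 < 1) (hβ0 : 1 ≤ β0) (hγ0 : 1 ≤ γ0) (hsum0 : β0 + γ0 ≤ k)
    (hin : ∀ y, 0 < y → y < 1 → γ0 ≤ B y ∧ B y ≤ β0 ∧ γ0 ≤ C y ∧ C y ≤ β0)
    (h0 : B y0 = β0 ∧ C y0 = γ0)
    (hs : ∀ y, 0 < y → y < 1 → B y = β0 → C y = γ0 →
      ∀ᶠ n in (𝒰 : Filter ℕ), ∀ i, s ≤ i → i ≤ ⌊y * (Γ n).d⌋₊ →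
        (Γ n).b i = β0 ∧ (Γ n).c i = γ0) : False := by
  set S : Set ℝ := {y | 0 < y ∧ y < 1 ∧ B y = β0 ∧ C y = γ0} with hS
  have hy0S : y0 ∈ S := ⟨hy0, hy1, h0⟩
  have hbdd : BddAbove S := ⟨1, fun y hy => hy.2.1.le⟩
  set u := sSup S with hu
  have hu0 : 0 < u := hy0.trans_le (le_csSup hbdd hy0S)
  have hu1 : u ≤ 1 := csSup_le ⟨_, hy0S⟩ fun y hy => hy.2.1.le
  have hs' : ∀ y, 0 < y → y < u → ∀ᶠ n in (𝒰 : Filter ℕ), ∀ i, s ≤ i → i ≤ ⌊y * (Γ n).d⌋₊ →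
      (Γ n).b i = β0 ∧ (Γ n).c i = γ0 := by
    intro y h1 h2
    obtain ⟨y', ⟨h3, h4, h5, h6⟩, h7⟩ := exists_lt_of_lt_csSup ⟨_, hy0S⟩ h2
    have := hin y h1 (h7.trans h4)
    have := hp.anti h1.le h7.le h4
    have := hp.mono h1.le h7.le h4
    exact hs y h1 (h7.trans h4) (by omega) (by omega)
  have hnot : ∀ y, u < y → y < 1 → ¬ (B y = β0 ∧ C y = γ0) := fun y h1 h2 h3 =>
    h1.not_ge (le_csSup hbdd ⟨hu0.trans h1, h2, h3⟩)
  rcases hu1.lt_or_eq with hu1' | hu1'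
  · obtain ⟨y2, h1, h2, h3⟩ := hp.exists_right_limit hu0.le hu1'
    have h4 := hin y2 (hu0.trans h1) h2
    by_cases hrev : B y2 = γ0 ∧ C y2 = β0
    · refine hp.false_of_reversal hk hd hu0 hu1 hβ0 hγ0 hsum0 hs' fun y h5 h6 => ?_
      rcases le_total y y2 with h7 | h7
      · have := h3 y h5 h7
        omega
      · have := hp.anti (hu0.trans h1).le h7 h6
        have := hp.mono (hu0.trans h1).le h7 h6
        have := hin y (hu0.trans h5) h6
        omega
    · exact hp.false_of_turn (by omega) hd hu0 h1 h2 hβ0 hγ0 hsum0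
        (abs_sqrt_sub_sqrt_lt h4.1 h4.2.1 h4.2.2.1 h4.2.2.2 (hnot y2 h1 h2) hrev) hs' h3
  · exact hp.false_of_reversal hk hd hu0 hu1 hβ0 hγ0 hsum0 hs' fun y h5 h6 => by linarith

lemma false_of_tendsto (hk : 3 ≤ k)
    (hd : Tendsto (fun n => (Γ n).d) (𝒰 : Filter ℕ) atTop) : False := by
  obtain ⟨B, C, hp⟩ := exists_profile 𝒰 hd
  obtain ⟨y0, hy0, hy1, hT⟩ := hp.exists_right_limit le_rfl one_pos
  obtain ⟨β0, hB⟩ : ∃ β0, B y0 = β0 := ⟨_, rfl⟩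
  obtain ⟨γ0, hC⟩ : ∃ γ0, C y0 = γ0 := ⟨_, rfl⟩
  rw [hB, hC] at hT
  have hβ0 : 1 ≤ β0 := hB ▸ hp.bpos hy0.le hy1
  have hγ0 : 1 ≤ γ0 := hC ▸ hp.cpos hy0 hy1
  have hsum0 : β0 + γ0 ≤ k := hB ▸ hC ▸ hp.add_le hy0.le hy1
  have hin : ∀ y, 0 < y → y < 1 → γ0 ≤ B y ∧ B y ≤ β0 ∧ γ0 ≤ C y ∧ C y ≤ β0 := by
    intro y h1 h2
    have hm : 0 < min y0 (1 - y) := lt_min hy0 (by linarith)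
    have hm1 := min_le_left y0 (1 - y)
    have hm2 := min_le_right y0 (1 - y)
    obtain ⟨e1, e2⟩ := hT _ hm hm1
    have h3 := hp.cb (y := y) (y' := min y0 (1 - y)) h1.le hm h2 (by linarith) (by linarith)
    have h4 := hp.cb (y := min y0 (1 - y)) (y' := y) hm.le h1 (by linarith) h2 (by linarith)
    rcases le_total y y0 with h5 | h5
    · have := hT y h1 h5
      omega
    · have := hp.anti hy0.le h5 h2
      have := hp.mono hy0.le h5 h2
      omega
  have h0β : γ0 ≤ β0 := hB ▸ (hin y0 hy0 hy1).1
  set s : ℕ → ℕ := fun n => sInf {i | (Γ n).b i = β0 ∧ (Γ n).c i = γ0} with hs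
  have hsle : ∀ n i, (Γ n).b i = β0 → (Γ n).c i = γ0 → s n ≤ i := fun n i h1 h2 =>
    Nat.sInf_le ⟨h1, h2⟩
  have hzone : ∀ y, 0 < y → y < 1 → B y = β0 → C y = γ0 →
      ∀ᶠ n in (𝒰 : Filter ℕ), ∀ i, s n ≤ i → i ≤ ⌊y * (Γ n).d⌋₊ →
        (Γ n).b i = β0 ∧ (Γ n).c i = γ0 := by
    intro y h1 h2 h3 h4
    filter_upwards [hp.eventually_eq h1.le h2] with n hn i i1 i2
    have hid := Nat.floor_mul_natCast_le h2.le (Γ n).d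
    obtain ⟨e1, e2⟩ : (Γ n).b (s n) = β0 ∧ (Γ n).c (s n) = γ0 :=
      Nat.sInf_mem (s := {i | (Γ n).b i = β0 ∧ (Γ n).c i = γ0})
        ⟨_, hn.1.trans h3, hn.2.trans h4⟩
    have := (Γ n).banti _ _ i1 (i2.trans hid)
    have := (Γ n).banti _ _ i2 hid
    have := (Γ n).cmono _ _ i1 (i2.trans hid)
    have := (Γ n).cmono _ _ i2 hid
    omega
  by_cases hbd : ∃ M, ∀ᶠ n in (𝒰 : Filter ℕ), s n ≤ M
  · obtain ⟨M, hM⟩ := hbd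
    obtain ⟨s0, hs0⟩ := 𝒰.exists_eventually_eq_of_le hM
    refine hp.false_of_forall_initial hk hd hy0 hy1 hβ0 hγ0 hsum0 hin ⟨hB, hC⟩
      (s := s0) fun y h1 h2 h3 h4 => ?_
    filter_upwards [hzone y h1 h2 h3 h4, hs0] with n h5 h6
    rwa [h6] at h5
  · have hunb : ∀ M, ∀ᶠ n in (𝒰 : Filter ℕ), M < s n := fun M =>
      (Ultrafilter.eventually_not.2 fun h => hbd ⟨M, h⟩).mono fun n hn => not_le.1 hn
    have hhalf := hT (y0 / 2) (by linarith) (by linarith)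
    have hsy : ∀ᶠ n in (𝒰 : Filter ℕ), s n ≤ ⌊y0 / 2 * (Γ n).d⌋₊ := by
      filter_upwards [hp.eventually_eq (y := y0 / 2) (by linarith) (by linarith)] with n hn
      exact hsle n _ (hn.1.trans hhalf.1) (hn.2.trans hhalf.2)
    have hsd : ∀ᶠ n in (𝒰 : Filter ℕ), s n ≤ (Γ n).d :=
      hsy.mono fun n hn => hn.trans (Nat.floor_mul_natCast_le (by linarith) _)
    obtain ⟨β', hβ'⟩ := 𝒰.exists_eventually_eq_of_le (hsd.mono fun n hn =>
      (Γ n).b_le ((Nat.sub_le (s n) 1).trans hn))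
    obtain ⟨γ', hγ'⟩ := 𝒰.exists_eventually_eq_of_le (hsd.mono fun n hn =>
      (Γ n).c_le ((Nat.sub_le (s n) 1).trans hn))
    have hz := hzone y0 hy0 hy1 hB hC
    have hsl : ∀ᶠ n in (𝒰 : Filter ℕ), s n ≤ ⌊y0 * (Γ n).d⌋₊ := by
      filter_upwards [hsy] with n hn
      refine hn.trans ?_
      gcongr
      linarith
    obtain ⟨n, h1, h2, h3, h4, h5, h6⟩ :=
      (hβ'.and (hγ'.and (hz.and (hsl.and (hsd.and (hunb 1)))))).exists
    obtain ⟨e1, e2⟩ := h3 (s n) le_rfl h4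
    have g1 := (Γ n).cpos (s n - 1) (by omega) (by omega)
    have g2 := (Γ n).cmono (s n - 1) (s n) (by omega) h5
    have g3 := (Γ n).banti (s n - 1) (s n) (by omega) h5
    have g4 : ¬ (β' = β0 ∧ γ' = γ0) := by
      intro h
      have := hsle n (s n - 1) (h1.trans h.1) (h2.trans h.2)
      omega
    refine false_of_long_initial (by omega) hd (by omega) (by omega) h0β (by omega) g4 hsum0
      (by linarith : 0 < y0 / 4) fun s0 => ?_
    filter_upwards [hβ', hγ', hz, hsl, hsy, hunb (s0 + 1),
      eventually_mul_natCast_ge hd (by linarith : 0 < y0 / 4) 1] with n h1 h2 h3 h4 h5 h6 h7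
    have g5 : ⌊y0 * ((Γ n).d : ℝ)⌋₊ ≤ (Γ n).d := Nat.floor_mul_natCast_le hy1.le _
    refine ⟨s n - 1, ⌊y0 * (Γ n).d⌋₊ - s n, by omega, h1, h2, ?_, ?_⟩
    · rw [Nat.sub_add_cancel (by omega)]
      exact Window.of_const (by omega) hβ0 hγ0 fun i i1 i2 => h3 i i1 (by omega)
    · rw [Nat.cast_sub h4]
      have f1 := Nat.lt_floor_add_one (y0 * ((Γ n).d : ℝ))
      have f2 : (s n : ℝ) ≤ y0 / 2 * (Γ n).d :=
        (Nat.cast_le.2 h5).trans (Nat.floor_le (by positivity))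
      linarith

/-- For a fixed valency at least three, the diameters are bounded. -/
theorem exists_d_le (hk : 3 ≤ k) : ∃ D, ∀ Γ : IntArray k, Γ.d ≤ D := by
  by_contra! h
  choose Γ hΓ using h
  refine false_of_tendsto (Γ := Γ) (𝒰 := Filter.hyperfilter ℕ) hk ?_
  exact (tendsto_atTop_mono (fun n => (hΓ n).le) tendsto_id).mono_left
    (Nat.hyperfilter_le_atTop)

end IntArray

lemma DRG.exists_d_le {k : ℕ} (hk : k ≠ 2) : ∃ D, ∀ Γ : DRG, Γ.b 0 = k → Γ.d ≤ D := by
  rcases Nat.lt_or_ge k 3 with h3 | h3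
  · refine ⟨1, fun Γ hΓ => ?_⟩
    by_contra! hd
    have := Γ.b_pos (i := 1) hd
    have := Γ.c_pos le_rfl hd.le
    have := Γ.sum_abc hd.le
    omega
  · obtain ⟨D, hD⟩ := IntArray.exists_d_le h3
    refine ⟨max D 1, fun Γ hΓ => ?_⟩
    subst hΓ
    by_cases hd : 2 ≤ Γ.d
    · exact (hD (Γ.intArray hd)).trans (le_max_left _ _)
    · exact le_max_of_le_right (by omega)

section ValencyDichotomy

variable {Λ : Type*} [Preorder Λ]

lemma eventually_valency_eq_two_or_lt {Γ : Λ → DRG}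
    (hd : Tendsto (fun l => (Γ l).d) atTop atTop) (K : ℕ) :
    ∀ᶠ l in (atTop : Filter Λ), (Γ l).b 0 = 2 ∨ K < (Γ l).b 0 := by
  have h : ∀ k, ∃ D, k ≠ 2 → ∀ Γ : DRG, Γ.b 0 = k → Γ.d ≤ D := by
    intro k
    by_cases hk : k = 2
    · exact ⟨0, fun h => absurd hk h⟩
    · obtain ⟨D, hD⟩ := DRG.exists_d_le hk
      exact ⟨D, fun _ => hD⟩
  choose D hD using h
  filter_upwards [hd.eventually_gt_atTop ((Finset.range (K + 1)).sup D)] with l hl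
  by_contra! hcon
  have h1 := hD _ hcon.1 (Γ l) rfl
  have h2 := Finset.le_sup (f := D) (Finset.mem_range.2 (Nat.lt_add_one_of_le hcon.2))
  omega

lemma eventually_valency_eq_two_or_tendsto {Γ : Λ → DRG} {t : Λ → ℝ}
    (hvar : ∀ l, 0 < sig2 Γ t l) (hd : Tendsto (fun l => (Γ l).d) atTop atTop) {ω αl : ℕ → ℝ}
    (hDR : AssumptionDR Γ t ω αl) :
    (∀ᶠ l in (atTop : Filter Λ), (Γ l).b 0 = 2) ∨
      Tendsto (fun l => ((Γ l).b 0 : ℝ)) atTop atTop := by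
  by_contra hcon
  obtain ⟨hne, hnt⟩ := not_or.1 hcon
  obtain ⟨hω1, ht1, ha1⟩ := hDR 1 le_rfl
  obtain ⟨-, ht2, ha2⟩ := hDR 2 one_le_two
  have hsig : ∀ᶠ l in (atTop : Filter Λ), omegaBar Γ t 1 l * sig2 Γ t l = (Γ l).b 0 ∧
      omegaBar Γ t 2 l * sig2 Γ t l = (Γ l).c 2 * (Γ l).b 1 := by
    filter_upwards [hd.eventually_ge_atTop 1] with l hl
    rw [omegaBar, omegaBar, div_mul_cancel₀ _ (hvar l).ne', div_mul_cancel₀ _ (hvar l).ne',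
      (Γ l).c_one hl]
    simp
  have hfreq : ∃ᶠ l in (atTop : Filter Λ), (Γ l).b 0 = 2 := by
    intro h
    apply hnt
    rw [tendsto_natCast_atTop_iff, tendsto_atTop]
    intro K
    filter_upwards [h, eventually_valency_eq_two_or_lt hd K] with l h1 h2
    exact (h2.resolve_left h1).le
  have hlim : Tendsto (fun l => 2 * omegaBar Γ t 2 l - omegaBar Γ t 1 l) atTop
      (nhds (2 * ω 2 - ω 1)) := (ht2.const_mul 2).sub ht1
  have h0 : 2 * ω 2 - ω 1 = 0 := by
    by_contra h0
    apply hfreq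
    filter_upwards [hlim.eventually_ne h0, hsig, hd.eventually_ge_atTop 3] with l h1 h2 h3 h4
    have := (Γ l).b_pos (i := 1) (by omega)
    have := (Γ l).c_pos (i := 1) le_rfl (by omega)
    have := (Γ l).sum_abc (i := 1) (by omega)
    have := (Γ l).b_pos (i := 2) (by omega)
    have := (Γ l).c_pos (i := 2) (by omega) (by omega)
    have := (Γ l).sum_abc (i := 2) (by omega)
    rw [h4, (by omega : (Γ l).b 1 = 1), (by omega : (Γ l).c 2 = 1)] at h2
    apply h1
    apply mul_right_cancel₀ (hvar l).ne'
    rw [zero_mul, sub_mul, mul_assoc, h2.1, h2.2]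
    norm_num
  rw [h0] at hlim
  set M := αl 2 - αl 1 + 1 with hM
  obtain ⟨K, hK⟩ := exists_nat_gt (18 * M ^ 2 / ω 1)
  apply hne
  filter_upwards [eventually_valency_eq_two_or_lt hd (K + 12), hsig, hd.eventually_ge_atTop 3,
    hlim.eventually_le_const (by positivity : 0 < ω 1 / 12),
    ht1.eventually_const_le (by linarith : ω 1 / 2 < ω 1),
    (ha2.sub ha1).eventually_le_const (by linarith : αl 2 - αl 1 < M)] with l h1 h2 h3 h4 h5 h6
  refine h1.resolve_right fun h1 => ?_
  have hs := hvar l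
  set σ := sig2 Γ t l with hσ
  obtain ⟨e1, e2⟩ := h2
  have hsum := (Γ l).sum_abc (i := 1) (by omega)
  rw [(Γ l).c_one (by omega)] at hsum
  have hsum' : ((Γ l).a 1 : ℝ) + (Γ l).b 1 + 1 = (Γ l).b 0 := by exact_mod_cast hsum
  have hk : (K : ℝ) + 12 < (Γ l).b 0 := by exact_mod_cast h1
  have hc2 : (1 : ℝ) ≤ (Γ l).c 2 := by exact_mod_cast (Γ l).c_pos (i := 2) (by omega) (by omega)
  have hb1 : ((Γ l).b 1 : ℝ) ≤ (Γ l).c 2 * (Γ l).b 1 :=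
    le_mul_of_one_le_left (Nat.cast_nonneg _) hc2
  have e3 := mul_le_mul_of_nonneg_right h4 hs.le
  have e4 := mul_le_mul_of_nonneg_right h5 hs.le
  rw [sub_mul, mul_assoc, e1, e2] at e3
  rw [e1] at e4
  have ha : ((Γ l).b 0 : ℝ) / 3 ≤ (Γ l).a 1 := by
    have : (0 : ℝ) ≤ K := Nat.cast_nonneg K
    linarith
  have e5 : ((Γ l).a 1 : ℝ) ≤ M * Real.sqrt σ := by
    rw [← div_le_iff₀ (Real.sqrt_pos.2 hs)]
    refine le_trans (le_of_eq ?_) h6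
    rw [alphaBar, alphaBar, ← sub_div, Nat.sub_self, (Γ l).a_zero]
    simp [hσ]
  have hk0 : (0 : ℝ) < (Γ l).b 0 := by
    have : (0 : ℝ) ≤ K := Nat.cast_nonneg K
    linarith
  have e6 : ((Γ l).b 0 / 3 : ℝ) ^ 2 ≤ M ^ 2 * σ := by
    calc ((Γ l).b 0 / 3 : ℝ) ^ 2 ≤ (M * Real.sqrt σ) ^ 2 :=
          pow_le_pow_left₀ (by positivity) (ha.trans e5) 2
      _ = M ^ 2 * σ := by rw [mul_pow, Real.sq_sqrt hs.le]
  rw [div_lt_iff₀ hω1] at hK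
  have e7 : (18 * M ^ 2) * (Γ l).b 0 < ((Γ l).b 0 * ω 1) * (Γ l).b 0 := by
    refine mul_lt_mul_of_pos_right (hK.trans ?_) hk0
    exact mul_lt_mul_of_pos_right (by linarith) hω1
  have e8 := mul_le_mul_of_nonneg_left e4 (sq_nonneg M)
  have e9 := mul_le_mul_of_nonneg_left e6 hω1.le
  linarith

end ValencyDichotomy

lemma existsUnique_mapClusterPt_of_tendsto {ι X : Type*} [TopologicalSpace X] [T2Space X]
    {F : Filter ι} [NeBot F] {f : ι → X} {x : X} (h : Tendsto f F (nhds x)) :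
    ∃! ξ, MapClusterPt ξ F f := by
  refine ⟨x, h.mapClusterPt, fun ξ hξ => ?_⟩
  have : NeBot (nhds ξ ⊓ nhds x) := NeBot.mono hξ (inf_le_inf_left _ h)
  exact eq_of_nhds_neBot this

/-- Under Assumption (DR), the net `λ ↦ 1/k(λ)` has exactly one accumulation point;
more precisely, either `k = 2` eventually, or `k → ∞`. -/
theorem stmt11 {Λ : Type*} [Preorder Λ] [IsDirected Λ (· ≤ ·)] [Nonempty Λ] [Infinite Λ]
    (Γ : Λ → DRG) (t : Λ → ℝ)
    (hpi : ∀ l : Λ, (Γ l).piMem (t l))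
    (hvar : ∀ l : Λ, 0 < sig2 Γ t l)
    (hd : Tendsto (fun l : Λ => (Γ l).d) atTop atTop)
    (ω αl : ℕ → ℝ) (hDR : AssumptionDR Γ t ω αl) :
    (∃! ξ : ℝ, MapClusterPt ξ atTop (fun l : Λ => 1 / ((Γ l).b 0 : ℝ))) ∧
    ((∀ᶠ l in (atTop : Filter Λ), (Γ l).b 0 = 2) ∨
      Tendsto (fun l : Λ => ((Γ l).b 0 : ℝ)) atTop atTop) := by
  have h := eventually_valency_eq_two_or_tendsto hvar hd hDR
  refine ⟨?_, h⟩
  rcases h with h | h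
  · refine existsUnique_mapClusterPt_of_tendsto (x := 1 / (2 : ℝ)) ?_
    refine tendsto_const_nhds.congr' ?_
    filter_upwards [h] with l hl
    rw [hl, Nat.cast_ofNat]
  · exact existsUnique_mapClusterPt_of_tendsto (tendsto_const_nhds.div_atTop h)
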